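/- arXiv:1505.07229 — 5 statements merged into one kernel-verified Lean document; each statement's English description precedes it below -/
import Mathlib

section
/- For every integer n ≥ 1, the polynomial C_n(X) ∈ ℤ[X] satisfies C_n(−1) = r(n), where r(n) is the number of pairs (x,y) ∈ ℤ × ℤ with x² + y² = n. -/
/-- The coefficients `c_{n,i}` from the paper. -/
def cCoeff (n i : ℕ) : ℤ :=
  if i = 0 then
    ∑ k ∈ Finset.Icc 1 (2 * n), if 2 * n = k * (k + 1) then 2 * (-1 : ℤ) ^ k else 0
  else
    ∑ k ∈ Finset.Icc 1 (2 * n),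
      ((if 2 * n = k * (k + 2 * i + 1) then (-1 : ℤ) ^ k else 0) +
        (if 2 * n = k * (k + 2 * i - 1) then (-1 : ℤ) ^ (k - 1) else 0))

/-- The polynomial `C_n(X) = c_{n,0} X^n + ∑_{i=1}^n c_{n,i} (X^{n+i} + X^{n-i}) ∈ ℤ[X]`. -/
noncomputable def Cpoly (n : ℕ) : Polynomial ℤ :=
  Polynomial.C (cCoeff n 0) * Polynomial.X ^ n +
    ∑ i ∈ Finset.Icc 1 n,
      Polynomial.C (cCoeff n i) * (Polynomial.X ^ (n + i) + Polynomial.X ^ (n - i))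

open Finset in
lemma eval_step (n : ℕ) (hn : 1 ≤ n) :
    (Cpoly n).eval (-1) =
      4 * ∑ j ∈ range n, ∑ k ∈ Icc 1 (2 * n),
        if 2 * n = k * (k + 2 * j + 1) then (-1 : ℤ) ^ (n + j + k) else 0 := by
  have hA : ∀ i ∈ Icc 1 n, (cCoeff n i) * ((-1 : ℤ) ^ (n + i) + (-1) ^ (n - i)) =
      2 * (∑ k ∈ Icc 1 (2 * n),
        if 2 * n = k * (k + 2 * i + 1) then (-1 : ℤ) ^ (n + i + k) else 0) +
      2 * (∑ k ∈ Icc 1 (2 * n),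
        if 2 * n = k * (k + 2 * (i - 1) + 1) then (-1 : ℤ) ^ (n + (i - 1) + k) else 0) := by
    intro i hi
    rw [mem_Icc] at hi
    have e1 : (-1 : ℤ) ^ (n - i) = (-1) ^ (n + i) := by
      rw [show n + i = (n - i) + 2 * i by omega, pow_add, pow_mul]; simp
    rw [e1, cCoeff, if_neg (by omega), sum_mul, mul_sum, mul_sum, ← sum_add_distrib]
    refine sum_congr rfl fun k hk => ?_
    rw [mem_Icc] at hk
    rw [show k + 2 * (i - 1) + 1 = k + 2 * i - 1 by omega]
    have e2 : (-1 : ℤ) ^ (k - 1) * (-1) ^ (n + i) = (-1) ^ (n + (i - 1) + k) := by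
      rw [← pow_add, show k - 1 + (n + i) = n + (i - 1) + k by omega]
    have e3 : (-1 : ℤ) ^ k * (-1) ^ (n + i) = (-1) ^ (n + i + k) := by
      rw [← pow_add, add_comm]
    rw [← e2, ← e3]
    split_ifs <;> ring
  have h0 : (cCoeff n 0) * (-1 : ℤ) ^ n = 2 * (∑ k ∈ Icc 1 (2 * n),
        if 2 * n = k * (k + 2 * 0 + 1) then (-1 : ℤ) ^ (n + 0 + k) else 0) := by
    rw [cCoeff, if_pos rfl, sum_mul, mul_sum]
    refine sum_congr rfl fun k hk => ?_
    simp only [mul_zero, add_zero, pow_add]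
    split_ifs <;> ring
  have hlast : (∑ k ∈ Icc 1 (2 * n),
        if 2 * n = k * (k + 2 * n + 1) then (-1 : ℤ) ^ (n + n + k) else 0) = 0 := by
    refine sum_eq_zero fun k hk => ?_
    rw [mem_Icc] at hk
    rw [if_neg]
    nlinarith
  have h1 : (Cpoly n).eval (-1) = (cCoeff n 0) * (-1 : ℤ) ^ n +
      ∑ i ∈ Icc 1 n, (cCoeff n i) * ((-1 : ℤ) ^ (n + i) + (-1) ^ (n - i)) := by
    simp [Cpoly, Polynomial.eval_finsetSum]
  rw [h1, sum_congr rfl hA, h0, sum_add_distrib, ← mul_sum, ← mul_sum]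
  generalize hg : (fun j => ∑ k ∈ Icc 1 (2 * n),
        if 2 * n = k * (k + 2 * j + 1) then (-1 : ℤ) ^ (n + j + k) else 0) = g
  have hg' := fun j => congrFun hg j
  simp only [hg'] at hlast ⊢
  have e4 : ∑ i ∈ Icc 1 n, g i = ∑ j ∈ range n, g (j + 1) := by
    rw [range_eq_Ico, sum_Ico_add' g 0 n 1]
    exact sum_congr (by ext; simp only [mem_Icc, mem_Ico]; omega) fun _ _ => rfl
  have e5 : ∑ i ∈ Icc 1 n, g (i - 1) = ∑ j ∈ range n, g j := by
    rw [range_eq_Ico, show (Icc 1 n) = Ico (0 + 1) (n + 1) by ext; simp only [mem_Icc, mem_Ico]; omega,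
      ← sum_Ico_add' (fun i => g (i - 1)) 0 n 1]
    rfl
  have e6 : g 0 + ∑ j ∈ range n, g (j + 1) = ∑ j ∈ range n, g j := by
    have := sum_range_succ g n
    have h2 := sum_range_succ' g n
    rw [hlast] at this
    linarith
  have hg0 := hg' 0
  rw [e4, e5, hg0]
  linarith

def fdiv (n : ℕ) : ℤ := ∑ d ∈ n.divisors, ZMod.χ₄ (d : ZMod 4)

open Finset in
lemma sum_step (n : ℕ) (hn : 1 ≤ n) :
    (∑ j ∈ range n, ∑ k ∈ Icc 1 (2 * n),
        if 2 * n = k * (k + 2 * j + 1) then (-1 : ℤ) ^ (n + j + k) else 0) = fdiv n := by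
  have hf : fdiv n = ∑ d ∈ n.divisors with d % 2 = 1, ZMod.χ₄ (d : ZMod 4) := by
    rw [fdiv, sum_filter]
    refine sum_congr rfl fun d _ => ?_
    split_ifs with h
    · rfl
    · rw [ZMod.χ₄_nat_eq_if_mod_four, if_pos (by omega)]
  rw [hf, ← sum_product', ← sum_filter]
  refine sum_nbij' (fun x => if x.2 % 2 = 1 then x.2 else x.2 + 2 * x.1 + 1)
    (fun d => ((max d (2 * n / d) - min d (2 * n / d) - 1) / 2, min d (2 * n / d))) ?_ ?_ ?_ ?_ ?_
  · rintro ⟨j, k⟩ h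
    simp only [mem_filter, mem_product, mem_range, mem_Icc, Nat.mem_divisors] at h ⊢
    obtain ⟨⟨hj, hk⟩, h⟩ := h
    split_ifs with hk2
    · refine ⟨⟨?_, by omega⟩, hk2⟩
      obtain ⟨k', rfl⟩ : ∃ k', k = 2 * k' + 1 := ⟨k / 2, by omega⟩
      exact ⟨k' + j + 1, by nlinarith⟩
    · refine ⟨⟨?_, by omega⟩, by omega⟩
      obtain ⟨k', rfl⟩ : ∃ k', k = 2 * k' := ⟨k / 2, by omega⟩
      exact ⟨k', by nlinarith⟩
  · intro d h
    simp only [mem_filter, mem_product, mem_range, mem_Icc, Nat.mem_divisors] at h ⊢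
    obtain ⟨⟨⟨e, rfl⟩, h0⟩, hd⟩ := h
    have hd0 : 0 < d := by omega
    have he0 : 0 < e := by
      rcases Nat.eq_zero_or_pos e with h | h
      · subst h; omega
      · exact h
    rw [show 2 * (d * e) / d = 2 * e by
      rw [show 2 * (d * e) = d * (2 * e) by ring]; exact Nat.mul_div_cancel_left _ hd0]
    have h1 : d ≤ d * e := Nat.le_mul_of_pos_right _ he0
    have h2 : e ≤ d * e := Nat.le_mul_of_pos_left _ hd0
    rcases le_total d (2 * e) with h | h
    · rw [max_eq_right h, min_eq_left h]
      refine ⟨⟨by omega, by omega, by omega⟩, ?_⟩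
      rw [show d + 2 * ((2 * e - d - 1) / 2) + 1 = 2 * e by omega]; ring
    · rw [max_eq_left h, min_eq_right h]
      refine ⟨⟨by omega, by omega, by omega⟩, ?_⟩
      rw [show 2 * e + 2 * ((d - 2 * e - 1) / 2) + 1 = d by omega]; ring
  · rintro ⟨j, k⟩ h
    simp only [mem_filter, mem_product, mem_range, mem_Icc] at h ⊢
    obtain ⟨⟨hj, hk⟩, h⟩ := h
    rw [h]
    split_ifs with hk2
    · rw [Nat.mul_div_cancel_left _ (by omega : 0 < k)]
      rw [Prod.mk.injEq]; omega
    · rw [Nat.mul_div_cancel _ (by omega)]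
      rw [Prod.mk.injEq]; omega
  · intro d h
    simp only [mem_filter, Nat.mem_divisors] at h ⊢
    obtain ⟨⟨⟨e, rfl⟩, h0⟩, hd⟩ := h
    have hd0 : 0 < d := by omega
    rw [show 2 * (d * e) / d = 2 * e by
      rw [show 2 * (d * e) = d * (2 * e) by ring]; exact Nat.mul_div_cancel_left _ hd0]
    split_ifs <;> omega
  · rintro ⟨j, k⟩ h
    simp only [mem_filter, mem_product, mem_range, mem_Icc] at h ⊢
    obtain ⟨⟨hj, hk⟩, h⟩ := h
    split_ifs with hk2
    · rw [ZMod.χ₄_eq_neg_one_pow hk2]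
      obtain ⟨k', rfl⟩ : ∃ k', k = 2 * k' + 1 := ⟨k / 2, by omega⟩
      have : n = (2 * k' + 1) * (k' + j + 1) := by nlinarith
      rw [show n + j + (2 * k' + 1) = 2 * (k' * (k' + j + 1) + j + k' + 1) + k' by
        rw [this]; ring, show (2 * k' + 1) / 2 = k' by omega, pow_add, pow_mul]
      simp
    · rw [ZMod.χ₄_eq_neg_one_pow (by omega)]
      obtain ⟨k', rfl⟩ : ∃ k', k = 2 * k' := ⟨k / 2, by omega⟩
      have : n = k' * (2 * k' + 2 * j + 1) := by nlinarith
      rw [show n + j + (2 * k') = 2 * (k' * (k' + j) + k') + (k' + j) by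
        rw [this]; ring, show (2 * k' + 2 * j + 1) / 2 = k' + j by omega, pow_add, pow_mul]
      simp

open Finset in
/-- Hecke recursion for the divisor sum. -/
lemma fdiv_prime_mul (p n : ℕ) (hp : p.Prime) (hn : n ≠ 0) :
    fdiv (p * n) + ZMod.χ₄ (p : ZMod 4) * (if p ∣ n then fdiv (n / p) else 0) =
      (1 + ZMod.χ₄ (p : ZMod 4)) * fdiv n := by
  have hmul : ∀ m, ∑ d ∈ (m.divisors.image (fun e : ℕ => p * e) : Finset ℕ), ZMod.χ₄ (d : ZMod 4) =
      ZMod.χ₄ (p : ZMod 4) * fdiv m := by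
    intro m
    rw [sum_image (g := fun e : ℕ => p * e) (fun a _ b _ h => Nat.eq_of_mul_eq_mul_left hp.pos h), fdiv, mul_sum]
    refine sum_congr rfl fun d _ => ?_
    rw [Nat.cast_mul, map_mul]
  have hU : (p * n).divisors = n.divisors ∪ n.divisors.image (fun e : ℕ => p * e) := by
    ext d
    simp only [mem_union, mem_image, Nat.mem_divisors]
    constructor
    · rintro ⟨h, h0⟩
      by_cases hpd : p ∣ d
      · obtain ⟨e, rfl⟩ := hpd
        exact Or.inr ⟨e, ⟨Nat.dvd_of_mul_dvd_mul_left hp.pos h, hn⟩, rfl⟩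
      · exact Or.inl ⟨((hp.coprime_iff_not_dvd.2 hpd).symm).dvd_of_dvd_mul_left h, hn⟩
    · rintro (⟨h, _⟩ | ⟨e, ⟨h, _⟩, rfl⟩)
      · exact ⟨h.mul_left p, mul_ne_zero hp.ne_zero hn⟩
      · exact ⟨Nat.mul_dvd_mul_left p h, mul_ne_zero hp.ne_zero hn⟩
  have hI : ∑ d ∈ n.divisors ∩ n.divisors.image (fun e : ℕ => p * e), ZMod.χ₄ (d : ZMod 4) =
      ZMod.χ₄ (p : ZMod 4) * (if p ∣ n then fdiv (n / p) else 0) := by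
    split_ifs with hpn
    · rw [← hmul]
      refine sum_congr ?_ fun _ _ => rfl
      obtain ⟨m, rfl⟩ := hpn
      rw [Nat.mul_div_cancel_left _ hp.pos]
      have hm : m ≠ 0 := by rintro rfl; simp at hn
      ext d
      simp only [mem_inter, mem_image, Nat.mem_divisors]
      constructor
      · rintro ⟨⟨h, _⟩, e, ⟨h', _⟩, rfl⟩
        exact ⟨e, ⟨Nat.dvd_of_mul_dvd_mul_left hp.pos h, hm⟩, rfl⟩
      · rintro ⟨e, ⟨h', _⟩, rfl⟩
        exact ⟨⟨Nat.mul_dvd_mul_left p h', hn⟩, e, ⟨h'.mul_left p, hn⟩, rfl⟩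
    · rw [mul_zero]
      refine sum_eq_zero fun d hd => ?_
      simp only [mem_inter, mem_image, Nat.mem_divisors] at hd
      obtain ⟨⟨h, _⟩, e, _, rfl⟩ := hd
      exact absurd ((dvd_mul_right p e).trans h) hpn
  have := sum_union_inter (s₁ := n.divisors) (s₂ := n.divisors.image (fun e : ℕ => p * e))
    (f := fun d : ℕ => ZMod.χ₄ (d : ZMod 4))
  rw [← hU, hI, hmul] at this
  simp only [fdiv] at this ⊢
  linarith

def Rset (n : ℕ) : Set (ℤ × ℤ) := {p | p.1 ^ 2 + p.2 ^ 2 = (n : ℤ)}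

lemma Rset_finite (n : ℕ) : (Rset n).Finite := by
  refine Set.Finite.subset (Set.finite_Icc ((-(n : ℤ), -(n : ℤ)) : ℤ × ℤ) ((n : ℤ), (n : ℤ))) ?_
  rintro ⟨x, y⟩ h
  simp only [Rset, Set.mem_ofPred_eq] at h
  simp only [Set.mem_Icc, Prod.mk_le_mk]
  refine ⟨⟨?_, ?_⟩, ?_, ?_⟩ <;> nlinarith [sq_nonneg x, sq_nonneg y]

/-- multiplication by `a + b i` -/
def mulG (a b : ℤ) (z : ℤ × ℤ) : ℤ × ℤ := (a * z.1 - b * z.2, a * z.2 + b * z.1)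

lemma mulG_inj (a b : ℤ) (h : a ^ 2 + b ^ 2 ≠ 0) : Function.Injective (mulG a b) := by
  rintro ⟨x, y⟩ ⟨u, v⟩ e
  simp only [mulG, Prod.mk.injEq] at e ⊢
  obtain ⟨e1, e2⟩ := e
  constructor <;> apply mul_left_cancel₀ h
  · linear_combination a * e1 + b * e2
  · linear_combination a * e2 - b * e1

lemma mulG_mem {a b : ℤ} {m n : ℕ} (h : a ^ 2 + b ^ 2 = m) {z : ℤ × ℤ} (hz : z ∈ Rset n) :
    mulG a b z ∈ Rset (m * n) := by
  simp only [Rset, mulG, Set.mem_ofPred_eq] at hz ⊢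
  push_cast
  rw [← h, ← hz]; ring

/-- criterion for being in the image of multiplication -/
lemma mem_image_mulG {a b : ℤ} {p n : ℕ} (hp : p.Prime) (h : a ^ 2 + b ^ 2 = p) {x y : ℤ}
    (hz : (x, y) ∈ Rset (p * n)) (hd : (p : ℤ) ∣ a * x + b * y) :
    (x, y) ∈ (Set.image (mulG a b) (Rset n)) := by
  have hpi : Prime (p : ℤ) := Nat.prime_iff_prime_int.1 hp
  have hp0 : (p : ℤ) ≠ 0 := hpi.ne_zero
  simp only [Rset, Set.mem_ofPred_eq] at hz
  push_cast at hz
  obtain ⟨u, hu⟩ := hd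
  have : (p : ℤ) ∣ a * y - b * x := by
    apply hpi.dvd_of_dvd_pow (n := 2)
    refine ⟨p * n - p * u ^ 2, ?_⟩
    linear_combination (p : ℤ) * hz - (a * x + b * y + p * u) * hu + (x ^ 2 + y ^ 2) * h
  obtain ⟨v, hv⟩ := this
  refine ⟨(u, v), ?_, ?_⟩
  · simp only [Rset, Set.mem_ofPred_eq]
    apply mul_left_cancel₀ (pow_ne_zero 2 hp0)
    linear_combination (p : ℤ) * hz - (a * x + b * y + p * u) * hu -
      (a * y - b * x + p * v) * hv + (x ^ 2 + y ^ 2) * h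
  · simp only [mulG, Prod.mk.injEq]
    constructor <;> apply mul_left_cancel₀ hp0
    · linear_combination -a * hu + b * hv + x * h
    · linear_combination -a * hv - b * hu + y * h

lemma ncard_image_mulG (a b : ℤ) (h : a ^ 2 + b ^ 2 ≠ 0) (n : ℕ) :
    ((Set.image (mulG a b) (Rset n))).ncard = (Rset n).ncard :=
  Set.ncard_image_of_injective _ (mulG_inj a b h)

/-- points of norm `p * n` divisible by `p` -/
lemma ncard_dvd (p n : ℕ) (hp : p.Prime) :
    ({z ∈ Rset (p * n) | (p : ℤ) ∣ z.1 ∧ (p : ℤ) ∣ z.2}).ncard =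
      if p ∣ n then (Rset (n / p)).ncard else 0 := by
  have hp0 : (p : ℤ) ≠ 0 := by exact_mod_cast hp.ne_zero
  split_ifs with hpn
  · obtain ⟨m, rfl⟩ := hpn
    rw [Nat.mul_div_cancel_left _ hp.pos, ← ncard_image_mulG p 0 (by simpa using hp0) m]
    congr 1
    ext ⟨x, y⟩
    simp only [Rset, mulG, Set.mem_ofPred_eq, Set.mem_image, Prod.exists, Prod.mk.injEq]
    constructor
    · rintro ⟨h, ⟨u, rfl⟩, ⟨v, rfl⟩⟩
      refine ⟨u, v, ?_, by ring, by ring⟩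
      push_cast at h
      apply mul_left_cancel₀ (pow_ne_zero 2 hp0)
      linear_combination h
    · rintro ⟨u, v, h, rfl, rfl⟩
      push_cast
      exact ⟨by rw [← h]; ring, ⟨u, by ring⟩, ⟨v, by ring⟩⟩
  · rw [Set.ncard_eq_zero ((Rset_finite _).subset (Set.sep_subset _ _))]
    ext ⟨x, y⟩
    simp only [Rset, Set.mem_ofPred_eq, Set.mem_empty_iff_false, iff_false]
    rintro ⟨h, ⟨u, rfl⟩, ⟨v, rfl⟩⟩
    push_cast at h
    apply hpn
    have : (p : ℤ) ∣ n := ⟨u ^ 2 + v ^ 2, by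
      apply mul_left_cancel₀ hp0
      linear_combination -h⟩
    exact_mod_cast this

lemma Rset_two (n : ℕ) : (Rset (2 * n)).ncard = (Rset n).ncard := by
  rw [← ncard_image_mulG 1 1 (by norm_num) n]
  congr 1
  ext ⟨x, y⟩
  constructor
  · intro hz
    refine mem_image_mulG Nat.prime_two (by norm_num) hz ?_
    simp only [Rset, Set.mem_ofPred_eq] at hz
    push_cast at hz
    apply Int.prime_two.dvd_of_dvd_pow (n := 2)
    exact ⟨n + x * y, by push_cast; linear_combination hz⟩
  · rintro ⟨z, hz, e⟩
    rw [← e]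
    exact mulG_mem (by norm_num) hz

lemma Rset_three (p n : ℕ) (hp : p.Prime) (h3 : p % 4 = 3) :
    (Rset (p * n)).ncard = if p ∣ n then (Rset (n / p)).ncard else 0 := by
  rw [← ncard_dvd p n hp]
  congr 1
  ext ⟨x, y⟩
  constructor
  · intro hz
    refine ⟨hz, ?_⟩
    have : Fact p.Prime := ⟨hp⟩
    simp only [Rset, Set.mem_ofPred_eq] at hz
    have h0 : (x : ZMod p) ^ 2 + (y : ZMod p) ^ 2 = 0 := by
      have := congrArg (Int.cast : ℤ → ZMod p) hz
      push_cast at this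
      simpa using this
    have key : ∀ u v : ZMod p, u ^ 2 + v ^ 2 = 0 → u = 0 := by
      intro u v huv
      by_contra hu
      apply ZMod.mod_four_ne_three_of_sq_eq_neg_sq' hu (p := p) (x := v) _ h3
      linear_combination huv
    have hx := key _ _ h0
    have hy := key _ _ (by rw [add_comm]; exact h0)
    exact ⟨(ZMod.intCast_zmod_eq_zero_iff_dvd _ _).1 hx, (ZMod.intCast_zmod_eq_zero_iff_dvd _ _).1 hy⟩
  · intro h; exact h.1

lemma Rset_one (p n : ℕ) (hp : p.Prime) (h1 : p % 4 = 1) :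
    (Rset (p * n)).ncard + (if p ∣ n then (Rset (n / p)).ncard else 0) = 2 * (Rset n).ncard := by
  have : Fact p.Prime := ⟨hp⟩
  obtain ⟨a, b, hab⟩ := Nat.Prime.sq_add_sq (p := p) (by omega)
  have hpi : Prime (p : ℤ) := Nat.prime_iff_prime_int.1 hp
  have h : (a : ℤ) ^ 2 + (b : ℤ) ^ 2 = p := by exact_mod_cast hab
  have h' : (a : ℤ) ^ 2 + (-b : ℤ) ^ 2 = p := by rw [neg_sq]; exact h
  have hU : Rset (p * n) = (Set.image (mulG a b) (Rset n)) ∪ (Set.image (mulG a (-b)) (Rset n)) := by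
    ext ⟨x, y⟩
    constructor
    · intro hz
      have hz' := hz
      simp only [Rset, Set.mem_ofPred_eq] at hz'
      push_cast at hz'
      have : (p : ℤ) ∣ (a * x + b * y) * (a * x + -b * y) :=
        ⟨a ^ 2 * n - y ^ 2, by linear_combination (a : ℤ) ^ 2 * hz' - y ^ 2 * h⟩
      rcases hpi.dvd_or_dvd this with hd | hd
      · exact Or.inl (mem_image_mulG hp h hz hd)
      · exact Or.inr (mem_image_mulG hp h' hz hd)
    · rintro (⟨z, hz, e⟩ | ⟨z, hz, e⟩) <;> rw [← e]
      · exact mulG_mem h hz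
      · exact mulG_mem h' hz
  have hpos : (0 : ℤ) < p := by exact_mod_cast hp.pos
  have nd : ∀ c d : ℤ, c ^ 2 + d ^ 2 = p → ¬ (p : ℤ) ∣ 2 * c := by
    intro c d hcd hdv
    have hc : (p : ℤ) ∣ c := by
      rcases hpi.dvd_or_dvd hdv with h2 | h2
      · exfalso
        have : p ∣ 2 := by exact_mod_cast h2
        have := Nat.le_of_dvd (by norm_num) this
        have := hp.two_le
        omega
      · exact h2
    have hd : (p : ℤ) ∣ d := by
      apply hpi.dvd_of_dvd_pow (n := 2)
      rw [show d ^ 2 = p - c ^ 2 by linear_combination hcd]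
      exact dvd_sub dvd_rfl (dvd_pow hc two_ne_zero)
    obtain ⟨u, rfl⟩ := hc
    obtain ⟨v, rfl⟩ := hd
    have : (p : ℤ) * (u ^ 2 + v ^ 2) = 1 := by
      apply mul_left_cancel₀ hpi.ne_zero
      linear_combination hcd
    exact hpi.not_isUnit (IsUnit.of_mul_eq_one _ this)
  have hI : (Set.image (mulG a b) (Rset n)) ∩ (Set.image (mulG a (-b)) (Rset n)) =
      {z ∈ Rset (p * n) | (p : ℤ) ∣ z.1 ∧ (p : ℤ) ∣ z.2} := by
    ext ⟨x, y⟩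
    constructor
    · intro hz
      refine ⟨hU ▸ Or.inl hz.1, ?_⟩
      obtain ⟨⟨⟨u, v⟩, _, e1⟩, ⟨⟨s, t⟩, _, e2⟩⟩ := hz
      simp only [mulG, Prod.mk.injEq] at e1 e2
      obtain ⟨e1, e1'⟩ := e1
      obtain ⟨e2, e2'⟩ := e2
      constructor
      · refine (hpi.dvd_or_dvd (a := 2 * a) (b := x) ⟨u + s, ?_⟩).resolve_left (nd a b h)
        linear_combination (u + s) * h - a * e1 - b * e1' - a * e2 + b * e2'
      · refine (hpi.dvd_or_dvd (a := 2 * a) (b := y) ⟨v + t, ?_⟩).resolve_left (nd a b h)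
        linear_combination (v + t) * h - a * e1' + b * e1 - a * e2' - b * e2
    · rintro ⟨hz, hx, hy⟩
      exact ⟨mem_image_mulG hp h hz (dvd_add (hx.mul_left _) (hy.mul_left _)),
        mem_image_mulG hp h' hz (dvd_add (hx.mul_left _) (hy.mul_left _))⟩
  have := Set.ncard_union_add_ncard_inter ((Set.image (mulG a b) (Rset n))) ((Set.image (mulG a (-b)) (Rset n)))
    ((Rset_finite n).image _) ((Rset_finite n).image _)
  rw [← hU, hI, ncard_dvd p n hp, ncard_image_mulG _ _ (by rw [h]; exact hpi.ne_zero),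
    ncard_image_mulG _ _ (by rw [h']; exact hpi.ne_zero)] at this
  omega

lemma Rset_unit : (Rset 1).ncard = 4 := by
  have : Rset 1 = (({(1, 0), (-1, 0), (0, 1), (0, -1)} : Finset (ℤ × ℤ)) : Set (ℤ × ℤ)) := by
    ext ⟨x, y⟩
    simp only [Rset, Set.mem_ofPred_eq, Finset.coe_insert, Finset.coe_singleton,
      Set.mem_insert_iff, Set.mem_singleton_iff, Prod.mk.injEq]
    constructor
    · intro h
      push_cast at h
      have hx : x ≤ 1 := by nlinarith [sq_nonneg y]
      have hx' : -1 ≤ x := by nlinarith [sq_nonneg y]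
      have hy : y ≤ 1 := by nlinarith [sq_nonneg x]
      have hy' : -1 ≤ y := by nlinarith [sq_nonneg x]
      interval_cases x <;> interval_cases y <;> simp_all
    · rintro (⟨rfl, rfl⟩ | ⟨rfl, rfl⟩ | ⟨rfl, rfl⟩ | ⟨rfl, rfl⟩) <;> norm_num
  rw [this, Set.ncard_coe_finset]
  decide

/-- Jacobi's two-square theorem. -/
lemma two_squares (n : ℕ) (hn : n ≠ 0) : ((Rset n).ncard : ℤ) = 4 * fdiv n := by
  induction n using Nat.strong_induction_on with
  | _ n ih =>
  by_cases h1 : n = 1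
  · subst h1
    rw [Rset_unit]; simp [fdiv]
  obtain ⟨p, hp, m, rfl⟩ := Nat.exists_prime_and_dvd h1
  have hm : m ≠ 0 := by rintro rfl; simp at hn
  have hlt : m < p * m := by
    have := hp.two_le
    have := Nat.pos_of_ne_zero hm
    nlinarith
  have ihm := ih m hlt hm
  have hF := fdiv_prime_mul p m hp hm
  have hT : (((if p ∣ m then (Rset (m / p)).ncard else 0 : ℕ)) : ℤ) =
      4 * (if p ∣ m then fdiv (m / p) else 0) := by
    split_ifs with hd
    · exact ih _ (lt_of_le_of_lt (Nat.div_le_self _ _) hlt)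
        (Nat.div_pos (Nat.le_of_dvd (Nat.pos_of_ne_zero hm) hd) hp.pos).ne'
    · simp
  rcases hp.eq_two_or_odd with rfl | hodd
  · rw [Rset_two, ihm]
    rw [show ZMod.χ₄ ((2 : ℕ) : ZMod 4) = 0 by decide] at hF
    linarith
  · rcases (by omega : p % 4 = 1 ∨ p % 4 = 3) with h | h
    · have hR := Rset_one p m hp h
      rw [ZMod.χ₄_nat_one_mod_four h] at hF
      have hR' := congrArg (Nat.cast : ℕ → ℤ) hR
      rw [Nat.cast_add, hT, Nat.cast_mul] at hR'
      push_cast at hR'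
      linarith
    · rw [Rset_three p m hp h, hT]
      rw [ZMod.χ₄_nat_three_mod_four h] at hF
      linarith

theorem Cpoly_eval_neg_one (n : ℕ) (hn : 1 ≤ n) :
    (Cpoly n).eval (-1) =
      (Nat.card {p : ℤ × ℤ // p.1 ^ 2 + p.2 ^ 2 = (n : ℤ)} : ℤ) := by
  rw [eval_step n hn, sum_step n hn, ← two_squares n (by omega)]
  rfl
end

section
/- Let n ≥ 1 be an integer and let P ∈ ℤ[X] be any polynomial with C_n(X) = (X−1)²·P(X). Then 4·P(−1) = r(n), where r(n) is the number of pairs (x,y) ∈ ℤ × ℤ with x² + y² = n. -/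
/-- Integer points on the circle `x² + y² = n`. -/
def circ (n : ℤ) : Set (ℤ × ℤ) := {q | q.1 ^ 2 + q.2 ^ 2 = n}

/-- Integer points with `p (x² + y²) = n`. -/
def circDiv (p n : ℤ) : Set (ℤ × ℤ) := {q | p * (q.1 ^ 2 + q.2 ^ 2) = n}

theorem circ_finite (n : ℤ) : (circ n).Finite := by
  apply Set.Finite.subset ((Set.finite_Icc (-n) n).prod (Set.finite_Icc (-n) n))
  rintro ⟨x, y⟩ h
  simp only [circ, Set.mem_ofPred_eq] at h
  simp only [Set.mem_prod, Set.mem_Icc]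
  refine ⟨⟨?_, ?_⟩, ?_, ?_⟩ <;> nlinarith [sq_nonneg x, sq_nonneg y, Int.le_self_sq x, Int.le_self_sq y,
    Int.le_self_sq (-x), Int.le_self_sq (-y)]

theorem circ_both (p n : ℤ) (hp : p ≠ 0) :
    {q | q ∈ circ (p * n) ∧ p ∣ q.1 ∧ p ∣ q.2}.ncard = (circDiv p n).ncard := by
  have hinj : Function.Injective (fun q : ℤ × ℤ => (p * q.1, p * q.2)) := by
    rintro ⟨x, y⟩ ⟨x', y'⟩ h
    simp only [Prod.mk.injEq] at h ⊢
    exact ⟨mul_left_cancel₀ hp h.1, mul_left_cancel₀ hp h.2⟩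
  rw [← Set.ncard_image_of_injective (circDiv p n) hinj]
  congr 1
  ext ⟨x, y⟩
  simp only [circ, circDiv, Set.mem_ofPred_eq, Set.mem_image, Prod.mk.injEq, Prod.exists]
  constructor
  · rintro ⟨h, ⟨u, rfl⟩, ⟨v, rfl⟩⟩
    refine ⟨u, v, ?_, rfl, rfl⟩
    apply mul_left_cancel₀ hp
    linear_combination h
  · rintro ⟨u, v, h, rfl, rfl⟩
    refine ⟨?_, ⟨u, rfl⟩, ⟨v, rfl⟩⟩
    linear_combination p * h

theorem circ_gauss (p n a b : ℤ) (hp : Prime p) (hab : a ^ 2 + b ^ 2 = p) :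
    {q | q ∈ circ (p * n) ∧ p ∣ a * q.1 + b * q.2}.ncard = (circ n).ncard := by
  have hinj : Function.Injective (fun q : ℤ × ℤ => (a * q.1 - b * q.2, b * q.1 + a * q.2)) := by
    rintro ⟨x, y⟩ ⟨x', y'⟩ h
    simp only [Prod.mk.injEq] at h ⊢
    constructor
    · apply mul_left_cancel₀ hp.ne_zero
      rw [← hab]
      linear_combination a * h.1 + b * h.2
    · apply mul_left_cancel₀ hp.ne_zero
      rw [← hab]
      linear_combination a * h.2 - b * h.1
  rw [← Set.ncard_image_of_injective (circ n) hinj]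
  congr 1
  ext ⟨x, y⟩
  simp only [circ, Set.mem_ofPred_eq, Set.mem_image, Prod.mk.injEq, Prod.exists]
  constructor
  · rintro ⟨h, ⟨u, hu⟩⟩
    have h2 : p ∣ (a * y - b * x) ^ 2 := by
      refine ⟨p * n - p * u ^ 2, ?_⟩
      have : (a * y - b * x) ^ 2 = (a ^ 2 + b ^ 2) * (x ^ 2 + y ^ 2) - (a * x + b * y) ^ 2 := by ring
      rw [this, hab, h, hu]; ring
    obtain ⟨v, hv⟩ := hp.dvd_of_dvd_pow h2
    have hx : a * u - b * v = x := by
      apply mul_left_cancel₀ hp.ne_zero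
      linear_combination (-a) * hu + b * hv + x * hab
    have hy : b * u + a * v = y := by
      apply mul_left_cancel₀ hp.ne_zero
      linear_combination (-b) * hu - a * hv + y * hab
    refine ⟨u, v, ?_, hx, hy⟩
    apply mul_left_cancel₀ hp.ne_zero
    rw [← h, ← hx, ← hy, ← hab]; ring
  · rintro ⟨u, v, h, rfl, rfl⟩
    refine ⟨?_, ⟨u, ?_⟩⟩
    · rw [← h, ← hab]; ring
    · rw [← hab]; ring

theorem circ_rec (p : ℕ) (hp : p.Prime) (n : ℤ) :
    ((circ (p * n)).ncard : ℤ) + ZMod.χ₄ p * (circDiv p n).ncard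
      = (1 + ZMod.χ₄ p) * (circ n).ncard := by
  have : Fact p.Prime := ⟨hp⟩
  have hpz : Prime (p : ℤ) := Nat.prime_iff_prime_int.mp hp
  by_cases h3 : p % 4 = 3
  · rw [ZMod.χ₄_nat_three_mod_four h3, ← circ_both p n hpz.ne_zero]
    have : {q | q ∈ circ (p * n) ∧ (p : ℤ) ∣ q.1 ∧ (p : ℤ) ∣ q.2} = circ (p * n) := by
      ext ⟨x, y⟩
      simp only [circ, Set.mem_ofPred_eq, and_iff_left_iff_imp]
      intro h
      have h0 : (x : ZMod p) ^ 2 + (y : ZMod p) ^ 2 = 0 := by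
        have := congrArg (Int.cast : ℤ → ZMod p) h
        push_cast at this
        simpa using this
      rw [← ZMod.intCast_zmod_eq_zero_iff_dvd, ← ZMod.intCast_zmod_eq_zero_iff_dvd]
      have hy : (y : ZMod p) = 0 := by
        by_contra hy
        exact ZMod.mod_four_ne_three_of_sq_eq_neg_sq' hy (eq_neg_of_add_eq_zero_left h0) h3
      refine ⟨?_, hy⟩
      rw [hy] at h0
      simpa using h0
    rw [this]; ring
  · obtain ⟨a, b, hab⟩ := Nat.Prime.sq_add_sq h3
    have habz : (a : ℤ) ^ 2 + (b : ℤ) ^ 2 = p := by exact_mod_cast hab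
    rcases hp.eq_two_or_odd with rfl | hodd
    · have hχ : ZMod.χ₄ ((2 : ℕ) : ZMod 4) = 0 := by decide
      rw [hχ, ← circ_gauss (2 : ℕ) n 1 1 hpz (by norm_num)]
      have : {q | q ∈ circ ((2 : ℕ) * n) ∧ ((2 : ℕ) : ℤ) ∣ 1 * q.1 + 1 * q.2}
          = circ ((2 : ℕ) * n) := by
        ext ⟨x, y⟩
        simp only [circ, Set.mem_ofPred_eq, and_iff_left_iff_imp]
        intro h
        have h2 : ((2 : ℕ) : ℤ) ∣ (1 * x + 1 * y) ^ 2 := by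
          refine ⟨n + x * y, ?_⟩
          linear_combination h
        exact hpz.dvd_of_dvd_pow h2
      rw [this]; ring
    · have h1 : p % 4 = 1 := by omega
      rw [ZMod.χ₄_nat_one_mod_four h1]
      have e1 := circ_gauss p n a b hpz habz
      have e2 := circ_gauss p n a (-b) hpz (by rw [neg_sq]; exact habz)
      have e3 := circ_both p n hpz.ne_zero
      have hna : ∀ c d : ℕ, c ^ 2 + d ^ 2 = p → ¬ (p : ℤ) ∣ c := by
        intro c d hcd hc
        have hc : p ∣ c := by exact_mod_cast hc
        have hd : p ∣ d := by
          apply hp.dvd_of_dvd_pow (n := 2)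
          rw [← Nat.dvd_add_right (dvd_pow hc two_ne_zero), hcd]
        obtain ⟨u, rfl⟩ := hc
        obtain ⟨v, rfl⟩ := hd
        have h5 : p * (u ^ 2 + v ^ 2) = 1 := by
          apply Nat.eq_of_mul_eq_mul_left hp.pos
          linear_combination hcd
        exact hp.one_lt.ne' (Nat.eq_one_of_mul_eq_one_right h5)
      have hn2 : ¬ (p : ℤ) ∣ 2 := by
        intro h
        have h : p ∣ 2 := by exact_mod_cast h
        have := Nat.le_of_dvd (by norm_num) h
        have := hp.two_le
        omega
      have hA := hna a b hab
      have hB := hna b a (by rw [add_comm]; exact hab)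
      have hu := Set.ncard_union_add_ncard_inter
        {q | q ∈ circ (p * n) ∧ (p : ℤ) ∣ a * q.1 + b * q.2}
        {q | q ∈ circ (p * n) ∧ (p : ℤ) ∣ a * q.1 + -b * q.2}
        ((circ_finite _).subset fun _ h => h.1) ((circ_finite _).subset fun _ h => h.1)
      rw [e1, e2] at hu
      have hU : {q | q ∈ circ (p * n) ∧ (p : ℤ) ∣ a * q.1 + b * q.2} ∪
          {q | q ∈ circ (p * n) ∧ (p : ℤ) ∣ a * q.1 + -b * q.2} = circ (p * n) := by
        ext ⟨x, y⟩
        simp only [circ, Set.mem_ofPred_eq, Set.mem_union, ← and_or_left, and_iff_left_iff_imp]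
        intro h
        apply hpz.dvd_or_dvd
        refine ⟨a ^ 2 * n - y ^ 2, ?_⟩
        linear_combination (a : ℤ) ^ 2 * h - y ^ 2 * habz
      have hI : {q | q ∈ circ (p * n) ∧ (p : ℤ) ∣ a * q.1 + b * q.2} ∩
          {q | q ∈ circ (p * n) ∧ (p : ℤ) ∣ a * q.1 + -b * q.2} =
          {q | q ∈ circ (p * n) ∧ (p : ℤ) ∣ q.1 ∧ (p : ℤ) ∣ q.2} := by
        ext ⟨x, y⟩
        simp only [Set.mem_ofPred_eq, Set.mem_inter_iff]
        constructor
        · rintro ⟨⟨h, h1⟩, -, h2⟩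
          refine ⟨h, ?_, ?_⟩
          · have := dvd_add h1 h2
            rw [show a * x + b * y + (a * x + -b * y) = 2 * (a * x) by ring] at this
            exact ((hpz.dvd_or_dvd this).resolve_left hn2 |> hpz.dvd_or_dvd).resolve_left hA
          · have := dvd_sub h1 h2
            rw [show a * x + b * y - (a * x + -b * y) = 2 * (b * y) by ring] at this
            exact ((hpz.dvd_or_dvd this).resolve_left hn2 |> hpz.dvd_or_dvd).resolve_left hB
        · rintro ⟨h, h1, h2⟩
          exact ⟨⟨h, dvd_add (h1.mul_left _) (h2.mul_left _)⟩, h,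
            dvd_add (h1.mul_left _) (h2.mul_left _)⟩
      rw [hU, hI, e3] at hu
      have : ((circ (p * n)).ncard : ℤ) + (circDiv p n).ncard = (circ n).ncard + (circ n).ncard := by
        exact_mod_cast hu
      linear_combination this

/-- The divisor sum of the nontrivial character mod 4. -/
def divChi (n : ℕ) : ℤ := ∑ d ∈ n.divisors, ZMod.χ₄ (d : ZMod 4)

theorem divChi_rec (p : ℕ) (hp : p.Prime) (n : ℕ) (hn : n ≠ 0) :
    divChi (p * n) + ZMod.χ₄ p * (if p ∣ n then divChi (n / p) else 0)
      = (1 + ZMod.χ₄ p) * divChi n := by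
  have hinj : Function.Injective (fun d => p * d) := fun x y h => Nat.eq_of_mul_eq_mul_left hp.pos h
  have himg : ∀ m : ℕ, ∑ d ∈ m.divisors.image (fun d => p * d), ZMod.χ₄ (d : ZMod 4)
      = ZMod.χ₄ p * divChi m := by
    intro m
    rw [Finset.sum_image (fun x _ y _ h => hinj h), divChi, Finset.mul_sum]
    apply Finset.sum_congr rfl
    intro d _
    push_cast
    rw [map_mul]
  have hU : n.divisors ∪ n.divisors.image (fun d => p * d) = (p * n).divisors := by
    ext d
    simp only [Finset.mem_union, Finset.mem_image, Nat.mem_divisors]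
    constructor
    · rintro (⟨h, _⟩ | ⟨e, ⟨h, _⟩, rfl⟩)
      · exact ⟨h.mul_left _, mul_ne_zero hp.ne_zero hn⟩
      · exact ⟨mul_dvd_mul_left _ h, mul_ne_zero hp.ne_zero hn⟩
    · rintro ⟨h, _⟩
      by_cases hpd : p ∣ d
      · obtain ⟨e, rfl⟩ := hpd
        exact Or.inr ⟨e, ⟨Nat.dvd_of_mul_dvd_mul_left hp.pos h, hn⟩, rfl⟩
      · exact Or.inl ⟨((Nat.Prime.coprime_iff_not_dvd hp).mpr hpd).symm.dvd_of_dvd_mul_left h, hn⟩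
  have hI : ∑ d ∈ n.divisors ∩ n.divisors.image (fun d => p * d), ZMod.χ₄ (d : ZMod 4)
      = ZMod.χ₄ p * (if p ∣ n then divChi (n / p) else 0) := by
    split_ifs with hd
    · rw [← himg]
      congr 1
      obtain ⟨m, rfl⟩ := hd
      rw [Nat.mul_div_cancel_left _ hp.pos]
      have hm : m ≠ 0 := right_ne_zero_of_mul hn
      ext d
      simp only [Finset.mem_inter, Finset.mem_image, Nat.mem_divisors]
      constructor
      · rintro ⟨⟨h, _⟩, e, _, rfl⟩
        exact ⟨e, ⟨Nat.dvd_of_mul_dvd_mul_left hp.pos h, hm⟩, rfl⟩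
      · rintro ⟨e, ⟨h, _⟩, rfl⟩
        exact ⟨⟨mul_dvd_mul_left _ h, hn⟩, e, ⟨h.mul_left _, hn⟩, rfl⟩
    · rw [mul_zero]
      apply Finset.sum_eq_zero
      intro d h
      exfalso
      simp only [Finset.mem_inter, Finset.mem_image, Nat.mem_divisors] at h
      obtain ⟨⟨h, _⟩, e, _, rfl⟩ := h
      exact hd (dvd_of_mul_right_dvd h)
  have := Finset.sum_union_inter (s₁ := n.divisors) (s₂ := n.divisors.image (fun d => p * d))
    (f := fun d : ℕ => ZMod.χ₄ (d : ZMod 4))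
  rw [hU, hI, himg] at this
  change divChi (p * n) + _ = divChi n + _ at this
  rw [this]; ring

theorem circ_one : (circ 1).ncard = 4 := by
  have : circ 1 = (({(1, 0), (-1, 0), (0, 1), (0, -1)} : Finset (ℤ × ℤ)) : Set (ℤ × ℤ)) := by
    ext ⟨x, y⟩
    simp only [circ, Set.mem_ofPred_eq, Finset.coe_insert, Finset.coe_singleton,
      Set.mem_insert_iff, Set.mem_singleton_iff, Prod.mk.injEq]
    constructor
    · intro h
      have hx : x ≤ 1 := by nlinarith [sq_nonneg y]
      have hx' : -1 ≤ x := by nlinarith [sq_nonneg y]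
      have hy : y ≤ 1 := by nlinarith [sq_nonneg x]
      have hy' : -1 ≤ y := by nlinarith [sq_nonneg x]
      interval_cases x <;> interval_cases y <;> simp_all
    · rintro (⟨rfl, rfl⟩ | ⟨rfl, rfl⟩ | ⟨rfl, rfl⟩ | ⟨rfl, rfl⟩) <;> norm_num
  rw [this, Set.ncard_coe_finset]
  decide

/-- Jacobi's two squares theorem. -/
theorem jacobi_two_squares (n : ℕ) (hn : n ≠ 0) : ((circ n).ncard : ℤ) = 4 * divChi n := by
  induction n using Nat.strong_induction_on with
  | _ n ih =>
    by_cases h1 : n = 1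
    · subst h1
      rw [Nat.cast_one, circ_one]
      simp [divChi]
    · obtain ⟨p, hp, m, rfl⟩ := Nat.exists_prime_and_dvd h1
      have hm : m ≠ 0 := right_ne_zero_of_mul hn
      have hmlt : m < p * m := by nlinarith [hp.two_le, Nat.pos_of_ne_zero hm]
      have e1 := circ_rec p hp m
      have e2 := divChi_rec p hp m hm
      rw [ih m hmlt hm] at e1
      have e3 : ((circDiv p m).ncard : ℤ) = 4 * (if p ∣ m then divChi (m / p) else 0) := by
        split_ifs with hd
        · obtain ⟨k, rfl⟩ := hd
          have hk : k ≠ 0 := right_ne_zero_of_mul hm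
          rw [Nat.mul_div_cancel_left _ hp.pos, ← ih k _ hk]
          · congr 2
            ext q
            simp only [circ, circDiv, Set.mem_ofPred_eq]
            push_cast
            have : (p : ℤ) ≠ 0 := by exact_mod_cast hp.ne_zero
            exact mul_right_inj' this
          · nlinarith [hp.two_le, Nat.pos_of_ne_zero hk]
        · have : circDiv p m = ∅ := by
            ext q
            simp only [circDiv, Set.mem_ofPred_eq, Set.mem_empty_iff_false, iff_false]
            intro h
            apply hd
            have : (p : ℤ) ∣ m := ⟨_, h.symm⟩
            exact_mod_cast this
          rw [this]; simp
      rw [e3] at e1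
      push_cast
      linear_combination e1 - 4 * e2

/-- The double sum over factorizations equals the character divisor sum. -/
theorem pair_sum (n : ℕ) (hn : 1 ≤ n) :
    ∑ k ∈ Finset.Icc 1 (2 * n), ∑ j ∈ Finset.range n,
      (if 2 * n = k * (k + 2 * j + 1) then (-1 : ℤ) ^ (n + k + j) else 0) = divChi n := by
  rw [← Finset.sum_product', ← Finset.sum_filter]
  have hodd : divChi n = ∑ d ∈ n.divisors.filter (fun d => d % 2 = 1), ZMod.χ₄ (d : ZMod 4) := by
    rw [divChi, Finset.sum_filter]
    apply Finset.sum_congr rfl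
    intro d _
    split_ifs with h
    · rfl
    · rw [ZMod.χ₄_nat_eq_if_mod_four, if_pos (by omega)]
  rw [hodd]
  refine Finset.sum_bij (fun q _ => if q.1 % 2 = 1 then q.1 else q.1 + 2 * q.2 + 1) ?_ ?_ ?_ ?_
  · rintro ⟨k, j⟩ h
    simp only [Finset.mem_filter, Finset.mem_product, Finset.mem_Icc, Finset.mem_range] at h
    obtain ⟨⟨⟨hk1, hk2⟩, hj⟩, h⟩ := h
    simp only [Finset.mem_filter, Nat.mem_divisors]
    split_ifs with hk
    · refine ⟨⟨⟨(k + 2 * j + 1) / 2, ?_⟩, by omega⟩, hk⟩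
      obtain ⟨s, hs⟩ : ∃ s, k + 2 * j + 1 = 2 * s := ⟨(k + 2 * j + 1) / 2, by omega⟩
      rw [hs] at h ⊢
      rw [Nat.mul_div_cancel_left _ (by norm_num)]
      linarith
    · obtain ⟨s, rfl⟩ : ∃ s, k = 2 * s := ⟨k / 2, by omega⟩
      refine ⟨⟨⟨s, ?_⟩, by omega⟩, by omega⟩
      linarith
  · rintro ⟨k, j⟩ h ⟨k', j'⟩ h' he
    simp only [Finset.mem_filter, Finset.mem_product, Finset.mem_Icc, Finset.mem_range] at h h' he
    obtain ⟨⟨⟨hk1, hk2⟩, hj⟩, h⟩ := h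
    obtain ⟨⟨⟨hk1', hk2'⟩, hj'⟩, h'⟩ := h'
    rw [h] at h'
    split_ifs at he with a b b
    · subst he
      have := Nat.eq_of_mul_eq_mul_left hk1 h'
      simp only [Prod.mk.injEq, true_and]; omega
    · exfalso
      rw [← he, mul_comm k'] at h'
      have := Nat.eq_of_mul_eq_mul_left hk1 h'
      omega
    · exfalso
      rw [he, mul_comm k] at h'
      have := Nat.eq_of_mul_eq_mul_left hk1' h'
      omega
    · rw [he] at h'
      have hpos : 0 < k' + 2 * j' + 1 := by omega
      have hkk : k = k' := Nat.eq_of_mul_eq_mul_right hpos h'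
      simp only [Prod.mk.injEq]; omega
  · intro d h
    simp only [Finset.mem_filter, Nat.mem_divisors] at h
    obtain ⟨⟨⟨m, rfl⟩, h0⟩, hd⟩ := h
    have hm : 1 ≤ m := Nat.pos_of_ne_zero (right_ne_zero_of_mul h0)
    have hd1 : 1 ≤ d := by omega
    have hA : d ≤ d * m := Nat.le_mul_of_pos_right _ hm
    have hB : m ≤ d * m := Nat.le_mul_of_pos_left _ hd1
    rcases Nat.lt_or_ge d (2 * m) with hlt | hge
    · obtain ⟨j, hj⟩ : ∃ j, 2 * m = d + 2 * j + 1 := ⟨(2 * m - d - 1) / 2, by omega⟩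
      refine ⟨(d, j), ?_, ?_⟩
      · simp only [Finset.mem_filter, Finset.mem_product, Finset.mem_Icc, Finset.mem_range]
        refine ⟨⟨⟨hd1, by omega⟩, by omega⟩, ?_⟩
        rw [← hj]; ring
      · simp [hd]
    · obtain ⟨j, hj⟩ : ∃ j, d = 2 * m + 2 * j + 1 := ⟨(d - 2 * m - 1) / 2, by omega⟩
      refine ⟨(2 * m, j), ?_, ?_⟩
      · simp only [Finset.mem_filter, Finset.mem_product, Finset.mem_Icc, Finset.mem_range]
        refine ⟨⟨⟨by omega, by omega⟩, by omega⟩, ?_⟩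
        rw [← hj]; ring
      · simp [hj]
  · rintro ⟨k, j⟩ h
    simp only [Finset.mem_filter, Finset.mem_product, Finset.mem_Icc, Finset.mem_range] at h
    obtain ⟨⟨⟨hk1, hk2⟩, hj⟩, h⟩ := h
    dsimp only
    split_ifs with hk
    · rw [ZMod.χ₄_eq_neg_one_pow hk]
      obtain ⟨s, rfl⟩ : ∃ s, k = 2 * s + 1 := ⟨k / 2, by omega⟩
      have hn' : n = (2 * s + 1) * (s + j + 1) := by linarith
      rw [show (2 * s + 1) / 2 = s by omega,
        show n + (2 * s + 1) + j = s + 2 * (s * (s + j + 1) + s + j + 1) by rw [hn']; ring,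
        pow_add, pow_mul]
      simp
    · obtain ⟨s, rfl⟩ : ∃ s, k = 2 * s := ⟨k / 2, by omega⟩
      rw [ZMod.χ₄_eq_neg_one_pow (by omega)]
      have hn' : n = s * (2 * s + 2 * j + 1) := by linarith
      rw [show (2 * s + 2 * j + 1) / 2 = s + j by omega,
        show n + 2 * s + j = s + j + 2 * (s * (s + j) + s) by rw [hn']; ring,
        pow_add _ (s + j), pow_mul]
      simp

theorem Cpoly_eval (n : ℕ) (hn : 1 ≤ n) : (Cpoly n).eval (-1) = 4 * divChi n := by
  rw [← pair_sum n hn]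
  have h0 : (-1 : ℤ) ^ n * cCoeff n 0 = 2 * ∑ k ∈ Finset.Icc 1 (2 * n),
      (if 2 * n = k * (k + 2 * 0 + 1) then (-1 : ℤ) ^ (n + k + 0) else 0) := by
    rw [cCoeff, if_pos rfl, Finset.mul_sum, Finset.mul_sum]
    apply Finset.sum_congr rfl
    intro k _
    simp only [mul_zero, add_zero]
    split_ifs
    · rw [pow_add]; ring
    · simp
  have hi : ∀ j, cCoeff n (j + 1) * ((-1 : ℤ) ^ (n + (j + 1)) * 2) =
      2 * ∑ k ∈ Finset.Icc 1 (2 * n),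
        (if 2 * n = k * (k + 2 * (j + 1) + 1) then (-1 : ℤ) ^ (n + k + (j + 1)) else 0) +
      2 * ∑ k ∈ Finset.Icc 1 (2 * n),
        (if 2 * n = k * (k + 2 * j + 1) then (-1 : ℤ) ^ (n + k + j) else 0) := by
    intro j
    rw [cCoeff, if_neg (by omega), Finset.sum_mul, Finset.mul_sum, Finset.mul_sum,
      ← Finset.sum_add_distrib]
    apply Finset.sum_congr rfl
    intro k hk
    obtain ⟨l, rfl⟩ : ∃ l, k = l + 1 := ⟨k - 1, by have := (Finset.mem_Icc.mp hk).1; omega⟩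
    rw [show l + 1 + 2 * (j + 1) - 1 = l + 1 + 2 * j + 1 by omega, add_mul]
    congr 1
    · split_ifs
      · ring
      · simp
    · split_ifs
      · rw [Nat.add_sub_cancel]; ring
      · simp
  have hlast : ∑ k ∈ Finset.Icc 1 (2 * n),
      (if 2 * n = k * (k + 2 * n + 1) then (-1 : ℤ) ^ (n + k + n) else 0) = 0 := by
    apply Finset.sum_eq_zero
    intro k hk
    have := (Finset.mem_Icc.mp hk).1
    rw [if_neg]
    intro h
    have : 1 * (k + 2 * n + 1) ≤ k * (k + 2 * n + 1) := Nat.mul_le_mul_right _ this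
    omega
  have hev : (Cpoly n).eval (-1) = (-1 : ℤ) ^ n * cCoeff n 0 +
      ∑ j ∈ Finset.range n, cCoeff n (j + 1) * ((-1 : ℤ) ^ (n + (j + 1)) * 2) := by
    have : Finset.Icc 1 n = (Finset.range n).image (fun j => j + 1) := by
      ext x
      simp only [Finset.mem_Icc, Finset.mem_image, Finset.mem_range]
      constructor
      · intro h; exact ⟨x - 1, by omega, by omega⟩
      · rintro ⟨y, h, rfl⟩; omega
    rw [Cpoly, this, Finset.sum_image (by intro x _ y _ h; simpa using h)]
    simp only [Polynomial.eval_add, Polynomial.eval_mul, Polynomial.eval_C, Polynomial.eval_pow,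
      Polynomial.eval_X, Polynomial.eval_finsetSum]
    congr 1
    · ring
    · apply Finset.sum_congr rfl
      intro j hj
      have := Finset.mem_range.mp hj
      have e : (-1 : ℤ) ^ (n - (j + 1)) = (-1) ^ (n + (j + 1)) := by
        rw [show n + (j + 1) = n - (j + 1) + 2 * (j + 1) by omega, pow_add _ (n - (j + 1)), pow_mul]
        simp
      rw [e]; ring
  rw [hev, h0, Finset.sum_comm]
  simp only [hi, Finset.sum_add_distrib, ← Finset.mul_sum]
  have t1 := Finset.sum_range_succ' (fun j => ∑ k ∈ Finset.Icc 1 (2 * n),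
      (if 2 * n = k * (k + 2 * j + 1) then (-1 : ℤ) ^ (n + k + j) else 0)) n
  have t2 := Finset.sum_range_succ (fun j => ∑ k ∈ Finset.Icc 1 (2 * n),
      (if 2 * n = k * (k + 2 * j + 1) then (-1 : ℤ) ^ (n + k + j) else 0)) n
  rw [hlast] at t2
  linear_combination 2 * t2 - 2 * t1

theorem four_mul_quotient_eval_neg_one_eq_sum_two_squares_count (n : ℕ) (hn : 1 ≤ n)
    (P : Polynomial ℤ) (hP : Cpoly n = (Polynomial.X - 1) ^ 2 * P) :
    4 * P.eval (-1) = (Nat.card {p : ℤ × ℤ // p.1 ^ 2 + p.2 ^ 2 = (n : ℤ)} : ℤ) := by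
  have h := Cpoly_eval n hn
  rw [← jacobi_two_squares n (by omega), hP] at h
  have hc : Nat.card {p : ℤ × ℤ // p.1 ^ 2 + p.2 ^ 2 = (n : ℤ)} = (circ n).ncard :=
    Nat.card_coe_set_eq (circ n)
  rw [hc, ← h]
  simp only [Polynomial.eval_mul, Polynomial.eval_pow, Polynomial.eval_sub, Polynomial.eval_X,
    Polynomial.eval_one]
  norm_num
end

section
/- For every integer n ≥ 1 there exists a polynomial B°_n ∈ ℤ[X] such that for every finite field F with q elements, the number of ideals I of A = F[x,y,y⁻¹] (the monoid algebra AddMonoidAlgebra F (ℕ × ℤ)) with dim_F(A/I) = n equals (q−1)·q^n·B°_n(q); moreover B°_n(1) = σ₀(n), the number of divisors of n, and B°_n(−1) = (−1)^{k−1} if n = k² for some positive integer k, and B°_n(−1) = 0 if n is not a perfect square. -/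
set_option linter.unusedSectionVars false

namespace BcircProof

section Gauss

variable {A : Type*} [CommRing A]

/-- The ratio `P_n / P_s` in Shanks' argument. -/
def shR (x : A) (v : ℕ → A) (s n : ℕ) : A :=
  ∏ k ∈ Finset.Ico s n, ((1 - x ^ (k + 1)) * v (k + 1))

/-- The summand in Shanks' argument. -/
def shT (x : A) (v : ℕ → A) (n s : ℕ) : A :=
  (-1) ^ s * x ^ (s * (n + 1)) * shR x v s n * (if s = 0 then 1 else 2 * v s)

theorem shR_self (x : A) (v : ℕ → A) (n : ℕ) : shR x v n n = 1 := by simp [shR]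

theorem shR_succ (x : A) (v : ℕ → A) {s n : ℕ} (h : s ≤ n) :
    shR x v s (n + 1) = shR x v s n * ((1 - x ^ (n + 1)) * v (n + 1)) := by
  unfold shR; rw [Finset.prod_Ico_succ_top h]

theorem shR_left (x : A) (v : ℕ → A) {s n : ℕ} (h : s < n) :
    shR x v s n = ((1 - x ^ (s + 1)) * v (s + 1)) * shR x v (s + 1) n := by
  unfold shR; rw [Finset.prod_eq_prod_Ico_succ_bot h]

theorem sh_partial (x : A) (v : ℕ → A) (hv : ∀ k, 1 ≤ k → v k * (1 + x ^ k) = 1) (n j : ℕ)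
    (hj : j ≤ n) :
    ∑ s ∈ Finset.range (j + 1), (shT x v (n + 1) s - shT x v n s) =
      2 * v (n + 1) * ((-1) ^ (j + 1) * x ^ ((j + 1) * (n + 1)) * shR x v j n) := by
  induction j with
  | zero =>
    have h := hv (n + 1) (by omega)
    simp only [zero_add, Finset.range_one, Finset.sum_singleton, shT, if_true]
    rw [shR_succ x v (Nat.zero_le n)]
    simp only [pow_zero, zero_mul, one_mul, pow_one]
    linear_combination (shR x v 0 n) * h
  | succ j ih =>
    rw [Finset.sum_range_succ, ih (by omega)]
    have h := hv (n + 1) (by omega)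
    have h2 := hv (j + 1) (by omega)
    unfold shT
    rw [shR_succ x v hj, shR_left x v (show j < n by omega)]
    simp only [Nat.succ_ne_zero, if_false]
    generalize shR x v (j + 1) n = r
    have e1 : x ^ ((j + 1) * (n + 1 + 1)) = x ^ ((j + 1) * (n + 1)) * x ^ (j + 1) := by ring
    have e2 : x ^ ((j + 1 + 1) * (n + 1)) = x ^ ((j + 1) * (n + 1)) * x ^ (n + 1) := by ring
    rw [e1, e2]
    have e3 : (-1 : A) ^ (j + 1 + 1) = - (-1) ^ (j + 1) := by ring
    rw [e3]
    generalize x ^ ((j + 1) * (n + 1)) = y at *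
    generalize x ^ (j + 1) = z at *
    generalize x ^ (n + 1) = w at *
    generalize (-1 : A) ^ (j + 1) = e at *
    generalize v (n + 1) = a at *
    generalize v (j + 1) = b at *
    linear_combination (2 * e * y * r * b) * h - (2 * e * y * r * a * w) * h2

theorem sh_main (x : A) (v : ℕ → A) (hv : ∀ k, 1 ≤ k → v k * (1 + x ^ k) = 1) (n : ℕ) :
    ∑ s ∈ Finset.range (n + 1), shT x v n s =
      1 + 2 * ∑ s ∈ Finset.range n, (-1) ^ (s + 1) * x ^ ((s + 1) ^ 2) := by
  induction n with
  | zero => simp [shT, shR]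
  | succ n ih =>
    have h := sh_partial x v hv n n le_rfl
    rw [Finset.sum_sub_distrib, ih] at h
    rw [Finset.sum_range_succ, eq_add_of_sub_eq h, shR_self,
      Finset.sum_range_succ (fun s => (-1) ^ (s + 1) * x ^ ((s + 1) ^ 2))]
    have h1 := hv (n + 1) (by omega)
    simp only [shT, shR_self, Nat.succ_ne_zero, if_false]
    have e1 : x ^ ((n + 1) * (n + 1 + 1)) = x ^ ((n + 1) ^ 2) * x ^ (n + 1) := by ring
    have e2 : x ^ ((n + 1) * (n + 1)) = x ^ ((n + 1) ^ 2) := by ring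
    rw [e1, e2]
    linear_combination (2 * (-1) ^ (n + 1) * x ^ ((n + 1) ^ 2)) * h1

end Gauss

section Series

open Polynomial

/-- `L_k = ∑_{m ≥ 1} X^(m-1) s^(k m)`. -/
noncomputable def serL (k : ℕ) : PowerSeries ℤ[X] :=
  PowerSeries.mk fun n => if k ∣ n ∧ n ≠ 0 then X ^ (n / k - 1) else 0

/-- `1 + (X - 1) W_N = ∏_{k ≤ N} (1 - s^k) / (1 - X s^k)`. -/
noncomputable def serW : ℕ → PowerSeries ℤ[X]
  | 0 => 0
  | k + 1 => serW k + serL (k + 1) + PowerSeries.C (X - 1) * serW k * serL (k + 1)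

theorem serL_mul (k : ℕ) (hk : 1 ≤ k) :
    serL k * (1 - PowerSeries.C X * PowerSeries.X ^ k) = PowerSeries.X ^ k := by
  have : serL k = PowerSeries.X ^ k + PowerSeries.C X * (serL k * PowerSeries.X ^ k) := by
    ext1 n
    simp only [serL, map_add, PowerSeries.coeff_X_pow, PowerSeries.coeff_mk,
      PowerSeries.coeff_C_mul, PowerSeries.coeff_mul_X_pow']
    by_cases hn : k ≤ n
    · obtain ⟨m, rfl⟩ := Nat.exists_eq_add_of_le hn
      simp only [Nat.dvd_add_right (dvd_refl k), hn, if_true, Nat.add_sub_cancel_left]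
      rw [Nat.add_div_left _ (by omega)]
      by_cases hm : k ∣ m
      · by_cases hm0 : m = 0
        · subst hm0; simp [show k ≠ 0 by omega]
        · obtain ⟨c, rfl⟩ := hm
          have : c ≠ 0 := by rintro rfl; simp at hm0
          rw [Nat.mul_div_cancel_left _ (by omega)]
          obtain ⟨c, rfl⟩ := Nat.exists_eq_succ_of_ne_zero this
          simp [hm0, show k ≠ 0 by omega, pow_succ, mul_comm]
      · have : m ≠ 0 := by rintro rfl; simp at hm
        simp [hm, this]
    · have : ¬ (k ∣ n ∧ n ≠ 0) := by
        rintro ⟨h, h0⟩; exact hn (Nat.le_of_dvd (by omega) h)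
      have h2 : n ≠ k := by omega
      simp [hn, this, h2]
  linear_combination this

theorem serW_eval_one (N n : ℕ) :
    (PowerSeries.coeff n (serW N)).eval 1 =
      ∑ k ∈ Finset.range N, if (k + 1) ∣ n ∧ n ≠ 0 then (1 : ℤ) else 0 := by
  induction N with
  | zero => simp [serW]
  | succ N ih =>
    rw [Finset.sum_range_succ, ← ih, serW, mul_assoc]
    simp only [map_add, PowerSeries.coeff_C_mul, serL, PowerSeries.coeff_mk]
    split_ifs <;> simp

theorem serW_one (n : ℕ) (hn : 1 ≤ n) :
    (PowerSeries.coeff n (serW n)).eval 1 = (n.divisors.card : ℤ) := by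
  rw [serW_eval_one, Nat.divisors, Finset.card_filter]
  push_cast
  rw [Finset.sum_Ico_eq_sum_range]
  refine Finset.sum_congr (by simp) fun k _ => ?_
  simp [show n ≠ 0 by omega, add_comm]

/-- The specialisation of the series at `X = -1`. -/
noncomputable def serNeg (N : ℕ) : PowerSeries ℤ :=
  PowerSeries.map (evalRingHom (-1)) (1 + PowerSeries.C (X - 1) * serW N)

theorem serNeg_succ (N : ℕ) :
    serNeg (N + 1) * (1 + PowerSeries.X ^ (N + 1)) =
      serNeg N * (1 - PowerSeries.X ^ (N + 1)) := by
  have h := congrArg (PowerSeries.map (evalRingHom (-1 : ℤ))) (serL_mul (N + 1) (by omega))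
  simp only [serNeg, serW, map_add, map_mul, map_sub, map_one, map_pow, PowerSeries.map_X,
    PowerSeries.map_C, coe_evalRingHom, eval_X, map_neg] at h ⊢
  linear_combination (PowerSeries.map (evalRingHom (-1)) (serW N) * 4 - 2) * h

theorem serNeg_coeff (n : ℕ) (hn : 1 ≤ n) :
    (PowerSeries.coeff n (serW n)).eval (-1) =
      - ∑ s ∈ Finset.range n, if n = (s + 1) ^ 2 then (-1 : ℤ) ^ (s + 1) else 0 := by
  have hex : ∀ k : ℕ, ∃ w : PowerSeries ℤ, 1 ≤ k → w * (1 + PowerSeries.X ^ k) = 1 := by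
    intro k
    by_cases hk : 1 ≤ k
    · have : IsUnit (1 + PowerSeries.X ^ k : PowerSeries ℤ) := by
        rw [PowerSeries.isUnit_iff_constantCoeff]
        simp [show k ≠ 0 by omega]
      obtain ⟨w, hw⟩ := this.exists_left_inv
      exact ⟨w, fun _ => hw⟩
    · exact ⟨0, fun h => absurd h hk⟩
  choose v hv using hex
  have hP : ∀ N, serNeg N = shR PowerSeries.X v 0 N := by
    intro N
    induction N with
    | zero => simp [serNeg, serW, shR]
    | succ N ih =>
      rw [shR_succ _ _ (Nat.zero_le N), ← ih]
      linear_combination (v (N + 1)) * serNeg_succ N - serNeg (N + 1) * hv (N + 1) (by omega)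
  have hmain := sh_main (PowerSeries.X : PowerSeries ℤ) v hv n
  rw [Finset.sum_range_succ'] at hmain
  have h0 : shT (PowerSeries.X : PowerSeries ℤ) v n 0 = serNeg n := by
    rw [hP]; simp [shT]
  rw [h0] at hmain
  have hc := congrArg (PowerSeries.coeff n) hmain
  have hz : ∀ s, PowerSeries.coeff n (shT (PowerSeries.X : PowerSeries ℤ) v n (s + 1)) = 0 := by
    intro s
    unfold shT
    rw [mul_comm ((-1) ^ (s + 1)), mul_assoc, mul_assoc, PowerSeries.coeff_X_pow_mul', if_neg]
    nlinarith
  have h2 : (2 : PowerSeries ℤ) = PowerSeries.C 2 := by simp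
  have h3 : ∀ s : ℕ, ((-1) ^ (s + 1) : PowerSeries ℤ) = PowerSeries.C ((-1) ^ (s + 1)) := by
    intro s; simp
  rw [h2] at hc
  simp only [h3, map_add, map_sum, hz, Finset.sum_const_zero, zero_add, PowerSeries.coeff_C_mul,
    PowerSeries.coeff_one, show n ≠ 0 by omega, if_false, PowerSeries.coeff_X_pow, serNeg,
    PowerSeries.coeff_map, coe_evalRingHom, eval_mul, eval_sub, eval_X, eval_one, eval_zero] at hc
  simp only [mul_ite, mul_one, mul_zero] at hc
  linarith

theorem serW_neg_sq (k : ℕ) (hk : 1 ≤ k) :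
    (PowerSeries.coeff (k ^ 2) (serW (k ^ 2))).eval (-1) = (-1 : ℤ) ^ (k - 1) := by
  rw [serNeg_coeff _ (by nlinarith), Finset.sum_eq_single (k - 1)]
  · obtain ⟨k, rfl⟩ := Nat.exists_eq_succ_of_ne_zero (show k ≠ 0 by omega)
    simp [pow_succ]
  · intro b _ hb
    rw [if_neg]
    intro h
    have := Nat.pow_left_injective (n := 2) (by norm_num) h
    omega
  · intro h
    simp only [Finset.mem_range, not_lt] at h
    nlinarith [Nat.sub_add_cancel hk]

theorem serW_neg_nonsq (n : ℕ) (hn : 1 ≤ n) (h : ¬ ∃ k : ℕ, n = k ^ 2) :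
    (PowerSeries.coeff n (serW n)).eval (-1) = 0 := by
  rw [serNeg_coeff n hn, Finset.sum_eq_zero, neg_zero]
  intro s _
  rw [if_neg fun hs => h ⟨_, hs⟩]

/-- Number of ideals of `F[y,y⁻¹]` of index `q^m`. -/
def numP (q : ℤ) (m : ℕ) : ℤ := if m = 0 then 1 else (q - 1) * q ^ (m - 1)

theorem series_count (q : ℤ) (c : ℕ → ℕ → ℤ) (h0 : ∀ n, c 0 n = if n = 0 then 1 else 0)
    (hs : ∀ k n, c (k + 1) n = ∑ p ∈ Finset.HasAntidiagonal.antidiagonal n,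
      (if (k + 1) ∣ p.1 then numP q (p.1 / (k + 1)) else 0) * (c k p.2 * q ^ p.1)) (k n : ℕ) :
    c k n = q ^ n *
      (PowerSeries.coeff n (1 + PowerSeries.C (X - 1) * serW k)).eval q := by
  induction k generalizing n with
  | zero => 
    rw [h0]; simp only [serW, mul_zero, add_zero, PowerSeries.coeff_one]
    split_ifs with h <;> simp [h]
  | succ k ih =>
    rw [hs]
    have e : (1 + PowerSeries.C (X - 1) * serW (k + 1) : PowerSeries ℤ[X]) =
      (1 + PowerSeries.C (X - 1) * serL (k + 1)) * (1 + PowerSeries.C (X - 1) * serW k) := by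
      rw [serW]; ring
    rw [e, PowerSeries.coeff_mul, eval_finsetSum, Finset.mul_sum]
    refine Finset.sum_congr rfl fun p hp => ?_
    rw [ih, eval_mul, ← Finset.HasAntidiagonal.mem_antidiagonal.1 hp, pow_add]
    have : eval q (PowerSeries.coeff p.1 (1 + PowerSeries.C (X - 1) * serL (k + 1))) =
        (if (k + 1) ∣ p.1 then numP q (p.1 / (k + 1)) else 0) := by
      simp only [map_add, PowerSeries.coeff_one, PowerSeries.coeff_C_mul, serL,
        PowerSeries.coeff_mk, numP]
      by_cases h1 : p.1 = 0
      · simp [h1]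
      · by_cases h2 : (k + 1) ∣ p.1
        · have h3 : p.1 / (k + 1) ≠ 0 := by
            have := Nat.div_pos (Nat.le_of_dvd (by omega) h2) (by omega : 0 < k + 1)
            omega
          simp only [h1, h2, if_false, if_true, ne_eq, not_false_eq_true, and_self, h3]
          simp
        · simp [h1, h2]
    rw [this]
    ring

end Series



section Core

open Polynomial

variable {R : Type*} [CommRing R]

/-- Index of an ideal as an additive subgroup. -/
noncomputable def idx {S : Type*} [CommRing S] (I : Ideal S) : ℕ :=
  (Submodule.toAddSubgroup I).index

/-- Ideal of coefficients in degree `m` of the elements of `I` of degree at most `m`. -/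
noncomputable def lc (I : Ideal R[X]) (m : ℕ) : Ideal R where
  carrier := {r | ∃ p ∈ I, p.natDegree ≤ m ∧ p.coeff m = r}
  add_mem' := by
    rintro a b ⟨p, hp, hpd, rfl⟩ ⟨r, hr, hrd, rfl⟩
    exact ⟨p + r, I.add_mem hp hr, (natDegree_add_le_of_degree_le hpd hrd), by simp⟩
  zero_mem' := ⟨0, I.zero_mem, by simp, by simp⟩
  smul_mem' := by
    rintro c a ⟨p, hp, hpd, rfl⟩
    exact ⟨C c * p, I.mul_mem_left _ hp, (natDegree_C_mul_le c p).trans hpd, by simp⟩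

theorem mem_lc {I : Ideal R[X]} {m : ℕ} {r : R} :
    r ∈ lc I m ↔ ∃ p ∈ I, p.natDegree ≤ m ∧ p.coeff m = r := Iff.rfl

theorem lc_succ (I : Ideal R[X]) (m : ℕ) : lc I m ≤ lc I (m + 1) := by
  rintro r ⟨p, hp, hpd, rfl⟩
  refine ⟨X * p, I.mul_mem_left _ hp, ?_, ?_⟩
  · have := natDegree_mul_le (p := (X : R[X])) (q := p)
    have := natDegree_X_le (R := R)
    omega
  simp

theorem lc_mono (I : Ideal R[X]) : Monotone (lc I) := monotone_nat_of_le_succ (lc_succ I)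

/-- The colon ideal `(I : d)`. -/
noncomputable def col (I : Ideal R[X]) (d : R) : Ideal R[X] where
  carrier := {p | C d * p ∈ I}
  add_mem' := by
    intro a b ha hb
    simp only [Set.mem_ofPred_eq, mul_add] at *
    exact I.add_mem ha hb
  zero_mem' := by simp
  smul_mem' := by
    intro c a ha
    simp only [Set.mem_ofPred_eq, smul_eq_mul] at *
    rw [mul_left_comm]; exact I.mul_mem_left _ ha

theorem mem_col {I : Ideal R[X]} {d : R} {p : R[X]} : p ∈ col I d ↔ C d * p ∈ I := Iff.rfl

theorem modByMonic_mem {I : Ideal R[X]} {g p : R[X]} (hg : g ∈ I) :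
    p %ₘ g ∈ I ↔ p ∈ I := by
  conv_rhs => rw [← modByMonic_add_div p g]
  rw [I.add_mem_iff_left (I.mul_mem_right _ hg)]

/-- The ideal `(g) + d I'`. -/
noncomputable def mkI (I' : Ideal R[X]) (d : R) (g : R[X]) : Ideal R[X] :=
  Ideal.span {g} ⊔ Ideal.span {C d} * I'

theorem mem_mkI {I' : Ideal R[X]} {d : R} {g p : R[X]} :
    p ∈ mkI I' d g ↔ ∃ h, ∃ i ∈ I', p = g * h + C d * i := by
  unfold mkI
  rw [Submodule.mem_sup]
  simp only [Ideal.mem_span_singleton', Ideal.mem_span_singleton_mul]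
  constructor
  · rintro ⟨_, ⟨h, rfl⟩, _, ⟨i, hi, rfl⟩, rfl⟩
    exact ⟨h, i, hi, by ring⟩
  · rintro ⟨h, i, hi, rfl⟩
    exact ⟨_, ⟨h, rfl⟩, _, ⟨i, hi, rfl⟩, by ring⟩

theorem C_mul_modByMonic (d : R) (p g : R[X]) : (C d * p) %ₘ g = C d * (p %ₘ g) := by
  rw [← smul_eq_C_mul, smul_modByMonic, smul_eq_C_mul]

theorem mem_mkI_iff {I' : Ideal R[X]} {d : R} {g p : R[X]} (hg : g ∈ I') (hgm : g.Monic) :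
    p ∈ mkI I' d g ↔ ∃ i ∈ I', p %ₘ g = C d * i := by
  rw [mem_mkI]
  constructor
  · rintro ⟨h, i, hi, rfl⟩
    refine ⟨i %ₘ g, (modByMonic_mem hg).2 hi, ?_⟩
    rw [add_modByMonic, mul_comm g, (modByMonic_eq_zero_iff_dvd hgm).2 (dvd_mul_left _ _), zero_add,
      C_mul_modByMonic]
  · rintro ⟨i, hi, h⟩
    refine ⟨p /ₘ g, i, hi, ?_⟩
    rw [← h, add_comm, modByMonic_add_div]

theorem modByMonic_of_natDegree_le [Nontrivial R] {g p : R[X]} {k : ℕ} (hgm : g.Monic)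
    (hgk : g.natDegree = k + 1) (hp : p.natDegree ≤ k) : p %ₘ g = p := by
  rw [modByMonic_eq_self_iff hgm]
  apply degree_lt_degree
  omega

theorem natDegree_modByMonic_le' [Nontrivial R] {g : R[X]} (p : R[X]) {k : ℕ} (hgm : g.Monic)
    (hgk : g.natDegree = k + 1) : (p %ₘ g).natDegree ≤ k := by
  have := natDegree_modByMonic_lt p hgm (by rintro rfl; simp at hgk)
  omega

theorem mem_mkI_self (I' : Ideal R[X]) (d : R) (g : R[X]) : g ∈ mkI I' d g :=
  mem_mkI.2 ⟨1, 0, I'.zero_mem, by simp⟩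

/-- The property of containing a monic polynomial of degree `k`. -/
def HasMonic (I : Ideal R[X]) (k : ℕ) : Prop := ∃ g ∈ I, g.Monic ∧ g.natDegree = k

theorem HasMonic.succ {I : Ideal R[X]} {k : ℕ} (h : HasMonic I k) [Nontrivial R] :
    HasMonic I (k + 1) := by
  obtain ⟨g, hg, hm, hk⟩ := h
  exact ⟨X * g, I.mul_mem_left _ hg, monic_X.mul hm, by
    rw [natDegree_X_mul hm.ne_zero, hk]⟩

variable [IsDomain R]

theorem col_mkI {I' : Ideal R[X]} {d : R} {g : R[X]} (hd : d ≠ 0) (hg : g ∈ I') (hgm : g.Monic) :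
    col (mkI I' d g) d = I' := by
  ext p
  rw [mem_col, mem_mkI_iff hg hgm]
  constructor
  · rintro ⟨i, hi, h⟩
    rw [C_mul_modByMonic] at h
    have := mul_left_cancel₀ (C_ne_zero.2 hd) h
    rw [← modByMonic_mem hg, this]; exact hi
  · intro hp
    exact ⟨p %ₘ g, (modByMonic_mem hg).2 hp, C_mul_modByMonic _ _ _⟩

theorem lc_mkI {I' : Ideal R[X]} {d : R} {g f : R[X]} {k : ℕ} (hg : g ∈ I')
    (hgm : g.Monic) (hgk : g.natDegree = k + 1) (hf : f ∈ I') (hfm : f.Monic)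
    (hfk : f.natDegree = k) : lc (mkI I' d g) k = Ideal.span {d} := by
  apply le_antisymm
  · rintro r ⟨p, hp, hpk, rfl⟩
    rw [mem_mkI_iff hg hgm, modByMonic_of_natDegree_le hgm hgk hpk] at hp
    obtain ⟨i, hi, rfl⟩ := hp
    rw [coeff_C_mul]
    exact Ideal.mul_mem_right _ _ (Ideal.mem_span_singleton_self d)
  · rw [Ideal.span_singleton_le_iff_mem]
    refine ⟨C d * f, mem_mkI.2 ⟨0, f, hf, by simp⟩, (natDegree_C_mul_le d f).trans hfk.le, ?_⟩
    rw [coeff_C_mul, ← hfk, hfm.coeff_natDegree, mul_one]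

theorem lc_dvd [IsPrincipalIdealRing R] {I : Ideal R[X]} (h0 : lc I 0 ≠ ⊥) (m : ℕ) (a : R)
    (ha : lc I m = Ideal.span {a}) (p : R[X]) (hp : p ∈ I) (hpm : p.natDegree ≤ m) : C a ∣ p := by
  induction m generalizing a p with
  | zero =>
    have : p.coeff 0 ∈ lc I 0 := ⟨p, hp, hpm, rfl⟩
    rw [ha, Ideal.mem_span_singleton] at this
    rw [eq_C_of_natDegree_le_zero hpm]
    exact map_dvd C this
  | succ m ih =>
    obtain ⟨b, hb⟩ := (IsPrincipalIdealRing.principal (lc I m)).principal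
    change lc I m = Ideal.span {b} at hb
    have hb0 : b ≠ 0 := by
      rintro rfl
      apply h0
      rw [eq_bot_iff]
      refine (lc_mono I (Nat.zero_le m)).trans ?_
      simp [hb]
    have hba : b ∈ lc I (m + 1) := lc_succ I m (hb ▸ Ideal.mem_span_singleton_self b)
    rw [ha, Ideal.mem_span_singleton] at hba
    obtain ⟨e, rfl⟩ := hba
    have hpa : p.coeff (m + 1) ∈ lc I (m + 1) := ⟨p, hp, hpm, rfl⟩
    rw [ha, Ideal.mem_span_singleton] at hpa
    obtain ⟨t, ht⟩ := hpa
    have hbm : a * e ∈ lc I m := hb ▸ Ideal.mem_span_singleton_self _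
    obtain ⟨f, hf, hfm, hfc⟩ := hbm
    have hdf := ih _ hb f hf hfm
    have hq : C (a * e) ∣ C e * p - C t * (X * f) := by
      apply ih _ hb
      · exact I.sub_mem (I.mul_mem_left _ hp) (I.mul_mem_left _ (I.mul_mem_left _ hf))
      · rw [natDegree_le_iff_coeff_eq_zero]
        intro N hN
        rcases Nat.lt_or_ge (m + 1) N with h | h
        · obtain ⟨N, rfl⟩ := Nat.exists_eq_succ_of_ne_zero (show N ≠ 0 by omega)
          simp only [coeff_sub, coeff_C_mul, Nat.succ_eq_add_one, coeff_X_mul]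
          rw [coeff_eq_zero_of_natDegree_lt (by omega : p.natDegree < N + 1),
            coeff_eq_zero_of_natDegree_lt (by omega : f.natDegree < N)]
          simp
        · obtain rfl : N = m + 1 := by omega
          simp only [coeff_sub, coeff_C_mul, coeff_X_mul, ht, hfc]
          ring
    have h3 : C (a * e) ∣ C e * p := by
      have h4 : C (a * e) ∣ C t * (X * f) := Dvd.dvd.mul_left (Dvd.dvd.mul_left hdf _) _
      have := dvd_add hq h4
      rwa [sub_add_cancel] at this
    rw [mul_comm, C_mul] at h3
    exact (mul_dvd_mul_iff_left (C_ne_zero.2 (right_ne_zero_of_mul hb0))).1 h3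

theorem lc_zero_ne_bot [Infinite R] {I : Ideal R[X]} (h : idx I ≠ 0) : lc I 0 ≠ ⊥ := by
  intro hb
  have hfin : Finite (R[X] ⧸ Submodule.toAddSubgroup I) := 
    Nat.finite_of_card_ne_zero h
  obtain ⟨x, y, hxy, he⟩ := Finite.exists_ne_map_eq_of_infinite
    (fun r : R => (QuotientAddGroup.mk (C r) : R[X] ⧸ Submodule.toAddSubgroup I))
  rw [QuotientAddGroup.eq] at he
  have h1 : -x + y ∈ lc I 0 := ⟨-C x + C y, he, by
    rw [← C_neg, ← C_add, natDegree_C], by simp⟩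
  rw [hb, Ideal.mem_bot] at h1
  exact hxy (by linear_combination -h1)

theorem structure_I [IsPrincipalIdealRing R] {I : Ideal R[X]} (h0 : lc I 0 ≠ ⊥) {k : ℕ} {d : R}
    {g : R[X]} (hg : g ∈ I) (hgm : g.Monic) (hgk : g.natDegree = k + 1)
    (hd : lc I k = Ideal.span {d}) :
    d ≠ 0 ∧ HasMonic (col I d) k ∧ g ∈ col I d ∧ I = mkI (col I d) d g := by
  have hd0 : d ≠ 0 := by
    rintro rfl
    apply h0
    rw [eq_bot_iff]
    refine (lc_mono I (Nat.zero_le k)).trans ?_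
    simp [hd]
  have hdiv := lc_dvd h0 k d hd
  have hgc : g ∈ col I d := I.mul_mem_left _ hg
  refine ⟨hd0, ?_, hgc, ?_⟩
  · have : d ∈ lc I k := hd ▸ Ideal.mem_span_singleton_self d
    obtain ⟨f, hf, hfk, hfc⟩ := this
    obtain ⟨f', rfl⟩ := hdiv f hf hfk
    rw [coeff_C_mul] at hfc
    have hc : f'.coeff k = 1 := mul_left_cancel₀ hd0 (by rw [hfc, mul_one])
    rw [natDegree_C_mul hd0] at hfk
    have hn : f'.natDegree = k :=
      le_antisymm hfk (le_natDegree_of_ne_zero (by rw [hc]; exact one_ne_zero))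
    exact ⟨f', hf, by rw [Monic, leadingCoeff, hn, hc], hn⟩
  · ext p
    rw [mem_mkI_iff hgc hgm]
    constructor
    · intro hp
      have h1 : p %ₘ g ∈ I := (modByMonic_mem hg).2 hp
      obtain ⟨i, hi⟩ := hdiv _ h1 (natDegree_modByMonic_le' p hgm hgk)
      exact ⟨i, by rw [mem_col, ← hi]; exact h1, hi⟩
    · rintro ⟨i, hi, h⟩
      rw [← modByMonic_mem hg, h]
      exact hi

theorem idx_mkI {I' : Ideal R[X]} {d : R} {g : R[X]} {k : ℕ} (hd : d ≠ 0) (hg : g ∈ I')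
    (hgm : g.Monic) (hgk : g.natDegree = k + 1) :
    idx (mkI I' d g) = idx (Ideal.span {d}) ^ (k + 1) * idx I' := by
  set I := mkI I' d g with hI
  let φ : R[X] →+ R[X] := AddMonoidHom.mulLeft (C d)
  let K : AddSubgroup R[X] := Submodule.toAddSubgroup I ⊔ φ.range
  have h1 : (Submodule.toAddSubgroup I).relIndex K = idx I' := by
    rw [AddSubgroup.relIndex_sup_left, ← AddSubgroup.index_comap]
    unfold idx
    congr 1
    ext p
    have : p ∈ col I d ↔ p ∈ I' := by rw [hI, col_mkI hd hg hgm]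
    exact this
  let ψ : R[X] →+ (Fin (k + 1) → R ⧸ Ideal.span {d}) :=
    { toFun := fun p i => Ideal.Quotient.mk (Ideal.span {d}) ((p %ₘ g).coeff i)
      map_zero' := by ext i; simp
      map_add' := by intro a b; ext i; simp [add_modByMonic] }
  have hmemK : ∀ p, p ∈ K ↔ C d ∣ p %ₘ g := by
    intro p
    constructor
    · intro hp
      obtain ⟨a, ha, b, hb, rfl⟩ := AddSubgroup.mem_sup.1 hp
      obtain ⟨c, rfl⟩ := hb
      obtain ⟨i, -, hi⟩ := (mem_mkI_iff hg hgm).1 ha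
      rw [add_modByMonic, hi]
      change C d ∣ C d * i + (C d * c) %ₘ g
      rw [C_mul_modByMonic]
      exact dvd_add (dvd_mul_right _ _) (dvd_mul_right _ _)
    · rintro ⟨c, hc⟩
      rw [← modByMonic_add_div p g, add_comm, hc]
      exact AddSubgroup.add_mem_sup (I.mul_mem_right _ (mem_mkI_self _ _ _)) ⟨c, rfl⟩
  have hker : ψ.ker = K := by
    ext p
    rw [hmemK, C_dvd_iff_dvd_coeff, AddMonoidHom.mem_ker]
    constructor
    · intro h i
      by_cases hi : i < k + 1
      · have := congrFun h ⟨i, hi⟩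
        change Ideal.Quotient.mk (Ideal.span {d}) ((p %ₘ g).coeff i) = 0 at this
        rwa [Ideal.Quotient.eq_zero_iff_mem, Ideal.mem_span_singleton] at this
      · rw [coeff_eq_zero_of_natDegree_lt]
        · exact dvd_zero _
        · have := natDegree_modByMonic_le' p hgm hgk
          omega
    · intro h
      ext i
      change Ideal.Quotient.mk (Ideal.span {d}) ((p %ₘ g).coeff i) = 0
      rw [Ideal.Quotient.eq_zero_iff_mem, Ideal.mem_span_singleton]
      exact h i
  have hsurj : Function.Surjective ψ := by
    intro w
    choose r hr using fun i => Ideal.Quotient.mk_surjective (w i)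
    let p : R[X] := ∑ i : Fin (k + 1), monomial i (r i)
    have hp : p.natDegree ≤ k := by
      apply natDegree_sum_le_of_forall_le
      intro i _
      exact (natDegree_monomial_le _).trans (by omega)
    refine ⟨p, ?_⟩
    ext i
    change Ideal.Quotient.mk (Ideal.span {d}) ((p %ₘ g).coeff i) = w i
    rw [modByMonic_of_natDegree_le hgm hgk hp, ← hr]
    congr 1
    simp only [p, finsetSum_coeff, coeff_monomial]
    rw [Finset.sum_eq_single i]
    · simp
    · intro b _ hb
      rw [if_neg]
      exact fun h => hb (Fin.ext h)
    · simp
  have h2 : K.index = idx (Ideal.span {d}) ^ (k + 1) := by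
    rw [← hker, AddSubgroup.index_ker, AddMonoidHom.range_eq_top.2 hsurj,
      AddSubgroup.card_top, Nat.card_fun]
    simp only [Nat.card_eq_fintype_card, Fintype.card_fin]
    rfl
  have h3 := AddSubgroup.relIndex_mul_index (show Submodule.toAddSubgroup I ≤ K from le_sup_left)
  rw [h1, h2] at h3
  rw [mul_comm]
  exact h3.symm

/-- The ideals over `(d, I')`. -/
def Fib (k : ℕ) (d : R) (I' : Ideal R[X]) : Type _ :=
  {I : Ideal R[X] // HasMonic I (k + 1) ∧ idx I ≠ 0 ∧ lc I k = Ideal.span {d} ∧ col I d = I'}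

theorem card_Fib [IsPrincipalIdealRing R] [Infinite R] {k : ℕ} {d : R} {I' : Ideal R[X]}
    (hd : d ≠ 0) (hdi : idx (Ideal.span {d}) ≠ 0) (hI' : HasMonic I' k) (hi : idx I' ≠ 0) :
    Nat.card (Fib k d I') = idx (Ideal.span {d}) ^ (k + 1) := by
  obtain ⟨f, hf, hfm, hfk⟩ := hI'
  have hI'' : HasMonic I' k := ⟨f, hf, hfm, hfk⟩
  obtain ⟨g, hg, hgm, hgk⟩ := hI''.succ
  have hmonic : ∀ r : R[X], r.natDegree ≤ k → (g + r).Monic ∧ (g + r).natDegree = k + 1 := by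
    intro r hr
    have hlt : r.degree < g.degree := degree_lt_degree (by omega)
    exact ⟨hgm.add_of_left hlt, by rw [natDegree_add_eq_left_of_degree_lt hlt, hgk]⟩
  have hfib : ∀ g' ∈ I', g'.Monic → g'.natDegree = k + 1 →
      HasMonic (mkI I' d g') (k + 1) ∧ idx (mkI I' d g') ≠ 0 ∧
      lc (mkI I' d g') k = Ideal.span {d} ∧ col (mkI I' d g') d = I' := by
    intro g' h1 h2 h3
    refine ⟨⟨g', mem_mkI_self _ _ _, h2, h3⟩, ?_, lc_mkI h1 h2 h3 hf hfm hfk, col_mkI hd h1 h2⟩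
    rw [idx_mkI hd h1 h2 h3]
    exact mul_ne_zero (pow_ne_zero _ hdi) hi
  have hr : ∀ i ∈ I', g + i %ₘ g ∈ I' := fun i hi => I'.add_mem hg ((modByMonic_mem hg).2 hi)
  have hrm := fun i : R[X] => hmonic (i %ₘ g) (natDegree_modByMonic_le' i hgm hgk)
  let θ : I' → Fib k d I' := fun i => ⟨mkI I' d (g + i.1 %ₘ g),
    hfib _ (hr i.1 i.2) (hrm i.1).1 (hrm i.1).2⟩
  have hθs : Function.Surjective θ := by
    rintro ⟨I, ⟨g', hg', hgm', hgk'⟩, hix, hlc, hcol⟩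
    obtain ⟨-, -, h1, h2⟩ := structure_I (lc_zero_ne_bot hix) hg' hgm' hgk' hlc
    rw [hcol] at h1 h2
    have hdeg : (g' - g).natDegree ≤ k := by
      have : (g' - g).degree < g'.degree := by
        apply degree_sub_lt_left _ hgm'.ne_zero (by rw [hgm', hgm])
        rw [degree_eq_natDegree hgm'.ne_zero, degree_eq_natDegree hgm.ne_zero, hgk, hgk']
      rw [degree_eq_natDegree hgm'.ne_zero, hgk'] at this
      exact natDegree_le_of_degree_le (Order.lt_succ_iff.1 (by exact_mod_cast this))
    refine ⟨⟨g' - g, I'.sub_mem h1 hg⟩, ?_⟩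
    apply Subtype.ext
    change mkI I' d (g + (g' - g) %ₘ g) = I
    rw [modByMonic_of_natDegree_le hgm hgk hdeg, add_sub_cancel, ← h2]
  set I0 := mkI I' d g with hI0
  have hI0le : I0 ≤ I' := by
    intro p hp
    obtain ⟨h, i, hi, rfl⟩ := mem_mkI.1 hp
    exact I'.add_mem (I'.mul_mem_right _ hg) (I'.mul_mem_left _ hi)
  have hle : ∀ i j : I', -i.1 + j.1 ∈ I0 → mkI I' d (g + i.1 %ₘ g) ≤ mkI I' d (g + j.1 %ₘ g) := by
    intro i j hij p hp
    obtain ⟨a, ha, hae⟩ := (mem_mkI_iff hg hgm).1 hij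
    rw [add_modByMonic, neg_modByMonic] at hae
    obtain ⟨h, b, hb, rfl⟩ := mem_mkI.1 hp
    rw [mem_mkI]
    exact ⟨h, b - a * h, I'.sub_mem hb (I'.mul_mem_right _ ha), by linear_combination -h * hae⟩
  have hθ : ∀ i j : I', θ i = θ j ↔ -i.1 + j.1 ∈ I0 := by
    intro i j
    constructor
    · intro h
      have h' : mkI I' d (g + i.1 %ₘ g) = mkI I' d (g + j.1 %ₘ g) := congrArg Subtype.val h
      have h1 : (g + j.1 %ₘ g) - (g + i.1 %ₘ g) ∈ mkI I' d (g + j.1 %ₘ g) :=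
        Ideal.sub_mem _ (mem_mkI_self _ _ _) (h' ▸ mem_mkI_self _ _ _)
      have e : (g + j.1 %ₘ g) - (g + i.1 %ₘ g) = (-i.1 + j.1) %ₘ g := by
        rw [add_modByMonic, neg_modByMonic]; ring
      rw [e, mem_mkI_iff (hr _ j.2) (hrm _).1, modByMonic_of_natDegree_le (hrm _).1 (hrm _).2
        (natDegree_modByMonic_le' _ hgm hgk)] at h1
      exact (mem_mkI_iff hg hgm).2 h1
    · intro h
      apply Subtype.ext
      apply le_antisymm (hle i j h)
      apply hle j i
      have := I0.neg_mem h
      rwa [neg_add_rev, neg_neg] at this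
  have hcard : Nat.card (Fib k d I') =
      (Submodule.toAddSubgroup I0).relIndex (Submodule.toAddSubgroup I') := by
    unfold AddSubgroup.relIndex AddSubgroup.index
    symm
    refine Nat.card_congr (Equiv.ofBijective (Quotient.lift θ ?_) ⟨?_, ?_⟩)
    · intro a b hab
      exact (hθ a b).2 (QuotientAddGroup.leftRel_apply.1 hab)
    · rintro ⟨a⟩ ⟨b⟩ hab
      exact Quotient.sound (QuotientAddGroup.leftRel_apply.2 ((hθ a b).1 hab))
    · intro y
      obtain ⟨x, rfl⟩ := hθs y
      exact ⟨Quotient.mk _ x, rfl⟩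
  have h3 := AddSubgroup.relIndex_mul_index
    (show Submodule.toAddSubgroup I0 ≤ Submodule.toAddSubgroup I' from hI0le)
  have h4 := idx_mkI hd hg hgm hgk
  rw [hcard]
  exact Nat.eq_of_mul_eq_mul_right (Nat.pos_of_ne_zero hi) (h3.trans h4)

end Core


section Count

open Polynomial

theorem idx_eq_card {S : Type*} [CommRing S] (I : Ideal S) : idx I = Nat.card (S ⧸ I) := rfl

theorem idx_eq_pow (F : Type*) {S : Type*} [Field F] [Finite F] [CommRing S] [Algebra F S]
    {I : Ideal S} (h : idx I ≠ 0) :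
    Module.Finite F (S ⧸ I) ∧ idx I = Nat.card F ^ Module.finrank F (S ⧸ I) := by
  rw [idx_eq_card] at h
  have : Finite (S ⧸ I) := Nat.finite_of_card_ne_zero h
  exact ⟨inferInstance, by rw [idx_eq_card, Module.natCard_eq_pow_finrank (K := F)]⟩

theorem idx_eq_pow_iff (F : Type*) {S : Type*} [Field F] [Finite F] [CommRing S] [Algebra F S]
    {I : Ideal S} {n : ℕ} (hn : 1 ≤ n) :
    Module.finrank F (S ⧸ I) = n ↔ idx I = Nat.card F ^ n := by
  have hq : 1 < Nat.card F := Finite.one_lt_card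
  constructor
  · rintro rfl
    have : Module.Finite F (S ⧸ I) := Module.finite_of_finrank_pos (by omega)
    rw [idx_eq_card, Module.natCard_eq_pow_finrank (K := F)]
  · intro h
    have h0 : idx I ≠ 0 := by rw [h]; positivity
    have := (idx_eq_pow F h0).2
    rw [h] at this
    exact (Nat.pow_right_injective hq this).symm

theorem hasMonic_of_idx (F : Type*) {R : Type*} [Field F] [Finite F] [CommRing R] [Nontrivial R]
    [Algebra F R] {I : Ideal R[X]} {n : ℕ} (h : idx I = Nat.card F ^ n) : HasMonic I n := by
  have hq : 1 < Nat.card F := Finite.one_lt_card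
  have h0 : idx I ≠ 0 := by rw [h]; positivity
  obtain ⟨hfin, hi⟩ := idx_eq_pow F h0
  have hn : Module.finrank F (R[X] ⧸ I) = n := (Nat.pow_right_injective hq (h.symm.trans hi)).symm
  let x : R[X] ⧸ I := Ideal.Quotient.mkₐ F I X
  let p := (Algebra.lmul F (R[X] ⧸ I) x).charpoly
  have hp : aeval x p = 0 := by
    have h1 := LinearMap.aeval_self_charpoly (Algebra.lmul F (R[X] ⧸ I) x)
    change aeval (Algebra.lmul F (R[X] ⧸ I) x) p = 0 at h1
    rw [aeval_algHom_apply] at h1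
    exact Algebra.lmul_injective (h1.trans (map_zero _).symm)
  refine ⟨p.map (algebraMap F R), ?_, (LinearMap.charpoly_monic _).map _, ?_⟩
  · rw [← aeval_X_left_eq_map, ← Ideal.Quotient.eq_zero_iff_mem]
    change Ideal.Quotient.mkₐ F I _ = 0
    rw [← aeval_algHom_apply]
    exact hp
  · rw [natDegree_map_eq_of_injective (algebraMap F R).injective, LinearMap.charpoly_natDegree, hn]

variable (R : Type*) [CommRing R]

/-- Ideals of `R[X]` of index `q^n` containing a monic polynomial of degree `k`. -/
def Jt (q k n : ℕ) : Type _ := {I : Ideal R[X] // HasMonic I k ∧ idx I = q ^ n}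

/-- Ideals of `R` whose index has `j`-th power `q^a`. -/
def Dt (q j a : ℕ) : Type _ := {D : Ideal R // idx D ^ j = q ^ a}

variable {R} [IsDomain R] [IsPrincipalIdealRing R] [Infinite R]

theorem idx_bot : idx (⊥ : Ideal R) = 0 := by
  change AddSubgroup.index (⊥ : AddSubgroup R) = 0
  rw [AddSubgroup.index_bot, Nat.card_eq_zero_of_infinite]

/-- A generator of an ideal. -/
noncomputable def gen (D : Ideal R) : R := Submodule.IsPrincipal.generator D

theorem span_gen (D : Ideal R) : Ideal.span {gen D} = D := Ideal.span_singleton_generator D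

theorem gen_ne_zero {D : Ideal R} (h : idx D ≠ 0) : gen D ≠ 0 := by
  intro h0
  have := span_gen D
  rw [h0, Ideal.span_singleton_eq_bot.2 rfl] at this
  rw [← this, idx_bot] at h
  exact h rfl

theorem idx_of_Fib {k : ℕ} {d : R} {I' : Ideal R[X]} (I : Fib k d I') :
    idx I.1 = idx (Ideal.span {d}) ^ (k + 1) * idx I' := by
  obtain ⟨I, ⟨g, hg, hgm, hgk⟩, hi, hlc, hcol⟩ := I
  obtain ⟨hd, -, h1, h2⟩ := structure_I (lc_zero_ne_bot hi) hg hgm hgk hlc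
  rw [hcol] at h1 h2
  change idx I = _
  rw [h2, idx_mkI hd h1 hgm hgk]

theorem Dt_ne_zero {q j a : ℕ} (hq : 1 < q) (hj : j ≠ 0) (D : Dt R q j a) : idx D.1 ≠ 0 := by
  intro h
  have := D.2
  rw [h, zero_pow hj] at this
  exact absurd this.symm (by positivity)

theorem Jt_ne_zero {q k n : ℕ} (hq : 1 < q) (I : Jt R q k n) : idx I.1 ≠ 0 := by
  rw [I.2.2]; positivity

/-- The total space of the fibration. -/
abbrev Tot (R : Type*) [CommRing R] [IsDomain R] [IsPrincipalIdealRing R] [Infinite R]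
    (q k n : ℕ) : Type _ :=
  Σ p : {p // p ∈ Finset.HasAntidiagonal.antidiagonal n}, Σ D : Dt R q (k + 1) p.1.1,
    Σ I' : Jt R q k p.1.2, Fib k (gen D.1) I'.1

theorem tot_equiv (F : Type*) [Field F] [Finite F] [Algebra F R] (k n : ℕ) :
    Nonempty (Tot R (Nat.card F) k n ≃ Jt R (Nat.card F) (k + 1) n) := by
  have hq : 1 < Nat.card F := Finite.one_lt_card
  let T : Tot R (Nat.card F) k n → Jt R (Nat.card F) (k + 1) n := fun t =>
    ⟨t.2.2.2.1, t.2.2.2.2.1, by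
      rw [idx_of_Fib t.2.2.2, span_gen, t.2.1.2, t.2.2.1.2.2, ← pow_add,
        Finset.HasAntidiagonal.mem_antidiagonal.1 t.1.2]⟩
  refine ⟨Equiv.ofBijective T ⟨?_, ?_⟩⟩
  · rintro ⟨⟨⟨a, b⟩, hp⟩, ⟨D, hD⟩, ⟨I', hm, hi⟩, ⟨I, hI⟩⟩ ⟨⟨⟨a', b'⟩, hp'⟩, ⟨D', hD'⟩, ⟨I'', hm', hi'⟩,
      ⟨I2, hI2⟩⟩ h
    have h1 : I = I2 := congrArg Subtype.val h
    subst h1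
    have h2 : D = D' := by
      rw [← span_gen D, ← span_gen D', ← hI.2.2.1]
      exact hI2.2.2.1
    subst h2
    have h3 : I' = I'' := hI.2.2.2.symm.trans hI2.2.2.2
    subst h3
    have h4 : a = a' := Nat.pow_right_injective hq (hD.symm.trans hD')
    have h5 : b = b' := Nat.pow_right_injective hq (hi.symm.trans hi')
    subst h4 h5
    rfl
  · rintro ⟨I, ⟨g, hg, hgm, hgk⟩, hi⟩
    have hi0 : idx I ≠ 0 := by rw [hi]; positivity
    have hlc := (span_gen (lc I k)).symm
    obtain ⟨hd, hcm, h1, h2⟩ := structure_I (lc_zero_ne_bot hi0) hg hgm hgk hlc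
    have h3 := idx_mkI hd h1 hgm hgk
    rw [← h2, ← hlc] at h3
    have h5 : idx (lc I k) ≠ 0 := by
      intro h; rw [h, zero_pow (by omega), zero_mul] at h3; exact hi0 h3
    have h6 : idx (col I (gen (lc I k))) ≠ 0 := by
      intro h; rw [h, mul_zero] at h3; exact hi0 h3
    obtain ⟨m, e5⟩ : ∃ m, idx (lc I k) = Nat.card F ^ m := ⟨_, (idx_eq_pow F h5).2⟩
    obtain ⟨b, e6⟩ : ∃ b, idx (col I (gen (lc I k))) = Nat.card F ^ b :=
      ⟨_, (idx_eq_pow F h6).2⟩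
    have hs : m * (k + 1) + b = n := by
      apply Nat.pow_right_injective hq
      change Nat.card F ^ (m * (k + 1) + b) = Nat.card F ^ n
      rw [← hi, h3, e5, e6]; ring
    exact ⟨⟨⟨⟨m * (k + 1), b⟩, Finset.HasAntidiagonal.mem_antidiagonal.2 hs⟩,
      ⟨lc I k, by rw [e5, ← pow_mul]⟩, ⟨col I (gen (lc I k)), hcm, e6⟩,
      ⟨I, ⟨g, hg, hgm, hgk⟩, hi0, hlc, rfl⟩⟩, rfl⟩

theorem card_Jt_succ (F : Type*) [Field F] [Finite F] [Algebra F R] (k n : ℕ)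
    (hDf : ∀ a, Finite (Dt R (Nat.card F) (k + 1) a)) (hJf : ∀ b, Finite (Jt R (Nat.card F) k b)) :
    Finite (Jt R (Nat.card F) (k + 1) n) ∧
    Nat.card (Jt R (Nat.card F) (k + 1) n) = ∑ p ∈ Finset.HasAntidiagonal.antidiagonal n,
      Nat.card (Dt R (Nat.card F) (k + 1) p.1) *
        (Nat.card (Jt R (Nat.card F) k p.2) * Nat.card F ^ p.1) := by
  have hq : 1 < Nat.card F := Finite.one_lt_card
  obtain ⟨e⟩ := tot_equiv (R := R) F k n
  have hF : ∀ (a b : ℕ) (D : Dt R (Nat.card F) (k + 1) a) (I' : Jt R (Nat.card F) k b),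
      Nat.card (Fib k (gen D.1) I'.1) = Nat.card F ^ a := by
    intro a b D I'
    have h0 := Dt_ne_zero hq (by omega) D
    rw [card_Fib (gen_ne_zero h0) (by rwa [span_gen]) I'.2.1 (Jt_ne_zero hq I'), span_gen, D.2]
  have hFf : ∀ (a b : ℕ) (D : Dt R (Nat.card F) (k + 1) a) (I' : Jt R (Nat.card F) k b),
      Finite (Fib k (gen D.1) I'.1) := by
    intro a b D I'
    apply Nat.finite_of_card_ne_zero
    rw [hF]; positivity
  refine ⟨Finite.of_equiv _ e, ?_⟩
  rw [← Nat.card_congr e, Nat.card_sigma,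
    ← Finset.sum_coe_sort (Finset.HasAntidiagonal.antidiagonal n)]
  refine Finset.sum_congr rfl fun p _ => ?_
  have := Fintype.ofFinite (Dt R (Nat.card F) (k + 1) p.1.1)
  have := Fintype.ofFinite (Jt R (Nat.card F) k p.1.2)
  rw [Nat.card_sigma]
  simp only [Nat.card_sigma, hF]
  simp

theorem Jt_zero (q : ℕ) (hq : 1 < q) (n : ℕ) :
    Finite (Jt R q 0 n) ∧ Nat.card (Jt R q 0 n) = if n = 0 then 1 else 0 := by
  have htop : ∀ I : Jt R q 0 n, I.1 = ⊤ := by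
    rintro ⟨I, ⟨g, hg, hgm, hg0⟩, hi⟩
    rw [hgm.natDegree_eq_zero.1 hg0] at hg
    exact (Ideal.eq_top_iff_one _).2 hg
  have hsub : Subsingleton (Jt R q 0 n) := ⟨fun a b => Subtype.ext ((htop a).trans (htop b).symm)⟩
  have hidx : idx (⊤ : Ideal R[X]) = 1 := AddSubgroup.index_top
  refine ⟨inferInstance, ?_⟩
  split_ifs with h
  · subst h
    have : Nonempty (Jt R q 0 0) :=
      ⟨⟨⊤, ⟨1, trivial, monic_one, natDegree_one⟩, by rw [hidx, pow_zero]⟩⟩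
    exact Nat.card_unique
  · have : IsEmpty (Jt R q 0 n) := ⟨fun I => by
      have h2 := I.2.2
      rw [htop I, hidx] at h2
      have := Nat.one_lt_pow h hq
      omega⟩
    exact Nat.card_of_isEmpty

theorem card_Dt (F : Type*) [Field F] [Finite F] [Algebra F R] (P : ℕ → ℕ)
    (hP : ∀ m, Nat.card {D : Ideal R // idx D = Nat.card F ^ m} = P m)
    (hPf : ∀ m, Finite {D : Ideal R // idx D = Nat.card F ^ m}) (j a : ℕ) (hj : 1 ≤ j) :
    Finite (Dt R (Nat.card F) j a) ∧
    Nat.card (Dt R (Nat.card F) j a) = if j ∣ a then P (a / j) else 0 := by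
  have hq : 1 < Nat.card F := Finite.one_lt_card
  by_cases h : j ∣ a
  · obtain ⟨m, rfl⟩ := h
    have e : Dt R (Nat.card F) j (j * m) ≃ {D : Ideal R // idx D = Nat.card F ^ m} := by
      refine Equiv.subtypeEquivRight fun D => ?_
      rw [mul_comm, pow_mul]
      exact (Nat.pow_left_injective (by omega)).eq_iff
    rw [Nat.card_congr e, hP, Nat.mul_div_cancel_left _ (by omega)]
    exact ⟨Finite.of_equiv _ e.symm, by simp⟩
  · have : IsEmpty (Dt R (Nat.card F) j a) := ⟨fun D => by
      have h1 := (idx_eq_pow F (Dt_ne_zero hq (by omega) D)).2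
      have h2 := D.2
      rw [h1, ← pow_mul] at h2
      exact h ⟨_, (Nat.pow_right_injective hq h2).symm.trans (mul_comm _ _)⟩⟩
    exact ⟨inferInstance, by simp [h]⟩

end Count

section Laurent

open Polynomial LaurentPolynomial

variable {F : Type*} [Field F]

theorem mon_lift {m : ℕ} (p : F[X]) (c : F) (hp : p.Monic) (hm : p.natDegree = m) :
    (p * X + Polynomial.C c).Monic ∧ (p * X + Polynomial.C c).natDegree = m + 1 := by
  have h1 : (p * X).Monic := hp.mul monic_X
  have h2 : (p * X).natDegree = m + 1 := by rw [natDegree_mul_X hp.ne_zero, hm]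
  have hlt : (Polynomial.C c).degree < (p * X).degree := by
    apply degree_lt_degree; rw [natDegree_C, h2]; omega
  exact ⟨h1.add_of_left hlt, by rw [natDegree_add_eq_left_of_degree_lt hlt, h2]⟩

theorem mon_equiv (S : F → Prop) (m : ℕ) :
    Nonempty ({p : F[X] // p.Monic ∧ p.natDegree = m} × {c : F // S c} ≃
      {p : F[X] // p.Monic ∧ p.natDegree = m + 1 ∧ S (p.coeff 0)}) := by
  refine ⟨Equiv.ofBijective (fun t => ⟨t.1.1 * X + Polynomial.C t.2.1,
    (mon_lift t.1.1 t.2.1 t.1.2.1 t.1.2.2).1, (mon_lift t.1.1 t.2.1 t.1.2.1 t.1.2.2).2, ?_⟩)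
      ⟨?_, ?_⟩⟩
  · simpa using t.2.2
  · rintro ⟨⟨p, hp⟩, ⟨c, hc⟩⟩ ⟨⟨p', hp'⟩, ⟨c', hc'⟩⟩ h
    have h1 : p * X + Polynomial.C c = p' * X + Polynomial.C c' := congrArg Subtype.val h
    have h2 : c = c' := by simpa using congrArg (fun r => r.coeff 0) h1
    subst h2
    have h3 : p = p' := mul_right_cancel₀ X_ne_zero (add_right_cancel h1)
    subst h3
    rfl
  · rintro ⟨p, hp, hm, hS⟩
    have e := divX_mul_X_add p
    have h1 : p.divX.natDegree = m := by rw [natDegree_divX_eq_natDegree_tsub_one, hm]; rfl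
    have h2 : p.divX.Monic := by
      have h3 : p.coeff (m + 1) = 1 := by rw [← hm]; exact hp
      rw [Monic, leadingCoeff, h1, coeff_divX, h3]
    exact ⟨⟨⟨p.divX, h2, h1⟩, ⟨p.coeff 0, hS⟩⟩, Subtype.ext e⟩

theorem card_mon [Finite F] (m : ℕ) :
    Finite {p : F[X] // p.Monic ∧ p.natDegree = m} ∧
    Nat.card {p : F[X] // p.Monic ∧ p.natDegree = m} = Nat.card F ^ m := by
  induction m with
  | zero =>
    have : Unique {p : F[X] // p.Monic ∧ p.natDegree = 0} :=
      { default := ⟨1, monic_one, natDegree_one⟩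
        uniq := fun p => Subtype.ext (p.2.1.natDegree_eq_zero.1 p.2.2) }
    exact ⟨inferInstance, by rw [Nat.card_unique, pow_zero]⟩
  | succ m ih =>
    obtain ⟨e⟩ := mon_equiv (fun _ : F => True) m
    have := ih.1
    have e2 : {p : F[X] // p.Monic ∧ p.natDegree = m + 1 ∧ True} ≃
      {p : F[X] // p.Monic ∧ p.natDegree = m + 1} := Equiv.subtypeEquivRight (by simp)
    refine ⟨Finite.of_equiv _ (e.trans e2), ?_⟩
    rw [← Nat.card_congr (e.trans e2), Nat.card_prod, ih.2, pow_succ,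
      Nat.card_congr (Equiv.subtypeUnivEquiv (p := fun _ : F => True) (fun _ => trivial))]

theorem card_mon_ne [Finite F] (m : ℕ) :
    Finite {p : F[X] // p.Monic ∧ p.natDegree = m ∧ p.coeff 0 ≠ 0} ∧
    Nat.card {p : F[X] // p.Monic ∧ p.natDegree = m ∧ p.coeff 0 ≠ 0} =
      if m = 0 then 1 else (Nat.card F - 1) * Nat.card F ^ (m - 1) := by
  cases m with
  | zero =>
    have : Unique {p : F[X] // p.Monic ∧ p.natDegree = 0 ∧ p.coeff 0 ≠ 0} :=
      { default := ⟨1, monic_one, natDegree_one, by simp⟩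
        uniq := fun p => Subtype.ext (p.2.1.natDegree_eq_zero.1 p.2.2.1) }
    exact ⟨inferInstance, by rw [Nat.card_unique, if_pos rfl]⟩
  | succ m =>
    obtain ⟨e⟩ := mon_equiv (fun c : F => c ≠ 0) m
    obtain ⟨h1, h2⟩ := card_mon (F := F) m
    refine ⟨Finite.of_equiv _ e, ?_⟩
    have h3 : Nat.card {c : F // c ≠ 0} = Nat.card F - 1 := by
      rw [← Nat.card_units, Nat.card_congr unitsEquivNeZero]
    rw [← Nat.card_congr e, Nat.card_prod, h2, h3, if_neg (by omega), mul_comm]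
    rfl

theorem T_dvd_cancel (a b : F[T;T⁻¹]) (n : ℤ) (h : a ∣ b * T n) : a ∣ b := by
  obtain ⟨c, hc⟩ := h
  refine ⟨c * T (-n), ?_⟩
  rw [← mul_assoc, ← hc, mul_assoc, ← T_add, add_neg_cancel, T_zero, mul_one]

theorem laurent_span (D : Ideal F[T;T⁻¹]) (p : F[X])
    (hp : D.comap (toLaurent (R := F)) = Ideal.span {p}) : D = Ideal.span {toLaurent p} := by
  apply le_antisymm
  · intro f hf
    obtain ⟨n, f', hf'⟩ := f.exists_T_pow
    have h1 : f' ∈ D.comap (toLaurent (R := F)) := by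
      rw [Ideal.mem_comap, hf']; exact D.mul_mem_right _ hf
    rw [hp, Ideal.mem_span_singleton] at h1
    rw [Ideal.mem_span_singleton]
    apply T_dvd_cancel _ _ n
    rw [← hf']
    exact map_dvd _ h1
  · rw [Ideal.span_singleton_le_iff_mem]
    have : p ∈ D.comap (toLaurent (R := F)) := hp ▸ Ideal.mem_span_singleton_self p
    exact this

instance laurentPID : IsPrincipalIdealRing F[T;T⁻¹] where
  principal D := by
    obtain ⟨p, hp⟩ := (IsPrincipalIdealRing.principal (D.comap (toLaurent (R := F)))).principal
    exact ⟨⟨_, laurent_span D p hp⟩⟩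

instance laurentInf : Infinite F[T;T⁻¹] :=
  Infinite.of_injective _ (Polynomial.toLaurent_injective (R := F))

theorem coprime_X {p : F[X]} (h : p.coeff 0 ≠ 0) (n : ℕ) : IsCoprime (X ^ n) p := by
  apply IsCoprime.pow_left
  rw [Polynomial.irreducible_X.coprime_iff_not_dvd, X_dvd_iff]
  exact h

theorem comap_span {p : F[X]} (h : p.coeff 0 ≠ 0) :
    (Ideal.span {toLaurent p}).comap (toLaurent (R := F)) = Ideal.span {p} := by
  apply le_antisymm
  · intro f hf
    rw [Ideal.mem_comap, Ideal.mem_span_singleton] at hf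
    obtain ⟨c, hc⟩ := hf
    obtain ⟨n, c', hc'⟩ := c.exists_T_pow
    have : f * X ^ n = p * c' := by
      apply Polynomial.toLaurent_injective
      rw [map_mul, map_mul, hc, hc', toLaurent_X_pow, mul_assoc]
    rw [Ideal.mem_span_singleton]
    exact (coprime_X h n).symm.dvd_of_dvd_mul_right ⟨c', this⟩
  · rw [Ideal.span_singleton_le_iff_mem]
    exact Ideal.mem_span_singleton_self _

theorem idx_span [Finite F] {p : F[X]} (hp : p.Monic) (h : p.coeff 0 ≠ 0) :
    idx (Ideal.span {toLaurent p}) = Nat.card F ^ p.natDegree := by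
  set D := Ideal.span {toLaurent p} with hD
  have hsurj : Function.Surjective (Ideal.quotientMap D (toLaurent (R := F)) le_rfl) := by
    intro y
    obtain ⟨f, rfl⟩ := Ideal.Quotient.mk_surjective y
    obtain ⟨n, f', hf'⟩ := f.exists_T_pow
    obtain ⟨u, v, huv⟩ := coprime_X h n
    refine ⟨Ideal.Quotient.mk _ (f' * u), ?_⟩
    rw [Ideal.quotientMap_mk, Ideal.Quotient.eq, hD, Ideal.mem_span_singleton]
    have h1 : toLaurent u * T n + toLaurent v * toLaurent p = 1 := by
      rw [← toLaurent_X_pow, ← map_mul, ← map_mul, ← map_add, huv, map_one]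
    refine ⟨-f * toLaurent v, ?_⟩
    rw [map_mul, hf']
    linear_combination f * h1
  have e := Equiv.ofBijective _ ⟨Ideal.quotientMap_injective (I := D) (f := toLaurent (R := F)), hsurj⟩
  rw [idx_eq_card, ← Nat.card_congr e, hD, comap_span h]
  have : Module.Finite F (F[X] ⧸ Ideal.span {p}) := hp.finite_quotient
  rw [Module.natCard_eq_pow_finrank (K := F), finrank_quotient_span_eq_natDegree]

theorem card_laurent [Finite F] (m : ℕ) :
    Finite {D : Ideal F[T;T⁻¹] // idx D = Nat.card F ^ m} ∧
    Nat.card {D : Ideal F[T;T⁻¹] // idx D = Nat.card F ^ m} =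
      if m = 0 then 1 else (Nat.card F - 1) * Nat.card F ^ (m - 1) := by
  have hq : 1 < Nat.card F := Finite.one_lt_card
  obtain ⟨h1, h2⟩ := card_mon_ne (F := F) m
  let θ : {p : F[X] // p.Monic ∧ p.natDegree = m ∧ p.coeff 0 ≠ 0} →
    {D : Ideal F[T;T⁻¹] // idx D = Nat.card F ^ m} := fun p =>
      ⟨Ideal.span {toLaurent p.1}, by rw [idx_span p.2.1 p.2.2.2, p.2.2.1]⟩
  have hθ : Function.Bijective θ := by
    constructor
    · intro p p' h
      have h3 : Ideal.span {toLaurent p.1} = Ideal.span {toLaurent p'.1} := congrArg Subtype.val h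
      have h4 := comap_span p.2.2.2
      rw [h3, comap_span p'.2.2.2, Ideal.span_singleton_eq_span_singleton] at h4
      exact Subtype.ext (eq_of_monic_of_associated p.2.1 p'.2.1 h4.symm)
    · rintro ⟨D, hD⟩
      obtain ⟨p, hp⟩ := (IsPrincipalIdealRing.principal (D.comap (toLaurent (R := F)))).principal
      change _ = Ideal.span {p} at hp
      have hp0 : p ≠ 0 := by
        rintro rfl
        have := laurent_span D 0 hp
        rw [map_zero, Ideal.span_singleton_eq_bot.2 rfl] at this
        rw [this, idx_bot] at hD
        exact absurd hD.symm (by positivity)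
      set r := p * Polynomial.C p.leadingCoeff⁻¹ with hr
      have hrp : D.comap (toLaurent (R := F)) = Ideal.span {r} := by
        rw [hp, Ideal.span_singleton_eq_span_singleton]
        exact associated_mul_unit_right _ _ (isUnit_C.2 (IsUnit.mk0 _
          (inv_ne_zero (leadingCoeff_ne_zero.2 hp0))))
      have hrm : r.Monic := monic_mul_leadingCoeff_inv hp0
      have hr0 : r.coeff 0 ≠ 0 := by
        intro h
        obtain ⟨s, hs⟩ := X_dvd_iff.2 h
        have h5 : toLaurent s ∈ D := by
          rw [laurent_span D r hrp, Ideal.mem_span_singleton]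
          apply T_dvd_cancel _ _ 1
          rw [hs, map_mul, toLaurent_X, mul_comm]
        have h6 : s ∈ D.comap (toLaurent (R := F)) := h5
        rw [hrp, Ideal.mem_span_singleton] at h6
        have hs0 : s ≠ 0 := by rintro rfl; rw [mul_zero] at hs; exact hrm.ne_zero hs
        have h7 := natDegree_le_of_dvd h6 hs0
        rw [hs, natDegree_X_mul hs0] at h7
        omega
      have hDr := laurent_span D r hrp
      have h8 := idx_span hrm hr0
      rw [← hDr, hD] at h8
      exact ⟨⟨r, hrm, (Nat.pow_right_injective hq h8).symm, hr0⟩, Subtype.ext hDr.symm⟩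
  exact ⟨Finite.of_equiv _ (Equiv.ofBijective θ hθ), by
    rw [← Nat.card_congr (Equiv.ofBijective θ hθ), h2]⟩

/-- The ring isomorphism between `F[x,y,y⁻¹]` and `F[y,y⁻¹][x]`. -/
noncomputable def bigEquiv (F : Type*) [Field F] : AddMonoidAlgebra F (ℕ × ℤ) ≃+* F[T;T⁻¹][X] :=
  (AddMonoidAlgebra.curryRingEquiv (R := F) (M := ℕ) (N := ℤ)).trans
    (Polynomial.toFinsuppIso F[T;T⁻¹]).symm

theorem idx_comap_equiv {A B : Type*} [CommRing A] [CommRing B] (e : A ≃+* B) (I : Ideal B) :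
    idx (I.comap e) = idx I := by
  exact Nat.card_congr (Ideal.quotientEquiv (I.comap e) I e
    (Ideal.map_comap_of_surjective _ e.surjective I).symm).toEquiv

theorem card_big (F : Type*) [Field F] [Finite F] (n : ℕ) (hn : 1 ≤ n) :
    Nat.card {I : Ideal (AddMonoidAlgebra F (ℕ × ℤ)) //
      Module.finrank F (AddMonoidAlgebra F (ℕ × ℤ) ⧸ I) = n} =
    Nat.card (Jt F[T;T⁻¹] (Nat.card F) n n) := by
  symm
  refine Nat.card_congr (Equiv.ofBijective (fun I => ⟨I.1.comap (bigEquiv F), ?_⟩) ⟨?_, ?_⟩)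
  · rw [idx_eq_pow_iff F hn, idx_comap_equiv, I.2.2]
  · intro I I' h
    have h1 : I.1.comap (bigEquiv F) = I'.1.comap (bigEquiv F) := congrArg Subtype.val h
    exact Subtype.ext (Ideal.comap_injective_of_surjective _ (bigEquiv F).surjective h1)
  · rintro ⟨I, hI⟩
    rw [idx_eq_pow_iff F hn] at hI
    have h1 : (I.comap (bigEquiv F).symm).comap (bigEquiv F) = I := by
      ext x; simp [Ideal.mem_comap]
    have h2 : idx (I.comap (bigEquiv F).symm) = Nat.card F ^ n := by
      rw [idx_comap_equiv, hI]
    exact ⟨⟨I.comap (bigEquiv F).symm, hasMonic_of_idx F h2, h2⟩, Subtype.ext h1⟩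

theorem finite_Jt (F : Type*) [Field F] [Finite F] (k : ℕ) :
    ∀ n, Finite (Jt F[T;T⁻¹] (Nat.card F) k n) := by
  have hq : 1 < Nat.card F := Finite.one_lt_card
  induction k with
  | zero => exact fun n => (Jt_zero _ hq n).1
  | succ k ih =>
    exact fun n => (card_Jt_succ F k n (fun a => (card_Dt F _ (fun m => (card_laurent m).2)
      (fun m => (card_laurent m).1) (k + 1) a (by omega)).1) ih).1

theorem card_final (F : Type*) [Field F] [Finite F] (k n : ℕ) :
    (Nat.card (Jt F[T;T⁻¹] (Nat.card F) k n) : ℤ) = (Nat.card F : ℤ) ^ n *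
      (PowerSeries.coeff n (1 + PowerSeries.C (X - 1) * serW k)).eval (Nat.card F : ℤ) := by
  have hq : 1 < Nat.card F := Finite.one_lt_card
  refine series_count (Nat.card F : ℤ)
    (fun k n => (Nat.card (Jt F[T;T⁻¹] (Nat.card F) k n) : ℤ)) ?_ ?_ k n
  · intro n
    rw [(Jt_zero _ hq n).2]
    split_ifs <;> simp
  · intro k n
    have hD := fun a => card_Dt (R := F[T;T⁻¹]) F _ (fun m => (card_laurent m).2)
      (fun m => (card_laurent m).1) (k + 1) a (by omega)
    rw [(card_Jt_succ F k n (fun a => (hD a).1) (finite_Jt F k)).2]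
    push_cast
    refine Finset.sum_congr rfl fun p _ => ?_
    rw [(hD p.1).2]
    congr 1
    simp only [numP]
    split_ifs <;> simp [Nat.cast_sub hq.le]

end Laurent

end BcircProof

/-- There is a polynomial `B°_n ∈ ℤ[X]` such that for every finite field `F` with `q` elements
the number of codimension-`n` ideals of `F[x,y,y⁻¹]` equals `(q-1) q^n B°_n(q)`; moreover
`B°_n(1) = σ₀(n)` and `B°_n(-1)` is `(-1)^{k-1}` if `n = k²` and `0` if `n` is not a square. -/
theorem exists_Bcirc_polynomial (n : ℕ) (hn : 1 ≤ n) :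
    ∃ B : Polynomial ℤ,
      (∀ (F : Type) [Field F] [Fintype F],
        (Nat.card {I : Ideal (AddMonoidAlgebra F (ℕ × ℤ)) //
            Module.finrank F (AddMonoidAlgebra F (ℕ × ℤ) ⧸ I) = n} : ℤ) =
          ((Fintype.card F : ℤ) - 1) * (Fintype.card F : ℤ) ^ n *
            B.eval (Fintype.card F : ℤ)) ∧
      B.eval 1 = (n.divisors.card : ℤ) ∧
      (∀ k : ℕ, 1 ≤ k → n = k ^ 2 → B.eval (-1) = (-1 : ℤ) ^ (k - 1)) ∧
      ((¬ ∃ k : ℕ, n = k ^ 2) → B.eval (-1) = 0) := by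
  refine ⟨PowerSeries.coeff n (BcircProof.serW n), ?_, BcircProof.serW_one n hn, ?_,
    BcircProof.serW_neg_nonsq n hn⟩
  · intro F _ _
    rw [BcircProof.card_big F n hn, BcircProof.card_final F n n, ← Nat.card_eq_fintype_card]
    simp only [map_add, PowerSeries.coeff_one, PowerSeries.coeff_C_mul, show n ≠ 0 by omega,
      if_false, zero_add, Polynomial.eval_mul, Polynomial.eval_sub, Polynomial.eval_X,
      Polynomial.eval_one]
    ring
  · rintro k hk rfl
    exact BcircProof.serW_neg_sq k hk
end

section
/- For every integer n ≥ 1 and every finite field F with q elements, the number of ideals I of A = F[x,y,y⁻¹] (the monoid algebra AddMonoidAlgebra F (ℕ × ℤ)) with dim_F(A/I) = n equals Σ_{λ ⊢ n} (q−1)^{v(λ)} · q^{n + ℓ(λ) − v(λ)}, where the sum is over all partitions λ of n. -/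
namespace PL
open Polynomial

set_option linter.unusedSectionVars false

section core
variable {R : Type*} [CommRing R]

/-- `I` contains a monic polynomial of degree `k`. -/
def HasMonic (k : ℕ) (I : Ideal R[X]) : Prop := ∃ g ∈ I, g.Monic ∧ g.natDegree = k

/-- In degrees `≤ k`, `I` agrees with `c * J`. -/
def Rel (k : ℕ) (I J : Ideal R[X]) (c : Ideal R) : Prop :=
  ∀ h : R[X], h.natDegree ≤ k → (h ∈ I ↔ h ∈ c.map C * J)

lemma exists_ideal {g : R[X]} (hg : g.Monic) (V : Ideal R[X])
    (hV : ∀ v ∈ V, v.degree < g.degree → (X * v) %ₘ g ∈ V) :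
    ∃ I : Ideal R[X], ∀ h, h ∈ I ↔ h %ₘ g ∈ V := by
  nontriviality R
  have hmod : ∀ p h : R[X], (p * h) %ₘ g = (p * (h %ₘ g)) %ₘ g := by
    intro p h
    rw [← sub_eq_zero, ← Polynomial.sub_modByMonic, ← mul_sub,
      Polynomial.modByMonic_eq_zero_iff_dvd hg]
    exact Dvd.dvd.mul_left (by
      rw [Polynomial.modByMonic_eq_sub_mul_div h g]
      simp) p
  have hX : ∀ h : R[X], h %ₘ g ∈ V → (X * h) %ₘ g ∈ V := by
    intro h hh
    rw [hmod]
    exact hV _ hh (Polynomial.degree_modByMonic_lt h hg)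
  have hC : ∀ (a : R) (h : R[X]), h %ₘ g ∈ V → (C a * h) %ₘ g ∈ V := by
    intro a h hh
    rw [← Polynomial.smul_eq_C_mul, Polynomial.smul_modByMonic, Polynomial.smul_eq_C_mul]
    exact V.mul_mem_left _ hh
  have hXn : ∀ (n : ℕ) (h : R[X]), h %ₘ g ∈ V → (X ^ n * h) %ₘ g ∈ V := by
    intro n
    induction n with
    | zero => intro h hh; simpa using hh
    | succ n ih =>
      intro h hh
      rw [pow_succ, mul_assoc]
      exact ih _ (hX _ hh)
  refine ⟨{ carrier := {h | h %ₘ g ∈ V}, add_mem' := ?_, zero_mem' := ?_, smul_mem' := ?_ }, ?_⟩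
  · intro a b ha hb
    simp only [Set.mem_ofPred_eq] at *
    rw [Polynomial.add_modByMonic]
    exact V.add_mem ha hb
  · simp
  · intro p h hh
    simp only [Set.mem_ofPred_eq, smul_eq_mul] at *
    induction p using Polynomial.induction_on' with
    | add p q hp hq =>
      rw [add_mul, Polynomial.add_modByMonic]
      exact V.add_mem hp hq
    | monomial n a =>
      rw [← Polynomial.C_mul_X_pow_eq_monomial, mul_assoc]
      exact hC _ _ (hXn _ _ hh)
  · intro h; rfl

/-- An ideal containing the monic `g` is determined by remainders. -/
lemma mem_iff_mod {I : Ideal R[X]} {g : R[X]} (hgI : g ∈ I) (h : R[X]) :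
    h ∈ I ↔ h %ₘ g ∈ I := by
  conv_lhs => rw [← Polynomial.modByMonic_add_div h g]
  exact I.add_mem_iff_left (I.mul_mem_right _ hgI)

lemma natDegree_mod_le {g : R[X]} (hg : g.Monic) {k : ℕ} (hk : g.natDegree ≤ k + 1) (h : R[X]) :
    (h %ₘ g).natDegree ≤ k := by
  nontriviality R
  by_cases h1 : g = 1
  · simp [h1]
  · have := Polynomial.natDegree_modByMonic_lt h hg h1
    omega

/-- Two ideals sharing low-degree elements and a monic coincide. -/
lemma eq_of_agree {I I' : Ideal R[X]} {g : R[X]} (hg : g.Monic) {k : ℕ}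
    (hk : g.natDegree ≤ k + 1) (h1 : g ∈ I) (h2 : g ∈ I')
    (h : ∀ p : R[X], p.natDegree ≤ k → (p ∈ I ↔ p ∈ I')) : I = I' := by
  ext p
  rw [mem_iff_mod h1, mem_iff_mod h2]
  exact h _ (natDegree_mod_le hg hk p)

lemma natDegree_le_of_coeff {p : R[X]} {k : ℕ} (h : p.natDegree ≤ k + 1) (h0 : p.coeff (k+1) = 0) :
    p.natDegree ≤ k := by
  rw [Polynomial.natDegree_le_iff_coeff_eq_zero] at h ⊢
  intro N hN
  rcases Nat.lt_or_ge (k+1) N with h' | h'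
  · exact h N h'
  · rwa [show N = k + 1 by omega]

variable [IsDomain R] [IsPrincipalIdealRing R]

lemma lazard (I : Ideal R[X]) (hI : ∃ r : R, r ≠ 0 ∧ C r ∈ I) (m : ℕ) :
    ∃ d : R, d ≠ 0 ∧ ∃ f ∈ I, f.natDegree ≤ m ∧ f.coeff m = d ∧
      ∀ p ∈ I, p.natDegree ≤ m → d ∣ p.coeff m ∧ C d ∣ p := by
  have key : ∀ m : ℕ, ∃ D : Ideal R, ∀ x, x ∈ D ↔ ∃ p ∈ I, p.natDegree ≤ m ∧ p.coeff m = x := by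
    intro m
    refine ⟨Submodule.map (lcoeff R m) (degreeLE R m ⊓ I.restrictScalars R), fun x => ?_⟩
    simp only [Submodule.mem_map, Submodule.mem_inf, Polynomial.mem_degreeLE,
      Submodule.restrictScalars_mem, lcoeff_apply, ← Polynomial.natDegree_le_iff_degree_le]
    exact ⟨fun ⟨p, h⟩ => ⟨p, h.1.2, h.1.1, h.2⟩, fun ⟨p, h⟩ => ⟨p, ⟨h.2.1, h.1⟩, h.2.2⟩⟩
  induction m with
  | zero =>
    obtain ⟨D, hD⟩ := key 0
    obtain ⟨d, rfl⟩ := (IsPrincipalIdealRing.principal D).principal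
    obtain ⟨f, hf, hf1, hf2⟩ := (hD d).1 (Ideal.mem_span_singleton_self d)
    refine ⟨d, ?_, f, hf, hf1, hf2, ?_⟩
    · rintro rfl
      obtain ⟨r, hr, hrI⟩ := hI
      have := (hD r).2 ⟨C r, hrI, by simp, by simp⟩
      simp at this
      exact hr this
    · intro p hp hp0
      have := (hD _).2 ⟨p, hp, hp0, rfl⟩
      have h1 := Ideal.mem_span_singleton.1 this
      refine ⟨h1, ?_⟩
      rw [Polynomial.eq_C_of_natDegree_le_zero hp0]
      exact map_dvd C h1
  | succ m ih =>
    obtain ⟨d, hd0, f, hf, hfm, hfd, hall⟩ := ih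
    obtain ⟨D, hD⟩ := key (m+1)
    obtain ⟨d', rfl⟩ := (IsPrincipalIdealRing.principal D).principal
    obtain ⟨f', hf', hf1, hf2⟩ := (hD d').1 (Ideal.mem_span_singleton_self d')
    have hXf : (X * f).natDegree ≤ m + 1 :=
      (Polynomial.natDegree_mul_le).trans (by have := Polynomial.natDegree_X_le (R := R); omega)
    have hdd : d' ∣ d := Ideal.mem_span_singleton.1 ((hD d).2 ⟨X * f, I.mul_mem_left _ hf, hXf, by
      rw [Polynomial.coeff_X_mul, hfd]⟩)
    obtain ⟨c, rfl⟩ := hdd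
    have hd'0 : d' ≠ 0 := left_ne_zero_of_mul hd0
    have hc0 : c ≠ 0 := right_ne_zero_of_mul hd0
    have hsub : C d' ∣ f' := by
      have h1 := (hall (C c * f' - X * f)
        (I.sub_mem (I.mul_mem_left _ hf') (I.mul_mem_left _ hf))
        (natDegree_le_of_coeff ((Polynomial.natDegree_sub_le _ _).trans
          (max_le ((Polynomial.natDegree_C_mul_le _ _).trans hf1) hXf)) (by
            rw [Polynomial.coeff_sub, Polynomial.coeff_C_mul, Polynomial.coeff_X_mul, hfd, hf2]
            ring))).2
      have h2 := (dvd_sub_left ((hall f hf hfm).2.mul_left X)).1 h1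
      rw [mul_comm d' c, C_mul] at h2
      exact (mul_dvd_mul_iff_left (C_ne_zero.2 hc0)).1 h2
    refine ⟨d', hd'0, f', hf', hf1, hf2, ?_⟩
    intro p hp hpm
    have h1 : d' ∣ p.coeff (m+1) := Ideal.mem_span_singleton.1 ((hD _).2 ⟨p, hp, hpm, rfl⟩)
    refine ⟨h1, ?_⟩
    obtain ⟨b, hb⟩ := h1
    have h2 := (hall (p - C b * f') (I.sub_mem hp (I.mul_mem_left _ hf'))
        (natDegree_le_of_coeff ((Polynomial.natDegree_sub_le _ _).trans
          (max_le hpm ((Polynomial.natDegree_C_mul_le _ _).trans hf1))) (by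
            rw [Polynomial.coeff_sub, Polynomial.coeff_C_mul, hf2, hb]
            ring))).2
    have h3 : C d' ∣ p - C b * f' := (map_dvd C (Dvd.intro c rfl)).trans h2
    exact (dvd_sub_left (hsub.mul_left _)).1 h3

lemma mem_map_mul {c : R} {J : Ideal R[X]} {h : R[X]} :
    h ∈ (Ideal.span {c}).map C * J ↔ ∃ z ∈ J, C c * z = h := by
  rw [Ideal.map_span, Set.image_singleton, Ideal.mem_span_singleton_mul]

lemma exists_rel {k : ℕ} {I : Ideal R[X]} (hI : ∃ r : R, r ≠ 0 ∧ C r ∈ I) :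
    ∃ (J : Ideal R[X]) (c : Ideal R), HasMonic k J ∧ c ≠ ⊥ ∧ Rel k I J c := by
  obtain ⟨d, hd0, f, hf, hfk, hfd, hall⟩ := lazard I hI k
  have hCd : C d ≠ 0 := C_ne_zero.2 hd0
  obtain ⟨g, hfg⟩ := (hall f hf hfk).2
  have hdeg : ∀ z : R[X], (C d * z).natDegree = z.natDegree := fun z =>
    Polynomial.natDegree_C_mul hd0
  have hgk : g.natDegree ≤ k := by rw [← hdeg g, ← hfg]; exact hfk
  have hg1 : g.coeff k = 1 := by
    have := hfd
    rw [hfg, Polynomial.coeff_C_mul] at this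
    exact mul_left_cancel₀ hd0 (by rw [this, mul_one])
  have hgm : g.Monic := Polynomial.monic_of_natDegree_le_of_coeff_eq_one k hgk hg1
  have hgn : g.natDegree = k := le_antisymm hgk (Polynomial.le_natDegree_of_ne_zero (by simp [hg1]))
  -- the colon ideal
  let K : Ideal R[X] := Submodule.comap (LinearMap.mulLeft R[X] (C d)) I
  have hK : ∀ z, z ∈ K ↔ C d * z ∈ I := fun z => Iff.rfl
  have hgK : g ∈ K := by rw [hK, ← hfg]; exact hf
  obtain ⟨J, hJ⟩ := exists_ideal hgm K (fun v hv _ => (mem_iff_mod hgK _).1 (K.mul_mem_left _ hv))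
  have hJK : ∀ z, z ∈ J ↔ z ∈ K := fun z => by rw [hJ, ← mem_iff_mod hgK]
  refine ⟨J, Ideal.span {d}, ⟨g, (hJK g).2 hgK, hgm, hgn⟩, by simpa using hd0, ?_⟩
  intro h hh
  rw [mem_map_mul]
  constructor
  · intro hhI
    obtain ⟨z, rfl⟩ := (hall h hhI hh).2
    exact ⟨z, (hJK z).2 hhI, rfl⟩
  · rintro ⟨z, hz, rfl⟩
    exact (hJK z).1 hz

lemma rel_lead {k : ℕ} {I J : Ideal R[X]} {c : Ideal R} (hJ : HasMonic k J) 
    (h : Rel k I J c) (x : R) : x ∈ c ↔ ∃ p ∈ I, p.natDegree ≤ k ∧ p.coeff k = x := by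
  obtain ⟨d, rfl⟩ := (IsPrincipalIdealRing.principal c).principal
  obtain ⟨g, hgJ, hg, rfl⟩ := hJ
  change x ∈ Ideal.span {d} ↔ _
  constructor
  · intro hx
    obtain ⟨b, rfl⟩ := Ideal.mem_span_singleton.1 hx
    have hdeg : (C d * (C b * g)).natDegree ≤ g.natDegree :=
      (Polynomial.natDegree_C_mul_le _ _).trans (Polynomial.natDegree_C_mul_le _ _)
    refine ⟨C d * (C b * g), (h _ hdeg).2 (mem_map_mul.2 ⟨_, J.mul_mem_left _ hgJ, rfl⟩), hdeg, ?_⟩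
    simp [hg.coeff_natDegree]
  · rintro ⟨p, hp, hpk, rfl⟩
    obtain ⟨z, hz, rfl⟩ := mem_map_mul.1 ((h p hpk).1 hp)
    rw [Polynomial.coeff_C_mul]
    exact Ideal.mul_mem_right _ _ (Ideal.mem_span_singleton_self d)

lemma rel_unique {k : ℕ} {I J J' : Ideal R[X]} {c c' : Ideal R} (hc : c ≠ ⊥)
    (hJ : HasMonic k J) (hJ' : HasMonic k J') (h : Rel k I J c) (h' : Rel k I J' c') :
    J = J' ∧ c = c' := by
  have hcc : c = c' := by
    ext x
    rw [rel_lead hJ h, rel_lead hJ' h']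
  subst hcc
  refine ⟨?_, rfl⟩
  obtain ⟨d, rfl⟩ := (IsPrincipalIdealRing.principal c).principal
  have hd : d ≠ 0 := by rintro rfl; simp at hc
  have hag : ∀ p : R[X], p.natDegree ≤ k → (p ∈ J ↔ p ∈ J') := by
    intro p hp
    have hdeg : (C d * p).natDegree ≤ k := (Polynomial.natDegree_C_mul_le _ _).trans hp
    have e : ∀ K : Ideal R[X], C d * p ∈ (Ideal.span {d}).map C * K ↔ p ∈ K := by
      intro K
      rw [mem_map_mul]
      constructor
      · rintro ⟨z, hz, he⟩
        rwa [← mul_left_cancel₀ (C_ne_zero.2 hd) he]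
      · intro hp; exact ⟨p, hp, rfl⟩
    rw [← e J, ← e J']
    exact (h _ hdeg).symm.trans (h' _ hdeg)
  obtain ⟨g, hgJ, hg, hgk⟩ := hJ
  exact eq_of_agree hg (by omega) hgJ ((hag g hgk.le).1 hgJ) hag


/-- Polynomials of degree at most `k`. -/
noncomputable def Pk (R : Type*) [CommRing R] (k : ℕ) : AddSubgroup R[X] := (degreeLT R (k+1)).toAddSubgroup

lemma mem_Pk {k : ℕ} {p : R[X]} : p ∈ Pk R k ↔ p.natDegree ≤ k := by
  change p ∈ degreeLT R (k+1) ↔ _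
  rw [Polynomial.mem_degreeLT, Polynomial.degree_lt_iff_coeff_zero,
    Polynomial.natDegree_le_iff_coeff_eq_zero]
  exact Iff.rfl

lemma index_P {k : ℕ} {d : R} :
    ((Pk R k).map (AddMonoidHom.mulLeft (C d))).relIndex (Pk R k) =
      Nat.card (R ⧸ Ideal.span {d}) ^ (k+1) := by
  let f : R[X] →+ (Fin (k+1) → R ⧸ Ideal.span {d}) :=
    { toFun := fun p i => Ideal.Quotient.mk _ (p.coeff i)
      map_zero' := by ext; simp
      map_add' := fun p q => by ext; simp }
  have hf : ∀ p i, f p i = Ideal.Quotient.mk _ (p.coeff i) := fun p i => rfl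
  have h1 : f.ker ⊓ Pk R k = (Pk R k).map (AddMonoidHom.mulLeft (C d)) := by
    ext p
    rw [AddSubgroup.mem_inf, AddMonoidHom.mem_ker, AddSubgroup.mem_map, mem_Pk]
    constructor
    · rintro ⟨h0, hp⟩
      have : C d ∣ p := by
        rw [Polynomial.C_dvd_iff_dvd_coeff]
        intro i
        rcases Nat.lt_or_ge k i with hi | hi
        · rw [Polynomial.coeff_eq_zero_of_natDegree_lt (by omega)]; exact dvd_zero _
        · have := congrFun h0 ⟨i, by omega⟩
          rw [hf, Pi.zero_apply, Ideal.Quotient.eq_zero_iff_mem] at this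
          exact Ideal.mem_span_singleton.1 this
      by_cases hd : d = 0
      · subst hd
        simp at this
        exact ⟨0, AddSubgroup.zero_mem _, by simp [this]⟩
      · obtain ⟨z, rfl⟩ := this
        rw [Polynomial.natDegree_C_mul hd] at hp
        exact ⟨z, mem_Pk.2 hp, rfl⟩
    · rintro ⟨z, hz, rfl⟩
      rw [mem_Pk] at hz
      refine ⟨?_, (Polynomial.natDegree_C_mul_le _ _).trans hz⟩
      ext i
      rw [hf, AddMonoidHom.coe_mulLeft, Polynomial.coeff_C_mul, Pi.zero_apply,
        Ideal.Quotient.eq_zero_iff_mem]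
      exact Ideal.mul_mem_right _ _ (Ideal.mem_span_singleton_self d)
  rw [← h1, AddSubgroup.inf_relIndex_right, AddSubgroup.relIndex_ker]
  have h2 : (Pk R k).map f = ⊤ := by
    rw [eq_top_iff]
    intro y _
    choose r hr using fun i => Ideal.Quotient.mk_surjective (y i)
    refine ⟨((degreeLTEquiv R (k+1)).symm r).1, ((degreeLTEquiv R (k+1)).symm r).2, ?_⟩
    ext i
    rw [hf, ← hr i]
    congr 1
    exact congrFun ((degreeLTEquiv R (k+1)).apply_symm_apply r) i
  rw [h2, AddSubgroup.card_top, Nat.card_fun]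
  simp

lemma index_J {k : ℕ} {J : Ideal R[X]} {g : R[X]} (hgJ : g ∈ J) (hg : g.Monic)
    (hk : g.natDegree ≤ k + 1) :
    J.toAddSubgroup.relIndex (Pk R k) = Nat.card (R[X] ⧸ J) := by
  have h : Pk R k ⊔ J.toAddSubgroup = ⊤ := by
    rw [eq_top_iff]
    intro p _
    rw [← Polynomial.modByMonic_add_div p g]
    exact AddSubgroup.add_mem_sup (mem_Pk.2 (natDegree_mod_le hg hk p)) (J.mul_mem_right _ hgJ)
  rw [← AddSubgroup.relIndex_sup_right, h, AddSubgroup.relIndex_top_right]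
  rfl

/-- Low degree part of `J`. -/
noncomputable def Lo (k : ℕ) (J : Ideal R[X]) : AddSubgroup R[X] := J.toAddSubgroup ⊓ Pk R k

lemma mem_Lo {k : ℕ} {J : Ideal R[X]} {p : R[X]} : p ∈ Lo k J ↔ p ∈ J ∧ p.natDegree ≤ k := by
  rw [Lo, AddSubgroup.mem_inf, mem_Pk]; rfl

lemma index_cL_P {k : ℕ} {J : Ideal R[X]} {d : R} (hd : d ≠ 0) :
    ((Lo k J).map (AddMonoidHom.mulLeft (C d))).relIndex (Pk R k) =
      J.toAddSubgroup.relIndex (Pk R k) * Nat.card (R ⧸ Ideal.span {d}) ^ (k+1) := by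
  have h1 : (Lo k J).map (AddMonoidHom.mulLeft (C d)) ≤ (Pk R k).map (AddMonoidHom.mulLeft (C d)) :=
    AddSubgroup.map_mono inf_le_right
  have h2 : (Pk R k).map (AddMonoidHom.mulLeft (C d)) ≤ Pk R k := by
    rintro _ ⟨z, hz, rfl⟩
    exact mem_Pk.2 ((Polynomial.natDegree_C_mul_le _ _).trans (mem_Pk.1 hz))
  rw [← AddSubgroup.relIndex_mul_relIndex _ _ _ h1 h2, index_P,
    AddSubgroup.relIndex_map_map_of_injective, Lo, AddSubgroup.inf_relIndex_right]
  exact fun a b h => mul_left_cancel₀ (C_ne_zero.2 hd) h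

lemma index_cL_L {k : ℕ} {J : Ideal R[X]} {d : R} (hd : d ≠ 0) 
    (hJ : J.toAddSubgroup.relIndex (Pk R k) ≠ 0) :
    ((Lo k J).map (AddMonoidHom.mulLeft (C d))).relIndex (Lo k J) =
      Nat.card (R ⧸ Ideal.span {d}) ^ (k+1) := by
  have h1 : (Lo k J).map (AddMonoidHom.mulLeft (C d)) ≤ Lo k J := by
    rintro _ ⟨z, hz, rfl⟩
    have hz := mem_Lo.1 hz
    exact mem_Lo.2 ⟨J.mul_mem_left _ hz.1, (Polynomial.natDegree_C_mul_le _ _).trans hz.2⟩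
  have h2 := AddSubgroup.relIndex_mul_relIndex _ _ (Pk R k) h1 inf_le_right
  rw [index_cL_P hd, mul_comm] at h2
  nth_rewrite 1 [Lo] at h2
  rw [AddSubgroup.inf_relIndex_right] at h2
  exact mul_left_cancel₀ hJ h2

lemma rel_iff_Lo {k : ℕ} {I J : Ideal R[X]} {d : R} (hd : d ≠ 0) :
    Rel k I J (Ideal.span {d}) ↔ Lo k I = (Lo k J).map (AddMonoidHom.mulLeft (C d)) := by
  have e : ∀ h : R[X], h.natDegree ≤ k → (h ∈ (Ideal.span {d}).map C * J ↔ 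
      h ∈ (Lo k J).map (AddMonoidHom.mulLeft (C d))) := by
    intro h hh
    rw [mem_map_mul, AddSubgroup.mem_map]
    constructor
    · rintro ⟨z, hz, rfl⟩
      rw [Polynomial.natDegree_C_mul hd] at hh
      exact ⟨z, mem_Lo.2 ⟨hz, hh⟩, rfl⟩
    · rintro ⟨z, hz, rfl⟩
      exact ⟨z, (mem_Lo.1 hz).1, rfl⟩
  constructor
  · intro H
    ext p
    rw [mem_Lo]
    constructor
    · rintro ⟨h1, h2⟩
      exact (e p h2).1 ((H p h2).1 h1)
    · intro h
      have hp : p.natDegree ≤ k := by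
        obtain ⟨z, hz, rfl⟩ := h
        exact (Polynomial.natDegree_C_mul_le _ _).trans (mem_Lo.1 hz).2
      exact ⟨(H p hp).2 ((e p hp).2 h), hp⟩
  · intro H p hp
    rw [e p hp, ← H, mem_Lo]
    simp [hp]

lemma index_rel {k : ℕ} {I J : Ideal R[X]} {c : Ideal R} (hc : c ≠ ⊥) (hI : HasMonic (k+1) I)
    (hJ : HasMonic k J) (h : Rel k I J c) :
    Nat.card (R[X] ⧸ I) = Nat.card (R[X] ⧸ J) * Nat.card (R ⧸ c) ^ (k+1) := by
  obtain ⟨d, rfl⟩ := (IsPrincipalIdealRing.principal c).principal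
  have hd : d ≠ 0 := by rintro rfl; simp at hc
  obtain ⟨g, hgI, hg, hgk⟩ := hI
  obtain ⟨g', hgJ, hg', hgk'⟩ := hJ
  rw [← index_J hgI hg hgk.le, ← index_J hgJ hg' (k := k) (by omega)]
  have h := (rel_iff_Lo hd).1 h
  have h2 := index_cL_P (k := k) (J := J) hd
  rw [← h, Lo, AddSubgroup.inf_relIndex_right] at h2
  exact h2

lemma card_of_surj {G Y : Type*} [AddGroup G] (H : AddSubgroup G) (F : G → Y)
    (hs : Function.Surjective F) (hF : ∀ a b, F a = F b ↔ -a + b ∈ H) : Nat.card Y = H.index := by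
  symm
  refine Nat.card_congr (Equiv.ofBijective (Quotient.lift F ?_) ⟨?_, ?_⟩)
  · intro a b h
    exact (hF a b).2 (QuotientAddGroup.leftRel_apply.1 h)
  · intro a b
    induction a using Quotient.inductionOn
    induction b using Quotient.inductionOn
    intro h
    exact Quotient.sound (QuotientAddGroup.leftRel_apply.2 ((hF _ _).1 h))
  · intro y
    obtain ⟨a, rfl⟩ := hs y
    exact ⟨Quotient.mk _ a, rfl⟩

lemma fiber_card {k : ℕ} {J : Ideal R[X]} {c : Ideal R} (hc : c ≠ ⊥)
    (hJ : HasMonic k J) (h0 : Nat.card (R[X] ⧸ J) ≠ 0) :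
    Nat.card {I : Ideal R[X] // HasMonic (k+1) I ∧ Rel k I J c} = Nat.card (R ⧸ c) ^ (k+1) := by
  obtain ⟨d, rfl⟩ := (IsPrincipalIdealRing.principal c).principal
  change Nat.card {I : Ideal R[X] // HasMonic (k+1) I ∧ Rel k I J (Ideal.span {d})} =
    Nat.card (R ⧸ Ideal.span {d}) ^ (k+1)
  have hd : d ≠ 0 := by rintro rfl; simp at hc
  have hCd : C d ≠ 0 := C_ne_zero.2 hd
  obtain ⟨g, hgJ, hg, hgk⟩ := hJ
  rw [← index_J hgJ hg (k := k) (by omega)] at h0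
  rw [← index_cL_L hd h0]
  -- monic elements of degree `k+1`
  have hdeg : ∀ l ∈ Lo k J, (X * g + l).Monic ∧ (X * g + l).natDegree = k + 1 ∧
      X * g + l ∈ J := by
    intro l hl
    rw [mem_Lo] at hl
    have h1 : (X * g).Monic := Polynomial.monic_X.mul hg
    have h2 : (X * g).natDegree = k + 1 := by
      rw [Polynomial.natDegree_X_mul hg.ne_zero, hgk]
    have h3 : l.degree < (X * g).degree := by
      apply Polynomial.degree_lt_degree; omega
    refine ⟨h1.add_of_left h3, ?_, J.add_mem (J.mul_mem_left _ hgJ) hl.1⟩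
    rw [Polynomial.natDegree_add_eq_left_of_degree_lt h3, h2]
  have hex : ∀ l : Lo k J, ∃ I : {I : Ideal R[X] // HasMonic (k+1) I ∧ Rel k I J (Ideal.span {d})},
      X * g + l.1 ∈ I.1 := by
    intro l
    obtain ⟨hm, hn, hmem⟩ := hdeg l.1 l.2
    obtain ⟨I, hI⟩ := exists_ideal hm ((Ideal.span {d}).map C * J) (by
      intro v hv _
      obtain ⟨z, hz, rfl⟩ := mem_map_mul.1 hv
      rw [mul_left_comm, ← Polynomial.smul_eq_C_mul, Polynomial.smul_modByMonic,
        Polynomial.smul_eq_C_mul]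
      exact mem_map_mul.2 ⟨_, (mem_iff_mod hmem _).1 (J.mul_mem_left _ hz), rfl⟩)
    have hmI : X * g + l.1 ∈ I := by
      rw [hI, Polynomial.modByMonic_self hm]
      exact Ideal.zero_mem _
    refine ⟨⟨I, ⟨_, hmI, hm, hn⟩, ?_⟩, hmI⟩
    intro h hh
    rw [hI, (Polynomial.modByMonic_eq_self_iff hm).2]
    apply Polynomial.degree_lt_degree; omega
  choose F hF using hex
  refine card_of_surj _ F ?_ ?_
  · rintro ⟨I, ⟨p, hpI, hp, hpk⟩, hrel⟩
    have hlow : X * g - p ∈ Lo k J := by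
      have h1 : C d * (X * g - p) ∈ I := by
        have : C d * (X * g - p) = X * (C d * g) - C d * p := by ring
        rw [this]
        refine I.sub_mem (I.mul_mem_left _ ?_) (I.mul_mem_left _ hpI)
        exact (hrel _ ((Polynomial.natDegree_C_mul_le _ _).trans hgk.le)).2
          (mem_map_mul.2 ⟨g, hgJ, rfl⟩)
      have h2 : (X * g - p).natDegree ≤ k := by
        apply natDegree_le_of_coeff
        · refine (Polynomial.natDegree_sub_le _ _).trans (max_le ?_ hpk.le)
          rw [Polynomial.natDegree_X_mul hg.ne_zero, hgk]
        · rw [Polynomial.coeff_sub, Polynomial.coeff_X_mul, ← hpk, hp.coeff_natDegree, ← hgk,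
            hg.coeff_natDegree, sub_self]
      obtain ⟨z, hz, he⟩ := mem_map_mul.1
        ((hrel _ ((Polynomial.natDegree_C_mul_le _ _).trans h2)).1 h1)
      rw [mul_left_cancel₀ hCd he] at hz
      exact mem_Lo.2 ⟨hz, h2⟩
    refine ⟨-⟨_, hlow⟩, ?_⟩
    apply Subtype.ext
    have h3 := hF (-⟨_, hlow⟩)
    have h4 : X * g + (-(⟨_, hlow⟩ : Lo k J) : Lo k J).1 = p := by
      simp
    rw [h4] at h3
    refine eq_of_agree hp hpk.le h3 hpI fun q hq => ?_
    exact ((F _).2.2 q hq).trans (hrel q hq).symm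
  · intro a b
    rw [AddSubgroup.mem_addSubgroupOf, ← (rel_iff_Lo hd).1 (F a).2.2, mem_Lo]
    have hs : ((-a + b : Lo k J) : R[X]) = (X * g + b.1) - (X * g + a.1) := by
      push_cast; ring
    have hle : ((-a + b : Lo k J) : R[X]).natDegree ≤ k := (mem_Lo.1 (-a + b : Lo k J).2).2
    constructor
    · intro h
      refine ⟨?_, hle⟩
      rw [hs]
      exact Ideal.sub_mem _ (h ▸ hF b) (hF a)
    · rintro ⟨h, -⟩
      apply Subtype.ext
      obtain ⟨hm, hn, -⟩ := hdeg b.1 b.2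
      refine eq_of_agree hm hn.le ?_ (hF b) fun q hq => ?_
      · rw [hs] at h
        exact (Submodule.sub_mem_iff_left _ (hF a)).1 h
      · exact ((F a).2.2 q hq).trans ((F b).2.2 q hq).symm

/-- Ideals of `R[X]` with a monic of degree `k` and with quotient of size `q ^ n`. -/
abbrev Tk (R : Type*) [CommRing R] (q k n : ℕ) : Type _ :=
  {I : Ideal R[X] // HasMonic k I ∧ Nat.card (R[X] ⧸ I) = q ^ n}

/-- Ideals of `R` with quotient of size `q ^ e`. -/
abbrev Cq (R : Type*) [CommRing R] (q e : ℕ) : Type _ :=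
  {c : Ideal R // Nat.card (R ⧸ c) = q ^ e}

lemma exists_const [Infinite R] {I : Ideal R[X]} (h : Nat.card (R[X] ⧸ I) ≠ 0) :
    ∃ r : R, r ≠ 0 ∧ C r ∈ I := by
  have := Nat.finite_of_card_ne_zero h
  by_contra! hcon
  have hinj : Function.Injective ((Ideal.Quotient.mk I).comp C) := by
    rw [injective_iff_map_eq_zero]
    intro r hr
    by_contra h0
    exact hcon r h0 (Ideal.Quotient.eq_zero_iff_mem.1 hr)
  exact not_finite_iff_infinite.2 ‹Infinite R› (Finite.of_injective _ hinj)

lemma ne_bot_of_card [Infinite R] {c : Ideal R} (h : Nat.card (R ⧸ c) ≠ 0) : c ≠ ⊥ := by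
  rintro rfl
  have := Nat.finite_of_card_ne_zero h
  have hinj : Function.Injective (Ideal.Quotient.mk (⊥ : Ideal R)) := by
    rw [injective_iff_map_eq_zero]
    intro r hr
    simpa using Ideal.Quotient.eq_zero_iff_mem.1 hr
  exact not_finite_iff_infinite.2 ‹Infinite R› (Finite.of_injective _ hinj)

lemma card_pow (F : Type*) [Field F] [Fintype F] (M : Type*) [AddCommGroup M] [Module F M]
    (h : Nat.card M ≠ 0) : ∃ m, Nat.card M = Fintype.card F ^ m := by
  have := Nat.finite_of_card_ne_zero h
  have : Module.Finite F M := Module.Finite.of_finite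
  exact ⟨_, by rw [Module.natCard_eq_pow_finrank (K := F), Nat.card_eq_fintype_card]⟩

section recur
variable (F : Type*) [Field F] [Fintype F] [Algebra F R] [Infinite R]

/-- Index type of admissible multiplicities. -/
abbrev Ek (k n : ℕ) : Type := {e : ℕ // e ∈ (Finset.range (n+1)).filter (fun e => (k+1) * e ≤ n)}

/-- The base of the fibration. -/
abbrev Bk (R : Type*) [CommRing R] (q k n : ℕ) : Type _ :=
  Σ e : Ek k n, Tk R q k (n - (k+1) * e.1) × Cq R q e.1

lemma step_equiv (q : ℕ) (hq : Fintype.card F = q) (k n : ℕ) :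
    Nonempty (Tk R q (k+1) n ≃ Σ b : Bk R q k n,
      {I : Ideal R[X] // HasMonic (k+1) I ∧ Rel k I b.2.1.1 b.2.2.1}) := by
  have hq1 : 1 < q := hq ▸ Fintype.one_lt_card
  have hqn : ∀ m, q ^ m ≠ 0 := fun m => pow_ne_zero _ (by omega)
  have main : ∀ I : Tk R q (k+1) n, ∃ b : Bk R q k n, Rel k I.1 b.2.1.1 b.2.2.1 := by
    rintro ⟨I, hI, hcard⟩
    obtain ⟨J, c, hJ, hc, hrel⟩ := exists_rel (k := k)
      (exists_const (I := I) (by rw [hcard]; exact hqn n))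
    have hidx := index_rel hc hI hJ hrel
    rw [hcard] at hidx
    have hne := hqn n
    rw [hidx] at hne
    obtain ⟨a, ha⟩ := card_pow F (R[X] ⧸ J) (left_ne_zero_of_mul hne)
    obtain ⟨e, he⟩ := card_pow F (R ⧸ c)
      (fun h0 => (right_ne_zero_of_mul hne) (by rw [h0]; simp))
    rw [hq] at ha he
    rw [ha, he, ← pow_mul, ← pow_add] at hidx
    have hn := Nat.pow_right_injective hq1 hidx
    have hn' : n = a + (k+1) * e := by rw [hn]; ring
    have he' : e ≤ n := by nlinarith
    refine ⟨⟨⟨e, ?_⟩, ⟨J, hJ, ?_⟩, ⟨c, he⟩⟩, hrel⟩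
    · simp only [Finset.mem_filter, Finset.mem_range]
      omega
    · rw [ha]; congr 1; simp only; omega
  choose b hb using main
  refine ⟨Equiv.ofBijective (fun I => ⟨b I, ⟨I.1, I.2.1, hb I⟩⟩) ⟨?_, ?_⟩⟩
  · intro I I' h
    apply Subtype.ext
    have := congrArg (fun x : (Σ b : Bk R q k n,
      {I : Ideal R[X] // HasMonic (k+1) I ∧ Rel k I b.2.1.1 b.2.2.1}) => x.2.1) h
    exact this
  · rintro ⟨⟨⟨e, he⟩, ⟨J, hJ, hJc⟩, ⟨c, hc⟩⟩, ⟨I, hI, hrel⟩⟩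
    simp only [Finset.mem_filter, Finset.mem_range] at he
    have hc0 := ne_bot_of_card (c := c) (by rw [hc]; exact hqn e)
    have hIc : Nat.card (R[X] ⧸ I) = q ^ n := by
      rw [index_rel hc0 hI hJ hrel, hJc, hc, ← pow_mul, ← pow_add]
      congr 1
      rw [mul_comm e]
      simp only
      omega
    refine ⟨⟨I, hI, hIc⟩, ?_⟩
    obtain ⟨⟨⟨e', he'⟩, ⟨J', hJ', hJc'⟩, ⟨c', hc'⟩⟩, hbI⟩ :
      ∃ b', b' = b ⟨I, hI, hIc⟩ := ⟨_, rfl⟩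
    have hb' := hb ⟨I, hI, hIc⟩
    rw [← hbI] at hb'
    obtain ⟨rfl, rfl⟩ := rel_unique hc0 hJ hJ' hrel hb'
    have hee : e = e' := by
      rw [hc] at hc'
      exact Nat.pow_right_injective hq1 hc'
    subst hee
    simp only
    congr 1
    · exact hbI.symm
    · rw! [← hbI]; rfl

lemma step_card (q : ℕ) (hq : Fintype.card F = q) (hC : ∀ e, Finite (Cq R q e)) (k n : ℕ)
    (hT : ∀ n, Finite (Tk R q k n)) :
    Finite (Tk R q (k+1) n) ∧ Nat.card (Tk R q (k+1) n) =
      ∑ e ∈ (Finset.range (n+1)).filter (fun e => (k+1) * e ≤ n),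
        Nat.card (Tk R q k (n - (k+1) * e)) * (Nat.card (Cq R q e) * q ^ ((k+1) * e)) := by
  have hq1 : 1 < q := hq ▸ Fintype.one_lt_card
  have hqn : ∀ m, q ^ m ≠ 0 := fun m => pow_ne_zero _ (by omega)
  obtain ⟨E⟩ := step_equiv (R := R) F q hq k n
  have hfc : ∀ b : Bk R q k n, 
      Nat.card {I : Ideal R[X] // HasMonic (k+1) I ∧ Rel k I b.2.1.1 b.2.2.1} =
        q ^ ((k+1) * b.1.1) := by
    intro b
    rw [fiber_card (ne_bot_of_card (by rw [b.2.2.2]; exact hqn _)) b.2.1.2.1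
      (by rw [b.2.1.2.2]; exact hqn _), b.2.2.2, ← pow_mul, mul_comm]
  have hff : ∀ b : Bk R q k n, 
      Finite {I : Ideal R[X] // HasMonic (k+1) I ∧ Rel k I b.2.1.1 b.2.2.1} := fun b =>
    Nat.finite_of_card_ne_zero (by rw [hfc b]; exact hqn _)
  have hTT : ∀ e : Ek k n, Finite (Tk R q k (n - (k+1) * e.1) × Cq R q e.1) := fun e => inferInstance
  refine ⟨Finite.of_equiv _ E.symm, ?_⟩
  have : ∀ e : Ek k n, Fintype (Tk R q k (n - (k+1) * e.1) × Cq R q e.1) :=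
    fun e => Fintype.ofFinite _
  rw [Nat.card_congr E, Nat.card_sigma, Finset.sum_congr rfl fun b _ => hfc b]
  rw [Fintype.sum_sigma]
  rw [← Finset.sum_coe_sort ((Finset.range (n+1)).filter (fun e => (k+1) * e ≤ n))]
  refine Finset.sum_congr (by rfl) fun e _ => ?_
  dsimp only
  rw [Finset.sum_const, Finset.card_univ, ← Nat.card_eq_fintype_card, Nat.card_prod, smul_eq_mul,
    mul_assoc]

lemma card_T_zero (q : ℕ) (hq1 : 1 < q) (n : ℕ) :
    Finite (Tk R q 0 n) ∧ Nat.card (Tk R q 0 n) = if n = 0 then 1 else 0 := by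
  have htop : ∀ I : Ideal R[X], HasMonic 0 I ↔ I = ⊤ := by
    intro I
    constructor
    · rintro ⟨g, hgI, hg, h0⟩
      rw [Ideal.eq_top_iff_one, ← hg.natDegree_eq_zero.1 h0]
      exact hgI
    · rintro rfl
      exact ⟨1, trivial, Polynomial.monic_one, by simp⟩
  have hsub : Subsingleton (Tk R q 0 n) :=
    ⟨fun a b => Subtype.ext (((htop _).1 a.2.1).trans ((htop _).1 b.2.1).symm)⟩
  have hc1 : Nat.card (R[X] ⧸ (⊤ : Ideal R[X])) = 1 := by
    have : Subsingleton (R[X] ⧸ (⊤ : Ideal R[X])) := Ideal.Quotient.subsingleton_iff.2 rfl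
    exact Nat.card_of_subsingleton 0
  refine ⟨inferInstance, ?_⟩
  split_ifs with h
  · subst h
    exact Nat.card_of_subsingleton ⟨⊤, (htop _).2 rfl, by rw [hc1, pow_zero]⟩
  · have : IsEmpty (Tk R q 0 n) := by
      refine ⟨fun I => ?_⟩
      have h1 := I.2.2
      rw [(htop _).1 I.2.1, hc1] at h1
      have := Nat.one_lt_pow h hq1
      omega
    exact Nat.card_of_isEmpty

lemma finite_T (q : ℕ) (hq : Fintype.card F = q) (hC : ∀ e, Finite (Cq R q e)) (k n : ℕ) :
    Finite (Tk R q k n) := by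
  induction k generalizing n with
  | zero => exact (card_T_zero q (hq ▸ Fintype.one_lt_card) n).1
  | succ k ih => exact (step_card F q hq hC k n ih).1

lemma hasMonic_of_card (q : ℕ) (hq : Fintype.card F = q) (k n : ℕ) (hk : n ≤ k) (I : Ideal R[X])
    (hI : Nat.card (R[X] ⧸ I) = q ^ n) : HasMonic k I := by
  have hq1 : 1 < q := hq ▸ Fintype.one_lt_card
  have hfin : Finite (R[X] ⧸ I) :=
    Nat.finite_of_card_ne_zero (by rw [hI]; exact pow_ne_zero _ (by omega))
  have : Module.Finite F (R[X] ⧸ I) := Module.Finite.of_finite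
  have h1 := Module.natCard_eq_pow_finrank (K := F) (V := R[X] ⧸ I)
  rw [hI, Nat.card_eq_fintype_card, hq] at h1
  have h2 := Nat.pow_right_injective hq1 h1
  set x : R[X] ⧸ I := Ideal.Quotient.mk I X with hx
  set p := minpoly F x
  have hintx : IsIntegral F x := Algebra.IsIntegral.isIntegral x
  have hdeg : p.natDegree ≤ n := by
    rw [h2]
    exact minpoly.natDegree_le x
  have hm : p.Monic := minpoly.monic hintx
  have hroot : p.map (algebraMap F R) ∈ I := by
    rw [← Ideal.Quotient.eq_zero_iff_mem, ← minpoly.aeval F x]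
    have e : ∀ r : F[X], Ideal.Quotient.mk I (r.map (algebraMap F R)) = aeval x r := by
      intro r
      induction r using Polynomial.induction_on' with
      | add p q hp hq => rw [Polynomial.map_add, map_add, map_add, hp, hq]
      | monomial n a =>
        rw [Polynomial.map_monomial, Polynomial.aeval_monomial, ← Polynomial.C_mul_X_pow_eq_monomial,
          map_mul, map_pow]
        rfl
    exact e p
  refine ⟨p.map (algebraMap F R) * X ^ (k - p.natDegree), I.mul_mem_right _ hroot,
    (hm.map _).mul (Polynomial.monic_X_pow _), ?_⟩
  rw [(hm.map _).natDegree_mul (Polynomial.monic_X_pow _), hm.natDegree_map, natDegree_X_pow]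
  omega

end recur

open scoped PowerSeries.WithPiTopology in
/-- The factors of the partition generating function. -/
noncomputable def Wfac {S : Type*} [CommSemiring S] [TopologicalSpace S] (f : ℕ → ℕ → S) (i : ℕ) :
    PowerSeries S :=
  1 + ∑' j, f (i + 1) (j + 1) • (PowerSeries.X : PowerSeries S) ^ ((i + 1) * (j + 1))

open scoped PowerSeries.WithPiTopology in
lemma coeff_factor {S : Type*} [CommSemiring S] [TopologicalSpace S] [T2Space S]
    (f : ℕ → ℕ → S) (i m : ℕ) (hf : f (i+1) 0 = 1) :
    PowerSeries.coeff m (Wfac f i) = if (i + 1) ∣ m then f (i+1) (m / (i+1)) else 0 := by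
  rw [Wfac, map_add, (Nat.Partition.summable_genFun_term f i).map_tsum _
    (PowerSeries.WithPiTopology.continuous_coeff S m)]
  simp only [map_smul, PowerSeries.coeff_X_pow, PowerSeries.coeff_one, smul_eq_mul]
  have hz : ∀ g : ℕ → S, (∀ j, g j = 0) → ∑' j, g j = 0 := fun g hg => by simp [hg]
  split_ifs with h0 h1 h1
  · subst h0
    rw [hz _ ?_] 
    · simp [hf]
    · intro j
      rw [if_neg (by positivity), mul_zero]
  · subst h0; simp at h1
  · obtain ⟨j, rfl⟩ := h1
    have hj : j ≠ 0 := by rintro rfl; simp at h0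
    obtain ⟨j, rfl⟩ := Nat.exists_eq_succ_of_ne_zero hj
    rw [tsum_eq_single j ?_]
    · simp
    · intro b hb
      rw [if_neg, mul_zero]
      intro he
      have := Nat.eq_of_mul_eq_mul_left (Nat.succ_pos i) he
      omega
  · rw [zero_add]
    refine hz _ fun j => ?_
    rw [if_neg, mul_zero]
    rintro rfl
    exact h1 (Dvd.intro _ rfl)

open scoped PowerSeries.WithPiTopology in
theorem abstract_count (F : Type*) [Field F] [Fintype F] [Algebra F R] [Infinite R]
    (q : ℕ) (hq : Fintype.card F = q) (hC : ∀ e, Finite (Cq R q e))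
    (hC0 : Nat.card (Cq R q 0) = 1) (n : ℕ) :
    Nat.card {I : Ideal R[X] // Nat.card (R[X] ⧸ I) = q ^ n} =
      ∑ p : n.Partition, p.parts.toFinsupp.prod 
        (fun i j => Nat.card (Cq R q j) * q ^ (i * j)) := by
  have hq1 : 1 < q := hq ▸ Fintype.one_lt_card
  set f : ℕ → ℕ → ℕ := fun i j => Nat.card (Cq R q j) * q ^ (i * j) with hf
  have hf0 : ∀ i, f i 0 = 1 := fun i => by simp [hf, hC0]
  set W : ℕ → PowerSeries ℕ := Wfac f with hW
  have hprod : ∀ k, PowerSeries.mk (fun n => Nat.card (Tk R q k n)) = 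
      ∏ i ∈ Finset.range k, W i := by
    intro k
    induction k with
    | zero =>
      ext m
      rw [PowerSeries.coeff_mk, (card_T_zero q hq1 m).2]
      simp [PowerSeries.coeff_one]
    | succ k ih =>
      rw [Finset.prod_range_succ, ← ih]
      ext m
      rw [PowerSeries.coeff_mk, (step_card F q hq hC k m (finite_T F q hq hC k)).2,
        PowerSeries.coeff_mul]
      simp only [PowerSeries.coeff_mk, hW, coeff_factor f k _ (hf0 _), mul_ite, mul_zero]
      rw [← Finset.sum_filter]
      refine Finset.sum_bij' (fun e _ => (m - (k+1) * e, (k+1) * e)) (fun p _ => p.2 / (k+1))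
        ?_ ?_ ?_ ?_ ?_
      · intro e he
        simp only [Finset.mem_filter, Finset.mem_range] at he
        simp only [Finset.mem_filter, Finset.HasAntidiagonal.mem_antidiagonal]
        exact ⟨by omega, Dvd.intro _ rfl⟩
      · rintro ⟨a, b⟩ hab
        simp only [Finset.mem_filter, Finset.HasAntidiagonal.mem_antidiagonal] at hab
        obtain ⟨hab, e, rfl⟩ := hab
        simp only [Finset.mem_filter, Finset.mem_range]
        rw [Nat.mul_div_cancel_left _ (Nat.succ_pos k)]
        constructor
        · nlinarith
        · omega
      · intro e he
        simp only
        rw [Nat.mul_div_cancel_left _ (Nat.succ_pos k)]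
      · rintro ⟨a, b⟩ hab
        simp only [Finset.mem_filter, Finset.HasAntidiagonal.mem_antidiagonal] at hab
        obtain ⟨hab, e, rfl⟩ := hab
        simp only
        rw [Nat.mul_div_cancel_left _ (Nat.succ_pos k)]
        congr 1
        omega
      · intro e he
        simp only
        rw [Nat.mul_div_cancel_left _ (Nat.succ_pos k)]
  have h1 := (Nat.Partition.hasProd_genFun f).tendsto_prod_nat
  rw [PowerSeries.WithPiTopology.tendsto_iff_coeff_tendsto] at h1
  have h2 := h1 n
  rw [Nat.Partition.coeff_genFun] at h2
  refine tendsto_nhds_unique (tendsto_atTop_of_eventually_const (i₀ := n) fun k hk => ?_) h2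
  change PowerSeries.coeff n (∏ i ∈ Finset.range k, W i) = _
  rw [← hprod k, PowerSeries.coeff_mk]
  exact Nat.card_congr (Equiv.subtypeEquivRight fun I =>
    ⟨fun h => h.2, fun h => ⟨hasMonic_of_card F q hq k n hk I h, h⟩⟩)

end core

section laurent
variable (F : Type*) [Field F]
open LaurentPolynomial

lemma isPrincipal_laurent : IsPrincipalIdealRing F[T;T⁻¹] := by
  refine ⟨fun J => ?_⟩
  have h := IsLocalization.map_under (Submonoid.powers (X : F[X])) F[T;T⁻¹] J
  obtain ⟨p, hp⟩ := (IsPrincipalIdealRing.principal (Ideal.under F[X] J)).principal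
  rw [hp] at h
  refine ⟨⟨toLaurent p, ?_⟩⟩
  rw [← h]
  change Ideal.map _ (Ideal.span {p}) = Ideal.span _
  rw [Ideal.map_span, Set.image_singleton, algebraMap_eq_toLaurent]

lemma infinite_laurent : Infinite F[T;T⁻¹] :=
  Infinite.of_injective (toLaurent : F[X] → F[T;T⁻¹]) toLaurent_injective

variable {F}

lemma coprime_pow {p : F[X]} (hp : p.coeff 0 ≠ 0) (k : ℕ) : IsCoprime (X ^ k) p :=
  IsCoprime.pow_left ((Irreducible.coprime_iff_not_dvd irreducible_X).2 (by
    rwa [X_dvd_iff]))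

lemma toLaurent_mem {p : F[X]} (hp : p.coeff 0 ≠ 0) (r : F[X]) :
    toLaurent r ∈ Ideal.span {toLaurent p} ↔ p ∣ r := by
  rw [Ideal.mem_span_singleton]
  constructor
  · rintro ⟨s, hs⟩
    obtain ⟨k, s', hs'⟩ := LaurentPolynomial.exists_T_pow s
    have h1 : toLaurent (X ^ k * r) = toLaurent (p * s') := by
      rw [map_mul, map_mul, hs', hs, toLaurent_X_pow]; ring
    have h2 := toLaurent_injective h1
    exact (coprime_pow hp k).symm.dvd_of_dvd_mul_left (Dvd.intro s' h2.symm)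
  · intro h
    exact map_dvd toLaurent h

lemma card_quot [Fintype F] {p : F[X]} (hp : p.coeff 0 ≠ 0) :
    Nat.card (F[T;T⁻¹] ⧸ Ideal.span {toLaurent p}) = Fintype.card F ^ p.natDegree := by
  have hp0 : p ≠ 0 := by rintro rfl; simp at hp
  let φ : F[X] →+* F[T;T⁻¹] ⧸ Ideal.span {toLaurent p} :=
    (Ideal.Quotient.mk _).comp toLaurent
  have hker : RingHom.ker φ = Ideal.span {p} := by
    ext r
    rw [RingHom.mem_ker, Ideal.mem_span_singleton, ← toLaurent_mem hp, 
      ← Ideal.Quotient.eq_zero_iff_mem]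
    rfl
  have hsurj : Function.Surjective φ := by
    intro y
    obtain ⟨s, rfl⟩ := Ideal.Quotient.mk_surjective y
    obtain ⟨k, s', hs'⟩ := LaurentPolynomial.exists_T_pow s
    obtain ⟨u, w, huw⟩ := coprime_pow hp k
    refine ⟨u * s', ?_⟩
    change Ideal.Quotient.mk _ (toLaurent (u * s')) = _
    rw [Ideal.Quotient.mk_eq_mk_iff_sub_mem, Ideal.mem_span_singleton]
    have h1 := congrArg toLaurent huw
    rw [map_add, map_mul, map_mul, toLaurent_X_pow, map_one] at h1
    refine ⟨- toLaurent w * s, ?_⟩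
    rw [map_mul, hs']
    linear_combination s * h1
  rw [← Nat.card_congr (RingHom.quotientKerEquivOfSurjective hsurj).toEquiv, hker]
  have hfin : Module.Finite F (F[X] ⧸ Ideal.span {p}) := by
    by_cases h : p.natDegree = 0
    · have hu : IsUnit p := by
        rw [Polynomial.isUnit_iff_degree_eq_zero, Polynomial.degree_eq_natDegree hp0, h]; rfl
      have : Subsingleton (F[X] ⧸ Ideal.span {p}) :=
        Ideal.Quotient.subsingleton_iff.2 (Ideal.span_singleton_eq_top.2 hu)
      infer_instance
    · apply Module.finite_of_finrank_pos
      rw [finrank_quotient_span_eq_natDegree]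
      omega
  rw [Module.natCard_eq_pow_finrank (K := F), finrank_quotient_span_eq_natDegree,
    Nat.card_eq_fintype_card]

/-- Monic polynomials of degree `e` with nonzero constant term. -/
abbrev Mon (F : Type*) [Field F] (e : ℕ) : Type _ :=
  {p : F[X] // (p.Monic ∧ p.natDegree = e) ∧ p.coeff 0 ≠ 0}

lemma laurent_equiv [Fintype F] (q : ℕ) (hq : Fintype.card F = q) (e : ℕ) :
    Nonempty (Mon F e ≃ Cq F[T;T⁻¹] q e) := by
  have hq1 : 1 < q := hq ▸ Fintype.one_lt_card
  refine ⟨Equiv.ofBijective (fun p => ⟨Ideal.span {toLaurent p.1}, by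
    rw [card_quot p.2.2, hq, p.2.1.2]⟩) ⟨?_, ?_⟩⟩
  · intro p p' h
    have h1 : Ideal.span {toLaurent p.1} = Ideal.span {toLaurent p'.1} := congrArg Subtype.val h
    apply Subtype.ext
    refine Polynomial.eq_of_monic_of_associated p.2.1.1 p'.2.1.1 (associated_of_dvd_dvd ?_ ?_)
    · rw [← toLaurent_mem p.2.2, h1]; exact Ideal.mem_span_singleton_self _
    · rw [← toLaurent_mem p'.2.2, ← h1]; exact Ideal.mem_span_singleton_self _
  · rintro ⟨c, hc⟩
    have := infinite_laurent F
    have := isPrincipal_laurent F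
    have hc0 : c ≠ ⊥ := ne_bot_of_card (by rw [hc]; exact pow_ne_zero _ (by omega))
    have h := IsLocalization.map_under (Submonoid.powers (X : F[X])) F[T;T⁻¹] c
    obtain ⟨p, hp⟩ := (IsPrincipalIdealRing.principal (Ideal.under F[X] c)).principal
    change _ = Ideal.span {p} at hp
    have hp0 : p ≠ 0 := by
      rintro rfl
      rw [hp] at h
      simp [Ideal.map_span] at h
      exact hc0 h.symm
    have hmon := Polynomial.monic_mul_leadingCoeff_inv hp0
    set g := p * Polynomial.C p.leadingCoeff⁻¹ with hg
    have hu : IsUnit (Polynomial.C p.leadingCoeff⁻¹) :=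
      Polynomial.isUnit_C.2 (isUnit_iff_ne_zero.2 (inv_ne_zero (leadingCoeff_ne_zero.2 hp0)))
    have hpg : Ideal.span {p} = Ideal.span {g} :=
      (Ideal.span_singleton_mul_right_unit hu p).symm
    rw [hpg] at hp
    have hcg : Ideal.span {toLaurent g} = c := by
      rw [← h, hp, Ideal.map_span, Set.image_singleton, algebraMap_eq_toLaurent]
    have hmem : ∀ r : F[X], toLaurent r ∈ c ↔ g ∣ r := by
      intro r
      rw [← Ideal.mem_span_singleton, ← hp, Ideal.under_def, Ideal.mem_comap,
        algebraMap_eq_toLaurent]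
    have hg0 : g.coeff 0 ≠ 0 := by
      intro h0
      obtain ⟨g', hg'⟩ := X_dvd_iff.2 h0
      have h1 : toLaurent g ∈ c := (hmem g).2 dvd_rfl
      rw [hg', map_mul, toLaurent_X, Ideal.unit_mul_mem_iff_mem _ (isUnit_T 1), hmem] at h1
      have hg'0 : g' ≠ 0 := by rintro rfl; simp at hg'; exact hmon.ne_zero hg'
      have h2 := Polynomial.natDegree_le_of_dvd h1 hg'0
      rw [hg', Polynomial.natDegree_X_mul hg'0] at h2
      omega
    refine ⟨⟨g, ⟨hmon, ?_⟩, hg0⟩, Subtype.ext hcg⟩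
    have h3 := card_quot hg0
    rw [hcg, hc, hq] at h3
    exact (Nat.pow_right_injective hq1 h3).symm

lemma card_Mon_zero : Nat.card (Mon F 0) = 1 := by
  have : Subsingleton (Mon F 0) := ⟨fun a b => Subtype.ext (by
    rw [a.2.1.1.natDegree_eq_zero.1 a.2.1.2, b.2.1.1.natDegree_eq_zero.1 b.2.1.2])⟩
  exact Nat.card_of_subsingleton ⟨1, ⟨monic_one, by simp⟩, by simp⟩

lemma card_Mon_succ [Fintype F] (e : ℕ) :
    Nat.card (Mon F (e+1)) = (Fintype.card F - 1) * Fintype.card F ^ e := by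
  classical
  have E : ({a : F // a ≠ 0} × (degreeLT F e)) ≃ Mon F (e+1) :=
    { toFun := fun x => ⟨X * (X ^ e + x.2.1) + Polynomial.C x.1.1, by
        have h1 : (X ^ e + x.2.1).Monic := Polynomial.monic_X_pow_add (Polynomial.mem_degreeLT.1 x.2.2)
        have h2 : (X ^ e + x.2.1).natDegree = e := by
          rw [Polynomial.natDegree_add_eq_left_of_degree_lt, natDegree_X_pow]
          rw [degree_X_pow]
          exact Polynomial.mem_degreeLT.1 x.2.2
        have h3 : (X * (X ^ e + x.2.1)).natDegree = e + 1 := by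
          rw [Polynomial.natDegree_X_mul h1.ne_zero, h2]
        have h4 : (Polynomial.C x.1.1).degree < (X * (X ^ e + x.2.1)).degree := by
          apply Polynomial.degree_lt_degree
          rw [h3]; simp
        refine ⟨⟨(monic_X.mul h1).add_of_left h4, ?_⟩, ?_⟩
        · rw [Polynomial.natDegree_add_eq_left_of_degree_lt h4, h3]
        · simpa using x.1.2⟩
      invFun := fun p => ⟨⟨p.1.coeff 0, p.2.2⟩, ⟨p.1.divX - X ^ e, by
        rw [Polynomial.mem_degreeLT, Polynomial.degree_lt_iff_coeff_zero]
        intro m hm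
        rw [coeff_sub, coeff_divX, coeff_X_pow]
        split_ifs with h
        · subst h
          have := p.2.1.1.coeff_natDegree
          rw [p.2.1.2] at this
          rw [this, sub_self]
        · rw [Polynomial.coeff_eq_zero_of_natDegree_lt (by rw [p.2.1.2]; omega), sub_zero]⟩⟩
      left_inv := by
        rintro ⟨⟨a, ha⟩, ⟨r, hr⟩⟩
        ext
        · simp
        · simp [coeff_divX]
      right_inv := by
        rintro ⟨p, hp⟩
        apply Subtype.ext
        simp [Polynomial.X_mul_divX_add] }
  rw [← Nat.card_congr E, Nat.card_prod, Nat.card_congr (degreeLTEquiv F e).toEquiv,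
    Nat.card_eq_fintype_card, Nat.card_eq_fintype_card, Fintype.card_fun, Fintype.card_fin]
  congr 1
  rw [Fintype.card_subtype_compl]
  simp

lemma card_Cq [Fintype F] (q : ℕ) (hq : Fintype.card F = q) (e : ℕ) :
    Nat.card (Cq F[T;T⁻¹] q e) = if e = 0 then 1 else (q - 1) * q ^ (e - 1) := by
  obtain ⟨E⟩ := laurent_equiv q hq e
  rw [← Nat.card_congr E]
  cases e with
  | zero => simp [card_Mon_zero]
  | succ e => simp [card_Mon_succ, hq]

lemma finite_Cq [Fintype F] (q : ℕ) (hq : Fintype.card F = q) (e : ℕ) :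
    Finite (Cq F[T;T⁻¹] q e) := by
  have hq1 : 1 < q := hq ▸ Fintype.one_lt_card
  apply Nat.finite_of_card_ne_zero
  rw [card_Cq q hq]
  split_ifs
  · simp
  · exact mul_ne_zero (by omega) (pow_ne_zero _ (by omega))

end laurent

lemma weight_prod (q n : ℕ) (hq : 1 < q) (N : ℕ → ℕ)
    (hN : ∀ e, N e = if e = 0 then 1 else (q - 1) * q ^ (e - 1)) (p : n.Partition) :
    p.parts.toFinsupp.prod (fun i j => N j * q ^ (i * j)) =
      (q - 1) ^ p.parts.toFinset.card * q ^ (n + p.parts.card - p.parts.toFinset.card) := by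
  have hcnt : ∀ i ∈ p.parts.toFinset, 1 ≤ p.parts.count i := fun i hi =>
    Multiset.one_le_count_iff_mem.2 (Multiset.mem_toFinset.1 hi)
  rw [Finsupp.prod, Multiset.toFinsupp_support]
  have h1 : ∀ i ∈ p.parts.toFinset, N (p.parts.toFinsupp i) * q ^ (i * p.parts.toFinsupp i) =
      (q - 1) * q ^ ((p.parts.count i - 1) + i * p.parts.count i) := by
    intro i hi
    have := hcnt i hi
    rw [Multiset.toFinsupp_apply, hN, if_neg (by omega), mul_assoc, ← pow_add]
  rw [Finset.prod_congr rfl h1, Finset.prod_mul_distrib, Finset.prod_const, Finset.prod_pow_eq_pow_sum,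
    Finset.sum_add_distrib]
  congr 2
  have h2 : ∑ i ∈ p.parts.toFinset, p.parts.count i = p.parts.card := Multiset.toFinset_sum_count_eq _
  have h3 : ∑ i ∈ p.parts.toFinset, i * p.parts.count i = n := by
    conv_rhs => rw [← p.parts_sum, Finset.sum_multiset_count]
    exact Finset.sum_congr rfl fun i _ => by rw [smul_eq_mul, mul_comm]
  have h4 : ∑ i ∈ p.parts.toFinset, (p.parts.count i - 1) + p.parts.toFinset.card = p.parts.card := by
    rw [← h2, Finset.card_eq_sum_ones, ← Finset.sum_add_distrib]
    exact Finset.sum_congr rfl fun i hi => Nat.sub_add_cancel (hcnt i hi)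
  rw [h3]
  omega

lemma card_iff_finrank (F : Type*) [Field F] [Fintype F] (M : Type*) [AddCommGroup M] [Module F M]
    (n : ℕ) (hn : 1 ≤ n) : Module.finrank F M = n ↔ Nat.card M = Fintype.card F ^ n := by
  have hq1 : 1 < Fintype.card F := Fintype.one_lt_card
  constructor
  · intro h
    have : Module.Finite F M := Module.finite_of_finrank_pos (by omega)
    rw [Module.natCard_eq_pow_finrank (K := F), h, Nat.card_eq_fintype_card]
  · intro h
    have := Nat.finite_of_card_ne_zero (α := M) (by rw [h]; exact pow_ne_zero _ (by omega))
    have : Module.Finite F M := Module.Finite.of_finite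
    rw [Module.natCard_eq_pow_finrank (K := F), Nat.card_eq_fintype_card] at h
    exact Nat.pow_right_injective hq1 h

lemma card_transfer {A B : Type*} [CommRing A] [CommRing B] (f : A ≃+* B) (m : ℕ) :
    Nat.card {I : Ideal A // Nat.card (A ⧸ I) = m} = Nat.card {I : Ideal B // Nat.card (B ⧸ I) = m} := by
  refine Nat.card_congr (Equiv.subtypeEquiv f.symm.idealComapOrderIso.toEquiv fun I => ?_)
  rw [Nat.card_congr (Ideal.quotientEquiv I (f.symm.idealComapOrderIso I) f ?_).toEquiv]
  · rfl
  · exact (Ideal.map_comap_of_equiv f).symm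

end PL

/-- For a partition `λ` of `n`, `ℓ(λ) = λ.parts.card` is the number of parts and
`v(λ) = λ.parts.toFinset.card` is the number of distinct part sizes.  The number of
codimension-`n` ideals of `F[x,y,y⁻¹]` is `∑_{λ ⊢ n} (q-1)^{v(λ)} q^{n+ℓ(λ)-v(λ)}`. -/
theorem number_of_codim_n_ideals_of_partial_localization (n : ℕ) (hn : 1 ≤ n)
    (F : Type*) [Field F] [Fintype F] (q : ℕ) (hq : Fintype.card F = q) :
    (Nat.card {I : Ideal (AddMonoidAlgebra F (ℕ × ℤ)) //
        Module.finrank F (AddMonoidAlgebra F (ℕ × ℤ) ⧸ I) = n} : ℤ) =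
      ∑ lam : Nat.Partition n,
        ((q : ℤ) - 1) ^ lam.parts.toFinset.card *
          (q : ℤ) ^ (n + lam.parts.card - lam.parts.toFinset.card) := by
  have := PL.isPrincipal_laurent F
  have := PL.infinite_laurent F
  have hq1 : 1 < q := hq ▸ Fintype.one_lt_card
  have e : AddMonoidAlgebra F (ℕ × ℤ) ≃+* Polynomial (LaurentPolynomial F) :=
    (AddMonoidAlgebra.curryRingEquiv).trans (Polynomial.toFinsuppIso _).symm
  have h1 : Nat.card {I : Ideal (AddMonoidAlgebra F (ℕ × ℤ)) //
        Module.finrank F (AddMonoidAlgebra F (ℕ × ℤ) ⧸ I) = n} =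
      Nat.card {I : Ideal (AddMonoidAlgebra F (ℕ × ℤ)) //
        Nat.card (AddMonoidAlgebra F (ℕ × ℤ) ⧸ I) = q ^ n} :=
    Nat.card_congr (Equiv.subtypeEquivRight fun I => by
      rw [← hq]; exact PL.card_iff_finrank F _ n hn)
  rw [h1, PL.card_transfer e, PL.abstract_count F q hq (PL.finite_Cq q hq)
    (by rw [PL.card_Cq q hq, if_pos rfl]), Nat.cast_sum]
  refine Finset.sum_congr rfl fun p _ => ?_
  rw [PL.weight_prod q n hq1 _ (PL.card_Cq (F := F) q hq)]
  push_cast [Nat.cast_sub hq1.le]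
  rfl
end

section
/- Let F_q be a finite field with q elements, let d, h ≥ 1 be integers, and let Q₁, …, Q_h ∈ F_q[y] be polynomials whose ideal-theoretic gcd is 1 (i.e. they are coprime as a family). Then the number of (h+1)-tuples (P, P₁, …, P_h) of polynomials in F_q[y] such that (i) P is monic of degree d with P(0) ≠ 0, (ii) each P_i has degree < d, and (iii) P and P₁Q₁ + ⋯ + P_hQ_h are coprime, equals (q−1)² · q^{(h−1)d} · (q^{2d} − 1)/(q² − 1). -/
open Polynomial in
/-- Monic polynomials of degree `k` with nonzero constant term. -/
def MonNZ (F : Type*) [Field F] (k : ℕ) : Set (Polynomial F) :=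
  {P | P.Monic ∧ P.natDegree = k ∧ P.eval 0 ≠ 0}

/-- Coprime pairs. -/
def CopPairs (F : Type*) [Field F] (d : ℕ) : Set (Polynomial F × Polynomial F) :=
  {p | p.1 ∈ MonNZ F d ∧ p.2.degree < d ∧ IsCoprime p.1 p.2}

theorem card_fiber_aux {V W : Type*} [AddCommGroup V] [AddCommGroup W] [Finite V] [Finite W]
    (L : V →+ W) (hL : Function.Surjective L) (p : W → Prop) :
    Nat.card {f : V // p (L f)} = Nat.card {R : W // p R} * Nat.card L.ker := by
  classical
  choose s hs using hL
  rw [← Nat.card_prod]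
  refine Nat.card_congr ⟨fun f => (⟨L f.1, f.2⟩, ⟨f.1 - s (L f.1), ?_⟩),
    fun x => ⟨x.2.1 + s x.1.1, ?_⟩, ?_, ?_⟩
  · simp [AddMonoidHom.mem_ker, hs]
  · have := x.2.2
    rw [AddMonoidHom.mem_ker] at this
    rw [map_add, this, hs, zero_add]
    exact x.1.2
  · intro f; simp
  · rintro ⟨⟨R, hR⟩, ⟨k, hk⟩⟩
    rw [AddMonoidHom.mem_ker] at hk
    simp [hk, hs]

instance finite_degreeLT_aux (F : Type*) [Field F] [Fintype F] (d : ℕ) :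
    Finite (Polynomial.degreeLT F d) :=
  Finite.of_equiv _ (Polynomial.degreeLTEquiv F d).toEquiv.symm

theorem card_degreeLT_aux (F : Type*) [Field F] [Fintype F] (d : ℕ) :
    Nat.card (Polynomial.degreeLT F d) = Fintype.card F ^ d := by
  rw [Nat.card_congr (Polynomial.degreeLTEquiv F d).toEquiv]
  simp

theorem isCoprime_modByMonic_aux {F : Type*} [Field F] (P S : Polynomial F) :
    IsCoprime P (S %ₘ P) ↔ IsCoprime P S := by
  conv_rhs => rw [← Polynomial.modByMonic_add_div S P]
  rw [IsCoprime.add_mul_left_right_iff]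

theorem degree_lt_of_monNZ {F : Type*} [Field F] {d : ℕ} {P : Polynomial F} (hP : P ∈ MonNZ F d)
    (S : Polynomial F) : (S %ₘ P).degree < d := by
  have h1 := Polynomial.degree_modByMonic_lt S hP.1
  rwa [Polynomial.degree_eq_natDegree hP.1.ne_zero, hP.2.1] at h1

theorem card_fixedP (F : Type*) [Field F] [Fintype F] (d h : ℕ) (hh : 1 ≤ h)
    (Q : Fin h → Polynomial F) (hQ : Ideal.span (Set.range Q) = ⊤) (P : Polynomial F)
    (hP : P ∈ MonNZ F d) :
    Nat.card {f : Fin h → Polynomial.degreeLT F d //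
      IsCoprime P (∑ i, (f i : Polynomial F) * Q i)} =
    Nat.card {R : Polynomial.degreeLT F d // IsCoprime P (R : Polynomial F)} *
      Fintype.card F ^ ((h - 1) * d) := by
  let L : (Fin h → Polynomial.degreeLT F d) →+ Polynomial.degreeLT F d :=
    { toFun := fun f => ⟨(∑ i, (f i : Polynomial F) * Q i) %ₘ P,
        Polynomial.mem_degreeLT.2 (degree_lt_of_monNZ hP _)⟩
      map_zero' := by ext1; simp
      map_add' := by
        intro f g
        ext1
        simp [add_mul, Finset.sum_add_distrib, Polynomial.add_modByMonic] }
  have hL : Function.Surjective L := by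
    intro R
    have h1 : (1 : Polynomial F) ∈ Ideal.span (Set.range Q) := by rw [hQ]; trivial
    obtain ⟨c, hc⟩ := (Ideal.mem_span_range_iff_exists_fun).1 h1
    refine ⟨fun i => ⟨(R.1 * c i) %ₘ P, Polynomial.mem_degreeLT.2 (degree_lt_of_monNZ hP _)⟩, ?_⟩
    ext1
    show (∑ i, ((R.1 * c i) %ₘ P) * Q i) %ₘ P = R.1
    have h2 : (R.1 : Polynomial F) %ₘ P = R.1 := by
      rw [Polynomial.modByMonic_eq_self_iff hP.1, Polynomial.degree_eq_natDegree hP.1.ne_zero,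
        hP.2.1]
      exact Polynomial.mem_degreeLT.1 R.2
    conv_rhs => rw [← h2, ← mul_one R.1, ← hc, Finset.mul_sum]
    apply Polynomial.modByMonic_eq_of_dvd_sub hP.1
    rw [← Finset.sum_sub_distrib]
    refine Finset.dvd_sum fun i _ => ⟨-((R.1 * c i) /ₘ P) * Q i, ?_⟩
    rw [Polynomial.modByMonic_eq_sub_mul_div]
    ring
  have e1 := card_fiber_aux L hL (fun R => IsCoprime P (R : Polynomial F))
  have e2 := card_fiber_aux L hL (fun _ => True)
  have e3 : ∀ f, IsCoprime P ((L f : Polynomial F)) ↔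
      IsCoprime P (∑ i, (f i : Polynomial F) * Q i) := fun f => isCoprime_modByMonic_aux P _
  simp only [e3] at e1
  rw [e1]
  congr 1
  rw [Nat.card_congr (Equiv.subtypeUnivEquiv (fun _ => trivial)),
    Nat.card_congr (Equiv.subtypeUnivEquiv (fun _ => trivial)), Nat.card_pi] at e2
  simp only [card_degreeLT_aux, Finset.prod_const, Finset.card_univ, Fintype.card_fin] at e2
  have hpos : 0 < Fintype.card F ^ d := pow_pos Fintype.card_pos _
  apply Nat.eq_of_mul_eq_mul_left hpos
  rw [← e2, ← pow_mul, ← pow_add]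
  congr 1
  obtain ⟨k, rfl⟩ := Nat.exists_eq_add_of_le hh
  simp; ring

theorem card_MonNZ_zero (F : Type*) [Field F] [Fintype F] : Nat.card (MonNZ F 0) = 1 := by
  have : MonNZ F 0 = {1} := by
    ext P
    constructor
    · rintro ⟨h1, h2, h3⟩
      exact (Polynomial.Monic.natDegree_eq_zero h1).1 h2
    · rintro rfl
      exact ⟨Polynomial.monic_one, by simp, by simp⟩
  rw [this]; simp

open Polynomial in
theorem card_MonNZ_succ (F : Type*) [Field F] [Fintype F] (k : ℕ) :
    Nat.card (MonNZ F (k + 1)) = (Fintype.card F - 1) * Fintype.card F ^ k := by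
  classical
  rw [← card_degreeLT_aux F k, ← Fintype.card_units, ← Nat.card_eq_fintype_card, ← Nat.card_prod]
  symm
  have key : ∀ f : Polynomial.degreeLT F k, ∀ c : F,
      (X ^ (k+1) + (X * (f : F[X]) + C c)).Monic ∧ 
      (X ^ (k+1) + (X * (f : F[X]) + C c)).natDegree = k + 1 := by
    intro f c
    have hf := Polynomial.mem_degreeLT.1 f.2
    have h1 : (X * (f : F[X]) + C c).degree < ((k + 1 : ℕ) : WithBot ℕ) := by
      rw [Polynomial.degree_lt_iff_coeff_zero] at hf ⊢
      intro m hm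
      obtain ⟨m, rfl⟩ : ∃ n, m = n + 1 := ⟨m - 1, by omega⟩
      simp [coeff_X_mul, coeff_C, hf m (by omega)]
    refine ⟨Polynomial.monic_X_pow_add (n := k+1) (by simpa using h1), ?_⟩
    apply natDegree_eq_of_degree_eq_some
    rw [degree_add_eq_left_of_degree_lt] <;> simpa using h1
  refine Nat.card_congr (Equiv.ofBijective (fun x : Fˣ × Polynomial.degreeLT F k =>
    (⟨X ^ (k+1) + (X * (x.2 : F[X]) + C (x.1 : F)), (key x.2 x.1).1, (key x.2 x.1).2, by simp⟩ :
      MonNZ F (k+1))) ⟨?_, ?_⟩)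
  · rintro ⟨c, f⟩ ⟨c', f'⟩ h
    have h := congrArg Subtype.val h
    simp only [add_right_inj] at h
    have h0 := congrArg (Polynomial.eval 0) h
    simp at h0
    obtain rfl := Units.ext h0
    simp at h
    rw [h]
  · rintro ⟨P, h1, h2, h3⟩
    have hd : (P - X ^ (k+1)).divX.degree < (k : WithBot ℕ) := by
      rw [Polynomial.degree_lt_iff_coeff_zero]
      intro m hm
      rw [coeff_divX, coeff_sub, coeff_X_pow]
      split_ifs with hmk
      · rw [hmk, ← h2, h1.coeff_natDegree, sub_self]
      · rw [coeff_eq_zero_of_natDegree_lt (by omega), sub_zero]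
    refine ⟨(Units.mk0 _ h3, ⟨(P - X ^ (k+1)).divX, Polynomial.mem_degreeLT.2 hd⟩), ?_⟩
    ext1
    have := Polynomial.X_mul_divX_add (P - X ^ (k+1))
    simp [coeff_X_pow, coeff_zero_eq_eval_zero] at this
    simp [this]

instance finite_MonNZ (F : Type*) [Field F] [Fintype F] (k : ℕ) : Finite (MonNZ F k) := by
  have : ∀ P ∈ MonNZ F k, P ∈ (Polynomial.degreeLT F (k+1) : Set (Polynomial F)) := by
    rintro P ⟨h1, h2, h3⟩
    rw [SetLike.mem_coe, Polynomial.mem_degreeLT, Polynomial.degree_eq_natDegree h1.ne_zero, h2]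
    exact_mod_cast Nat.lt_succ_self k
  exact Set.Finite.subset (finite_degreeLT_aux F (k+1)) this

instance finite_CopPairs (F : Type*) [Field F] [Fintype F] (k : ℕ) : Finite (CopPairs F k) := by
  refine Set.Finite.subset (Set.Finite.prod (Set.toFinite (MonNZ F k))
    (finite_degreeLT_aux F k)) ?_
  rintro ⟨a, b⟩ ⟨h1, h2, h3⟩
  exact ⟨h1, Polynomial.mem_degreeLT.2 h2⟩

theorem monNZ_mul {F : Type*} [Field F] {a b : ℕ} {P R : Polynomial F} (hP : P ∈ MonNZ F a)
    (hR : R ∈ MonNZ F b) : P * R ∈ MonNZ F (a + b) :=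
  ⟨hP.1.mul hR.1, by rw [hP.1.natDegree_mul hR.1, hP.2.1, hR.2.1],
    by rw [Polynomial.eval_mul]; exact mul_ne_zero hP.2.2 hR.2.2⟩

theorem degree_mul_lt_iff_aux {F : Type*} [Field F] {a b : ℕ} {G R : Polynomial F}
    (hG : G ∈ MonNZ F a) : (G * R).degree < ((a + b : ℕ) : WithBot ℕ) ↔ R.degree < b := by
  rw [Polynomial.degree_mul, Polynomial.degree_eq_natDegree hG.1.ne_zero, hG.2.1]
  by_cases hR : R = 0
  · simp [hR, WithBot.bot_lt_coe]
  · rw [Polynomial.degree_eq_natDegree hR]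
    norm_cast
    omega

theorem gcd_unique_aux {F : Type*} [Field F] {G P R G' P' R' : Polynomial F}
    (h : IsCoprime P R) (h1 : G * P = G' * P') (h2 : G * R = G' * R') : G' ∣ G := by
  obtain ⟨u, v, huv⟩ := h
  refine ⟨u * P' + v * R', ?_⟩
  linear_combination u * h1 + v * h2 - G * huv

theorem gcd_count (F : Type*) [Field F] [Fintype F] (d : ℕ) :
    Nat.card (MonNZ F d) * Fintype.card F ^ d =
      ∑ k : Fin (d + 1), Nat.card (MonNZ F k) * Nat.card (CopPairs F (d - k)) := by
  rw [← card_degreeLT_aux, ← Nat.card_prod]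
  simp_rw [← Nat.card_prod]
  rw [← Nat.card_sigma]
  symm
  have hk : ∀ k : Fin (d+1), (k : ℕ) + (d - k) = d := fun k => by omega
  refine Nat.card_congr (Equiv.ofBijective
    (fun x : (k : Fin (d + 1)) × (MonNZ F k × CopPairs F (d - k)) =>
      ((⟨x.2.1.1 * x.2.2.1.1, by
          have := monNZ_mul x.2.1.2 x.2.2.2.1
          rwa [hk] at this⟩,
        ⟨x.2.1.1 * x.2.2.1.2, by
          rw [Polynomial.mem_degreeLT]
          have := (degree_mul_lt_iff_aux (b := d - x.1) x.2.1.2).2 x.2.2.2.2.1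
          rwa [hk] at this⟩) : MonNZ F d × Polynomial.degreeLT F d)) ⟨?_, ?_⟩)
  · rintro ⟨k, ⟨G, hG⟩, ⟨⟨P, R⟩, h⟩⟩ ⟨k', ⟨G', hG'⟩, ⟨⟨P', R'⟩, h'⟩⟩ he
    simp only [Prod.mk.injEq, Subtype.mk.injEq] at he
    obtain ⟨h1, h2⟩ := he
    have e : G = G' := Polynomial.eq_of_monic_of_associated hG.1 hG'.1
      (associated_of_dvd_dvd (gcd_unique_aux h'.2.2 h1.symm h2.symm)
        (gcd_unique_aux h.2.2 h1 h2))
    subst e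
    have ek : k = k' := Fin.ext (hG.2.1.symm.trans hG'.2.1)
    subst ek
    have e1 := mul_left_cancel₀ hG.1.ne_zero h1
    have e2 := mul_left_cancel₀ hG.1.ne_zero h2
    subst e1
    subst e2
    rfl
  · rintro ⟨⟨P, hP⟩, ⟨R, hR⟩⟩
    classical
    obtain ⟨G, P', R', hG, hc, h1, h2⟩ : ∃ G P' R' : Polynomial F, G.Monic ∧ IsCoprime P' R' ∧
        P = G * P' ∧ R = G * R' := by
      have hg : gcd P R ≠ 0 := fun h0 => hP.1.ne_zero ((gcd_eq_zero_iff _ _).1 h0).1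
      obtain ⟨P', h1⟩ := gcd_dvd_left P R
      obtain ⟨R', h2⟩ := gcd_dvd_right P R
      refine ⟨gcd P R, P', R', ?_, ?_, h1, h2⟩
      · rw [← normalize_gcd]
        exact Polynomial.monic_normalize hg
      · obtain ⟨u, v, huv⟩ := exists_gcd_eq_mul_add_mul P R
        refine ⟨u, v, mul_left_cancel₀ hg ?_⟩
        linear_combination -huv - u * h1 - v * h2
    subst h1 h2
    have hP'm : P'.Monic := hG.of_mul_monic_left hP.1
    have hdeg := hP.2.1
    rw [hG.natDegree_mul hP'm] at hdeg
    have hev := hP.2.2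
    rw [Polynomial.eval_mul] at hev
    have hGm : G ∈ MonNZ F G.natDegree := ⟨hG, rfl, left_ne_zero_of_mul hev⟩
    refine ⟨⟨⟨G.natDegree, by omega⟩, ⟨G, hGm⟩, ⟨(P', R'), ⟨hP'm, ?_, right_ne_zero_of_mul hev⟩,
      ?_, hc⟩⟩, rfl⟩
    · show P'.natDegree = d - G.natDegree
      omega
    · show R'.degree < ((d - G.natDegree : ℕ) : WithBot ℕ)
      rw [← degree_mul_lt_iff_aux hGm, show G.natDegree + (d - G.natDegree) = d by omega]
      exact Polynomial.mem_degreeLT.1 hR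

theorem rec_count (F : Type*) [Field F] [Fintype F] (d : ℕ) :
    (Nat.card (MonNZ F (d+1)) : ℤ) * Fintype.card F ^ (d+1) -
      Fintype.card F * (Nat.card (MonNZ F d) * Fintype.card F ^ d) =
    Nat.card (CopPairs F (d+1)) - Nat.card (CopPairs F d) := by
  have h1 := gcd_count F (d+1)
  have h2 := gcd_count F d
  rw [Fin.sum_univ_eq_sum_range (fun k => Nat.card (MonNZ F k) * Nat.card (CopPairs F (_ - k))),
    Finset.sum_range_succ'] at h1 h2
  rw [Finset.sum_range_succ'] at h1
  simp only [card_MonNZ_succ, card_MonNZ_zero, Nat.add_sub_add_right] at h1 h2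
  have hq : 1 ≤ Fintype.card F := Fintype.card_pos
  zify [hq] at h1 h2 ⊢
  rw [h2, card_MonNZ_succ]
  push_cast [hq]
  rw [h1]
  have : ∀ k ∈ Finset.range d, ((Fintype.card F : ℤ) - 1) * Fintype.card F ^ (k + 1) *
     (Nat.card (CopPairs F (d - (k+1))) : ℤ) = Fintype.card F * (((Fintype.card F : ℤ) - 1) *
      Fintype.card F ^ k * (Nat.card (CopPairs F (d - (k+1))) : ℤ)) := by
    intros; ring
  rw [Finset.sum_congr rfl this, ← Finset.mul_sum]
  simp
  ring

theorem card_CopPairs (F : Type*) [Field F] [Fintype F] (d : ℕ) :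
    (Nat.card (CopPairs F (d+1)) : ℤ) * ((Fintype.card F : ℤ) ^ 2 - 1) =
      ((Fintype.card F : ℤ) - 1) ^ 2 * ((Fintype.card F : ℤ) ^ (2 * (d+1)) - 1) := by
  have hq : 1 ≤ Fintype.card F := Fintype.card_pos
  induction d with
  | zero =>
    have h := rec_count F 0
    have h0 := gcd_count F 0
    rw [card_MonNZ_zero] at h0
    simp [-Nat.card_coe_set_eq, card_MonNZ_zero] at h0
    rw [card_MonNZ_succ, card_MonNZ_zero] at h
    push_cast [hq, ← h0] at h
    simp only [pow_zero, zero_add, mul_one, pow_one] at h ⊢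
    linear_combination (-(Fintype.card F : ℤ) ^ 2 + 1) * h
  | succ d ih =>
    have h := rec_count F (d+1)
    rw [card_MonNZ_succ, card_MonNZ_succ] at h
    push_cast [hq] at h
    linear_combination (-(Fintype.card F : ℤ) ^ 2 + 1) * h + ih

/-- Counting `(h+1)`-tuples `(P, P₁, …, P_h)` of polynomials over `F_q` with `P` monic of
degree `d`, `P(0) ≠ 0`, `deg P_i < d`, and `P` coprime to `P₁Q₁ + ⋯ + P_hQ_h`, where
`Q₁, …, Q_h` generate the unit ideal. -/
theorem count_tuples_coprime_combination (F : Type*) [Field F] [Fintype F] (q : ℕ)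
    (hq : Fintype.card F = q) (d h : ℕ) (hd : 1 ≤ d) (hh : 1 ≤ h)
    (Q : Fin h → Polynomial F) (hQ : Ideal.span (Set.range Q) = ⊤) :
    (Nat.card {PP : Polynomial F × (Fin h → Polynomial F) //
        PP.1.Monic ∧ PP.1.natDegree = d ∧ PP.1.eval 0 ≠ 0 ∧
          (∀ i, (PP.2 i).degree < d) ∧
          IsCoprime PP.1 (∑ i, PP.2 i * Q i)} : ℚ) =
      ((q : ℚ) - 1) ^ 2 * (q : ℚ) ^ ((h - 1) * d) *
        (((q : ℚ) ^ (2 * d) - 1) / ((q : ℚ) ^ 2 - 1)) := by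
  have hcard : Nat.card {PP : Polynomial F × (Fin h → Polynomial F) //
        PP.1.Monic ∧ PP.1.natDegree = d ∧ PP.1.eval 0 ≠ 0 ∧
          (∀ i, (PP.2 i).degree < d) ∧
          IsCoprime PP.1 (∑ i, PP.2 i * Q i)} =
      Nat.card (CopPairs F d) * Fintype.card F ^ ((h - 1) * d) := by
    have e1 : {PP : Polynomial F × (Fin h → Polynomial F) //
        PP.1.Monic ∧ PP.1.natDegree = d ∧ PP.1.eval 0 ≠ 0 ∧
          (∀ i, (PP.2 i).degree < d) ∧
          IsCoprime PP.1 (∑ i, PP.2 i * Q i)} ≃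
        (P : MonNZ F d) × {f : Fin h → Polynomial.degreeLT F d //
          IsCoprime P.1 (∑ i, (f i : Polynomial F) * Q i)} :=
      { toFun := fun x => ⟨⟨x.1.1, x.2.1, x.2.2.1, x.2.2.2.1⟩,
          ⟨fun i => ⟨x.1.2 i, Polynomial.mem_degreeLT.2 (x.2.2.2.2.1 i)⟩, x.2.2.2.2.2⟩⟩
        invFun := fun y => ⟨(y.1.1, fun i => (y.2.1 i : Polynomial F)), y.1.2.1, y.1.2.2.1,
          y.1.2.2.2, fun i => Polynomial.mem_degreeLT.1 (y.2.1 i).2, y.2.2⟩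
        left_inv := fun _ => rfl
        right_inv := fun _ => rfl }
    have e2 : CopPairs F d ≃ (P : MonNZ F d) × {R : Polynomial.degreeLT F d //
          IsCoprime P.1 (R : Polynomial F)} :=
      { toFun := fun x => ⟨⟨x.1.1, x.2.1⟩,
          ⟨⟨x.1.2, Polynomial.mem_degreeLT.2 x.2.2.1⟩, x.2.2.2⟩⟩
        invFun := fun y => ⟨(y.1.1, (y.2.1 : Polynomial F)), y.1.2,
          Polynomial.mem_degreeLT.1 y.2.1.2, y.2.2⟩
        left_inv := fun _ => rfl
        right_inv := fun _ => rfl }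
    haveI : Fintype (MonNZ F d) := Fintype.ofFinite _
    rw [Nat.card_congr e1, Nat.card_congr e2, Nat.card_sigma, Nat.card_sigma, Finset.sum_mul]
    exact Finset.sum_congr rfl fun P _ => card_fixedP F d h hh Q hQ P.1 P.2
  rw [hcard, hq]
  obtain ⟨e, rfl⟩ : ∃ e, d = e + 1 := ⟨d - 1, by omega⟩
  have hc := card_CopPairs F e
  rw [hq] at hc
  have hc' : (Nat.card (CopPairs F (e+1)) : ℚ) * ((q : ℚ) ^ 2 - 1) =
      ((q : ℚ) - 1) ^ 2 * ((q : ℚ) ^ (2 * (e+1)) - 1) := by exact_mod_cast hc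
  have hq1 : (1 : ℚ) < q := by
    rw [← hq]; exact_mod_cast Fintype.one_lt_card
  have hne : (q : ℚ) ^ 2 - 1 ≠ 0 := by nlinarith
  rw [← mul_div_assoc, eq_div_iff hne]
  push_cast
  linear_combination (q : ℚ) ^ ((h - 1) * (e + 1)) * hc'
end
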